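/- For every planar simple graph G₁ on n vertices and every planar simple graph G₂ with 2·|V(G₂)| ≤ n, there exists a SefeNoMap of G₁ and G₂, i.e., a pair of planar drawings Γ₁ of G₁ and Γ₂ of G₂ such that the set of points to which vertices of G₂ are mapped in Γ₂ is a subset of the set of points to which vertices of G₁ are mapped in Γ₁, and whenever an edge of G₁ and an edge of G₂ have their endpoints mapped to the same pair of points, the two edges are represented by the same arc in Γ₁ and Γ₂. -/

import Mathlib

open Set Bornology

/-- Points of the Euclidean plane. -/
abbrev Pt : Type := ℝ × ℝ

/-- `A` is an arc connecting `p` and `q`: the image of a continuous injective map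
from `[0,1]` to the plane sending `0` to `p` and `1` to `q`. -/
def IsArcBetween (A : Set Pt) (p q : Pt) : Prop :=
  ∃ f : ℝ → Pt, ContinuousOn f (Set.Icc 0 1) ∧ Set.InjOn f (Set.Icc 0 1) ∧
    f 0 = p ∧ f 1 = q ∧ A = f '' Set.Icc 0 1

/-- A planar drawing of a finite simple graph `G`: an injective placement of the
vertices in the plane, together with an arc for each edge joining the images of its
endpoints, such that no arc passes through the image of a vertex other than its two
endpoints, and two distinct arcs intersect only at images of shared endpoints. -/
structure PlanarDrawing {V : Type} [Fintype V] (G : SimpleGraph V) where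
  ρ : V → Pt
  inj : Function.Injective ρ
  arc : Sym2 V → Set Pt
  arc_isArc : ∀ u v : V, G.Adj u v → IsArcBetween (arc s(u, v)) (ρ u) (ρ v)
  vertex_mem : ∀ e ∈ G.edgeSet, ∀ w : V, ρ w ∈ arc e → w ∈ e
  arcs_cross : ∀ e ∈ G.edgeSet, ∀ e' ∈ G.edgeSet, e ≠ e' →
    ∀ x ∈ arc e ∩ arc e', ∃ w : V, w ∈ e ∧ w ∈ e' ∧ x = ρ w

/-- A SefeNoMap of `G₁` and `G₂`: a pair of planar drawings such that the vertex
points of `Γ₂` form a subset of the vertex points of `Γ₁`, and whenever an edge of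
`G₁` and an edge of `G₂` have their endpoints mapped to the same pair of points, the
two edges are represented by the same arc. -/
def IsSefeNoMap {V₁ V₂ : Type} [Fintype V₁] [Fintype V₂]
    {G₁ : SimpleGraph V₁} {G₂ : SimpleGraph V₂}
    (Γ₁ : PlanarDrawing G₁) (Γ₂ : PlanarDrawing G₂) : Prop :=
  Set.range Γ₂.ρ ⊆ Set.range Γ₁.ρ ∧
  ∀ u v : V₁, ∀ a b : V₂, G₁.Adj u v → G₂.Adj a b →
    ({Γ₁.ρ u, Γ₁.ρ v} : Set Pt) = ({Γ₂.ρ a, Γ₂.ρ b} : Set Pt) →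
    Γ₁.arc s(u, v) = Γ₂.arc s(a, b)



namespace SN

/-! ## Tree words -/

section TW
variable {E V : Type}

/-- Side of the integer `x` with respect to the chord `g`. -/
def S (pos : E × Bool → ℤ) (g : E) (x : ℤ) : Bool :=
  (decide (pos (g, false) < x)) ^^ (decide (pos (g, true) < x))

/-- Alternation parity of two chords. -/
def alt (pos : E × Bool → ℤ) (e f : E) : Bool :=
  S pos e (pos (f, false)) ^^ S pos e (pos (f, true))

/-- Tree words. -/
structure IsTW (pos : E × Bool → ℤ) (lab : E × Bool → V) (T : Set E) : Prop where
  inj : Function.Injective pos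
  nc : ∀ e f, e ≠ f → (e ∈ T ↔ f ∈ T) → alt pos e f = false
  L : ∀ d d', lab d = lab d' ↔ ∀ g ∈ T, S pos g (pos d) = S pos g (pos d')

def Step (lab : E × Bool → V) (A : Set E) (u v : V) : Prop :=
  ∃ e ∈ A, lab (e, false) = u ∧ lab (e, true) = v

def Reach (lab : E × Bool → V) (A : Set E) : V → V → Prop := Relation.EqvGen (Step lab A)

theorem Reach.refl {lab : E × Bool → V} {A : Set E} (u : V) : Reach lab A u u :=
  Relation.EqvGen.refl u

theorem Reach.symm {lab : E × Bool → V} {A : Set E} {u v : V} (h : Reach lab A u v) :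
    Reach lab A v u := Relation.EqvGen.symm _ _ h

theorem Reach.trans {lab : E × Bool → V} {A : Set E} {u v w : V} (h : Reach lab A u v)
    (h' : Reach lab A v w) : Reach lab A u w := Relation.EqvGen.trans _ _ _ h h'

theorem Reach.mono {lab : E × Bool → V} {A B : Set E} (hAB : A ⊆ B) {u v : V}
    (h : Reach lab A u v) : Reach lab B u v := by
  induction h with
  | rel x y h => obtain ⟨e, he, h⟩ := h; exact Relation.EqvGen.rel _ _ ⟨e, hAB he, h⟩
  | refl x => exact Reach.refl x
  | symm x y _ ih => exact ih.symm
  | trans x y z _ _ ih1 ih2 => exact ih1.trans ih2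

theorem Reach.edge {lab : E × Bool → V} {A : Set E} {e : E} (he : e ∈ A) (b b' : Bool) :
    Reach lab A (lab (e, b)) (lab (e, b')) := by
  have h : Reach lab A (lab (e, false)) (lab (e, true)) :=
    Relation.EqvGen.rel _ _ ⟨e, he, rfl, rfl⟩
  cases b <;> cases b'
  · exact Reach.refl _
  · exact h
  · exact h.symm
  · exact Reach.refl _

/-- If every edge of `A` is `B`-reachable, then `A`-reach implies `B`-reach. -/
theorem Reach.of_edges {lab : E × Bool → V} {A : Set E} {R : V → V → Prop} (hR : Equivalence R)
    (hAB : ∀ e ∈ A, R (lab (e, false)) (lab (e, true))) {u v : V}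
    (h : Reach lab A u v) : R u v := by
  induction h with
  | rel x y h => obtain ⟨e, he, rfl, rfl⟩ := h; exact hAB e he
  | refl x => exact hR.refl x
  | symm x y _ ih => exact hR.symm ih
  | trans x y z _ _ ih1 ih2 => exact hR.trans ih1 ih2

theorem reach_equiv (lab : E × Bool → V) (A : Set E) : Equivalence (Reach lab A) :=
  ⟨Reach.refl, Reach.symm, Reach.trans⟩

theorem alt_comm {pos : E × Bool → ℤ} (hinj : Function.Injective pos) {e f : E} (hef : e ≠ f) :
    alt pos e f = alt pos f e := by
  have key : ∀ b b', decide (pos (e, b) < pos (f, b')) = !decide (pos (f, b') < pos (e, b)) := by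
    intro b b'
    have : pos (e, b) ≠ pos (f, b') := fun h => hef (by have := hinj h; simp at this; exact this.1)
    by_cases h : pos (e, b) < pos (f, b')
    · have : ¬ pos (f, b') < pos (e, b) := by omega
      simp [h, this]
    · have : pos (f, b') < pos (e, b) := by omega
      simp [h, this]
  simp only [alt, S, key]
  generalize decide (pos (f, false) < pos (e, false)) = a
  generalize decide (pos (f, true) < pos (e, false)) = b
  generalize decide (pos (f, false) < pos (e, true)) = c
  generalize decide (pos (f, true) < pos (e, true)) = d
  cases a <;> cases b <;> cases c <;> cases d <;> rfl

theorem alt_self {pos : E × Bool → ℤ} (hinj : Function.Injective pos) (e : E) :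
    alt pos e e = true := by
  have : pos (e, false) ≠ pos (e, true) := fun h => by have := hinj h; simp at this
  simp only [alt, S, lt_self_iff_false, decide_false]
  rcases lt_or_gt_of_ne this with h | h
  · have h' : ¬ pos (e, true) < pos (e, false) := by omega
    simp [h, h']
  · have h' : ¬ pos (e, false) < pos (e, true) := by omega
    simp [h, h']

theorem exists_minmax (pos : E × Bool → ℤ) (hinj : Function.Injective pos) (g : E) :
    ∃ b : Bool, pos (g, b) < pos (g, !b) ∧
      ∀ x, S pos g x = true ↔ (pos (g, b) < x ∧ x ≤ pos (g, !b)) := by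
  have : pos (g, false) ≠ pos (g, true) := fun h => by have := hinj h; simp at this
  rcases lt_or_gt_of_ne this with h | h
  · refine ⟨false, h, fun x => ?_⟩
    by_cases h1 : pos (g, false) < x <;> by_cases h2 : pos (g, true) < x <;> simp [S, h1, h2] <;> omega
  · refine ⟨true, h, fun x => ?_⟩
    by_cases h1 : pos (g, false) < x <;> by_cases h2 : pos (g, true) < x <;> simp [S, h1, h2] <;> omega

theorem alt_false_iff {pos : E × Bool → ℤ} {e f : E} (b : Bool) :
    alt pos e f = false ↔ S pos e (pos (f, b)) = S pos e (pos (f, !b)) := by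
  cases b <;> simp only [alt, Bool.not_false, Bool.not_true] <;>
  generalize S pos e (pos (f, false)) = x <;> generalize S pos e (pos (f, true)) = y <;>
  cases x <;> cases y <;> simp

/-- Set of tree edges separating two positions. -/
def Sep (pos : E × Bool → ℤ) (T : Set E) (x y : ℤ) : Set E :=
  {g | g ∈ T ∧ S pos g x ≠ S pos g y}

theorem Sep_symm (pos : E × Bool → ℤ) (T : Set E) (x y : ℤ) : Sep pos T x y = Sep pos T y x := by
  ext g; simp only [Sep, mem_ofPred_eq, ne_comm]

theorem walk [Finite E] {pos : E × Bool → ℤ} {lab : E × Bool → V} {T : Set E}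
    (h : IsTW pos lab T) (d d' : E × Bool) :
    Reach lab (Sep pos T (pos d) (pos d')) (lab d) (lab d') := by
  suffices H : ∀ n : ℕ, ∀ d d' : E × Bool, (Sep pos T (pos d) (pos d')).ncard = n →
      Reach lab (Sep pos T (pos d) (pos d')) (lab d) (lab d') from H _ d d' rfl
  intro n
  induction n using Nat.strong_induction_on with
  | _ n ih =>
    intro d d' hn
    by_cases hemp : Sep pos T (pos d) (pos d') = ∅
    · have : lab d = lab d' := by
        rw [h.L]
        intro g hg
        by_contra hne
        have : g ∈ Sep pos T (pos d) (pos d') := ⟨hg, hne⟩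
        rw [hemp] at this; exact this
      rw [this]; exact Reach.refl _
    · obtain ⟨g, hg, hne⟩ := Set.nonempty_iff_ne_empty.mpr hemp
      -- main claim with S g d = true
      have main : ∀ d d' : E × Bool, (Sep pos T (pos d) (pos d')).ncard = n →
          S pos g (pos d) = true → S pos g (pos d') = false →
          Reach lab (Sep pos T (pos d) (pos d')) (lab d) (lab d') := by
        intro d d' hn h1 h2
        obtain ⟨b, hb, hS⟩ := exists_minmax pos h.inj g
        have hgS : g ∈ Sep pos T (pos d) (pos d') := ⟨hg, by rw [h1, h2]; simp⟩
        have hd1 := (hS _).mp h1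
        have hd2 : ¬ (pos (g, b) < pos d' ∧ pos d' ≤ pos (g, !b)) := by
          rw [← hS, h2]; simp
        have hmin : ¬ S pos g (pos (g, b)) = true := by rw [hS]; omega
        have hmax : S pos g (pos (g, !b)) = true := by rw [hS]; omega
        have sub1 : Sep pos T (pos d) (pos (g, !b)) ⊆ Sep pos T (pos d) (pos d') \ {g} := by
          rintro k ⟨hk, hkne⟩
          have hkg : k ≠ g := by rintro rfl; exact hkne (by rw [h1, hmax])
          have hnc := (alt_false_iff b).mp (h.nc k g hkg (by simp [hk, hg]))
          obtain ⟨c, hc, hSk⟩ := exists_minmax pos h.inj k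
          have hnc2 := (alt_false_iff c).mp (h.nc g k hkg.symm (by simp [hk, hg]))
          refine ⟨⟨hk, fun heq => hkne ?_⟩, hkg⟩
          rw [Bool.eq_iff_iff, hSk, hSk] at hnc heq ⊢
          rw [Bool.eq_iff_iff, hS, hS] at hnc2
          omega
        have sub2 : Sep pos T (pos (g, b)) (pos d') ⊆ Sep pos T (pos d) (pos d') \ {g} := by
          rintro k ⟨hk, hkne⟩
          have hkg : k ≠ g := by
            rintro rfl; exact hkne (by rw [h2]; simpa using hmin)
          have hnc := (alt_false_iff b).mp (h.nc k g hkg (by simp [hk, hg]))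
          obtain ⟨c, hc, hSk⟩ := exists_minmax pos h.inj k
          have hnc2 := (alt_false_iff c).mp (h.nc g k hkg.symm (by simp [hk, hg]))
          refine ⟨⟨hk, fun heq => hkne ?_⟩, hkg⟩
          rw [Bool.eq_iff_iff, hSk, hSk] at hnc heq ⊢
          rw [Bool.eq_iff_iff, hS, hS] at hnc2
          omega
        have hlt : (Sep pos T (pos d) (pos d') \ {g}).ncard < n := by
          rw [← hn]; exact Set.ncard_sdiff_singleton_lt_of_mem hgS (Set.toFinite _)
        have r1 := ih _ (lt_of_le_of_lt (Set.ncard_le_ncard sub1 (Set.toFinite _)) hlt) d (g, !b) rfl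
        have r2 := ih _ (lt_of_le_of_lt (Set.ncard_le_ncard sub2 (Set.toFinite _)) hlt) (g, b) d' rfl
        exact (r1.mono (sub1.trans sdiff_subset)).trans
          ((Reach.edge hgS (!b) b).trans (r2.mono (sub2.trans sdiff_subset)))
      cases hx : S pos g (pos d) <;> cases hy : S pos g (pos d')
      · exact absurd (by rw [hx, hy]) hne
      · rw [Sep_symm] at hn ⊢
        exact (main d' d hn hy hx).symm
      · exact main d d' hn hx hy
      · exact absurd (by rw [hx, hy]) hne

end TW
end SN


namespace SN
section TW2
set_option linter.unusedSimpArgs false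
variable {E V : Type}

/-- Reversal of three consecutive blocks. -/
def phi (i a j b : ℤ) (x : ℤ) : ℤ :=
  if x ≤ i then x else if x ≤ a then x + b - a else if x ≤ j then x + i + b - j - a
  else if x ≤ b then x - j + i else x

theorem phi_inj {i a j b : ℤ} (h1 : i < a) (h2 : a < j) (h3 : j < b) :
    Function.Injective (phi i a j b) := by
  intro x y hxy
  simp only [phi] at hxy
  split_ifs at hxy <;> omega

theorem phi_lt {i a j b : ℤ} (h1 : i < a) (h2 : a < j) (h3 : j < b) (p x : ℤ) :
    decide (phi i a j b p < phi i a j b x) =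
      (decide (p < x) ^^ (((decide (i < p) ^^ decide (j < p)) && (decide (a < x) ^^ decide (b < x))) ^^
        ((decide (a < p) ^^ decide (b < p)) && (decide (i < x) ^^ decide (j < x))))) := by
  rcases (by omega : p ≤ i ∨ (i < p ∧ p ≤ a) ∨ (a < p ∧ p ≤ j) ∨ (j < p ∧ p ≤ b) ∨ b < p)
    with hp | hp | hp | hp | hp <;>
  rcases (by omega : x ≤ i ∨ (i < x ∧ x ≤ a) ∨ (a < x ∧ x ≤ j) ∨ (j < x ∧ x ≤ b) ∨ b < x)
    with hx | hx | hx | hx | hx <;>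
  · have e1 : decide (i < p) = decide (i < p) := rfl
    unfold phi
    by_cases hip : i < p <;> by_cases hap : a < p <;> by_cases hjp : j < p <;> by_cases hbp : b < p <;>
    try omega
    all_goals
    by_cases hix : i < x <;> by_cases hax : a < x <;> by_cases hjx : j < x <;> by_cases hbx : b < x <;>
    try omega
    all_goals
    simp only [hip, hap, hjp, hbp, hix, hax, hjx, hbx, not_lt.mp, ← not_lt, not_true_eq_false,
      not_false_eq_true, if_true, if_false, decide_true, decide_false, Bool.xor_false, Bool.false_xor,
      Bool.and_true, Bool.and_false, Bool.true_and, Bool.false_and, Bool.xor_true, Bool.not_false,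
      Bool.not_true]
    try simp only [← decide_not, decide_eq_decide, decide_eq_true_eq, decide_eq_false_iff_not]
    try omega

theorem sorted_alt {pos : E × Bool → ℤ} (hinj : Function.Injective pos) {e f : E}
    (hef : e ≠ f) (h : alt pos e f = true) :
    ∃ i a j b : ℤ, i < a ∧ a < j ∧ j < b ∧
      ((∀ x, ((decide (i < x) ^^ decide (j < x)) = S pos e x ∧
        (decide (a < x) ^^ decide (b < x)) = S pos f x)) ∨
       (∀ x, ((decide (i < x) ^^ decide (j < x)) = S pos f x ∧
        (decide (a < x) ^^ decide (b < x)) = S pos e x))) := by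
  obtain ⟨be, hbe, hSe⟩ := exists_minmax pos hinj e
  obtain ⟨bf, hbf, hSf⟩ := exists_minmax pos hinj f
  have key : ∀ (x y z : ℤ), x < y → (decide (x < z) ^^ decide (y < z)) = decide (x < z ∧ z ≤ y) := by
    intro x y z hxy
    by_cases h1 : x < z <;> by_cases h2 : y < z <;> simp [h1, h2] <;> omega
  have kE : ∀ z, (decide (pos (e, be) < z) ^^ decide (pos (e, !be) < z)) = S pos e z := by
    intro z; rw [key _ _ _ hbe, Bool.eq_iff_iff, hSe]; simp
  have kF : ∀ z, (decide (pos (f, bf) < z) ^^ decide (pos (f, !bf) < z)) = S pos f z := by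
    intro z; rw [key _ _ _ hbf, Bool.eq_iff_iff, hSf]; simp
  have hne : ∀ b b', pos (e, b) ≠ pos (f, b') := fun b b' h => hef (by
    have := hinj h; simp at this; exact this.1)
  have hal : ¬ (S pos e (pos (f, bf)) = S pos e (pos (f, !bf))) := by
    rw [← alt_false_iff, h]; simp
  rw [Bool.eq_iff_iff, hSe, hSe] at hal
  have n1 := hne be bf
  have n2 := hne be (!bf)
  have n3 := hne (!be) bf
  have n4 := hne (!be) (!bf)
  by_cases hc : pos (e, be) < pos (f, bf)
  · exact ⟨pos (e, be), pos (f, bf), pos (e, !be), pos (f, !bf), by omega, by omega, by omega,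
      Or.inl fun x => ⟨kE x, kF x⟩⟩
  · exact ⟨pos (f, bf), pos (e, be), pos (f, !bf), pos (e, !be), by omega, by omega, by omega,
      Or.inr fun x => ⟨kF x, kE x⟩⟩

/-- The exchange step. -/
theorem exchange {pos : E × Bool → ℤ} {lab : E × Bool → V} {T : Set E}
    (h : IsTW pos lab T) {e f : E} (he : e ∈ T) (hf : f ∉ T) (halt : alt pos e f = true) :
    ∃ pos' : E × Bool → ℤ, IsTW pos' lab (insert f (T \ {e})) := by
  have hef : e ≠ f := fun h => hf (h ▸ he)
  obtain ⟨i, a, j, b, h1, h2, h3, hor⟩ := sorted_alt h.inj hef halt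
  let pos' : E × Bool → ℤ := fun d => phi i a j b (pos d)
  have plt : ∀ d d', decide (pos' d < pos' d') = (decide (pos d < pos d') ^^
      ((S pos e (pos d) && S pos f (pos d')) ^^ (S pos f (pos d) && S pos e (pos d')))) := by
    intro d d'
    have := phi_lt h1 h2 h3 (pos d) (pos d')
    rcases hor with hor | hor
    · rw [(hor _).1, (hor _).2, (hor _).1, (hor _).2] at this
      exact this
    · rw [(hor _).1, (hor _).2, (hor _).1, (hor _).2] at this
      rw [Bool.xor_comm (S pos e (pos d) && S pos f (pos d'))]
      exact this
  have hS : ∀ g d, S pos' g (pos' d) = (S pos g (pos d) ^^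
      ((alt pos e g && S pos f (pos d)) ^^ (alt pos f g && S pos e (pos d)))) := by
    intro g d
    simp only [S.eq_1 pos', plt]
    simp only [alt]
    have : S pos g (pos d) = (decide (pos (g, false) < pos d) ^^ decide (pos (g, true) < pos d)) := rfl
    rw [this]
    generalize decide (pos (g, false) < pos d) = x1
    generalize decide (pos (g, true) < pos d) = x2
    generalize S pos e (pos d) = x3
    generalize S pos f (pos d) = x4
    generalize S pos e (pos (g, false)) = x5
    generalize S pos e (pos (g, true)) = x6
    generalize S pos f (pos (g, false)) = x7
    generalize S pos f (pos (g, true)) = x8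
    revert x1 x2 x3 x4 x5 x6 x7 x8
    decide
  have hS' : ∀ g k, alt pos' g k = (alt pos g k ^^
      ((alt pos e g && alt pos f k) ^^ (alt pos f g && alt pos e k))) := by
    intro g k
    have h1 := hS g (k, false)
    have h2 := hS g (k, true)
    simp only [alt.eq_1 pos' g k, h1, h2]
    rw [alt.eq_1 pos g k, alt.eq_1 pos f k, alt.eq_1 pos e k]
    generalize S pos g (pos (k, false)) = x1
    generalize S pos g (pos (k, true)) = x2
    generalize S pos e (pos (k, false)) = x3
    generalize S pos e (pos (k, true)) = x4
    generalize S pos f (pos (k, false)) = x5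
    generalize S pos f (pos (k, true)) = x6
    generalize alt pos e g = x7
    generalize alt pos f g = x8
    revert x1 x2 x3 x4 x5 x6 x7 x8
    decide
  have aee := alt_self h.inj e
  have aff := alt_self h.inj f
  have afe : alt pos f e = true := by rw [alt_comm h.inj hef.symm]; exact halt
  refine ⟨pos', ⟨fun d d' hd => h.inj (phi_inj h1 h2 h3 hd), ?_, ?_⟩⟩
  · intro g k hgk hiff
    rw [hS']
    by_cases hgT : g ∈ insert f (T \ {e})
    · have hkT := hiff.mp hgT
      rcases hgT with rfl | ⟨hgT, hge⟩
      · rcases hkT with rfl | ⟨hkT, hke⟩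
        · exact absurd rfl hgk
        · have : alt pos e k = false := h.nc e k (fun h => hke h.symm) (by simp [he, hkT])
          simp [this, halt]
      · have hge' : alt pos e g = false := h.nc e g (fun h => hge h.symm) (by simp [he, hgT])
        rcases hkT with rfl | ⟨hkT, hke⟩
        · have := alt_comm h.inj hgk
          simp [this, halt, hge']
        · have hke' : alt pos e k = false := h.nc e k (fun h => hke h.symm) (by simp [he, hkT])
          simp [hge', hke', h.nc g k hgk (by simp [hgT, hkT])]
    · have hkT : k ∉ insert f (T \ {e}) := fun hh => hgT (hiff.mpr hh)
      have hg : g = e ∨ (g ∉ T ∧ g ≠ f) := by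
        by_cases g = e <;> simp_all
      have hk : k = e ∨ (k ∉ T ∧ k ≠ f) := by
        by_cases k = e <;> simp_all
      rcases hg with rfl | ⟨hg, hgf⟩
      · rcases hk with rfl | ⟨hk, hkf⟩
        · exact absurd rfl hgk
        · have : alt pos f k = false := h.nc f k hkf.symm (by simp [hf, hk])
          simp [this, afe]
      · have hg' : alt pos f g = false := h.nc f g hgf.symm (by simp [hf, hg])
        rcases hk with rfl | ⟨hk, hkf⟩
        · have := alt_comm h.inj hgk
          simp [afe, hg', this]
        · have hk' : alt pos f k = false := h.nc f k hkf.symm (by simp [hf, hk])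
          simp [hg', hk', h.nc g k hgk (by simp [hg, hk])]
  · intro d d'
    rw [h.L]
    have hf' : ∀ d, S pos' f (pos' d) = S pos e (pos d) := by
      intro d; rw [hS, halt, aff]; simp
    have hg' : ∀ g ∈ T \ {e}, ∀ d, S pos' g (pos' d) =
        (S pos g (pos d) ^^ (alt pos f g && S pos e (pos d))) := by
      intro g hg d
      have : alt pos e g = false := h.nc e g (fun h => hg.2 h.symm) (by simp [he, hg.1])
      rw [hS, this]; simp
    constructor
    · intro H g hg
      rcases hg with rfl | hg
      · rw [hf', hf']; exact H e he
      · rw [hg' g hg, hg' g hg, H g hg.1, H e he]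
    · intro H
      have He : S pos e (pos d) = S pos e (pos d') := by
        rw [← hf', ← hf']; exact H f (Set.mem_insert _ _)
      intro g hg
      by_cases hge : g = e
      · rw [hge]; exact He
      · have := H g (Set.mem_insert_of_mem _ ⟨hg, hge⟩)
        rw [hg' g ⟨hg, hge⟩, hg' g ⟨hg, hge⟩, He] at this
        simpa using this

/-- Acyclicity. -/
def Acyc (lab : E × Bool → V) (F : Set E) : Prop :=
  ∀ f ∈ F, ¬ Reach lab (F \ {f}) (lab (f, false)) (lab (f, true))

theorem forest_ext [Finite E] {lab : E × Bool → V} {F : Set E} (hF : Acyc lab F)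
    {pos : E × Bool → ℤ} {T : Set E} (h : IsTW pos lab T) :
    ∃ pos' T', IsTW pos' lab T' ∧ F ⊆ T' := by
  suffices H : ∀ n : ℕ, ∀ pos T, IsTW pos lab T → (F \ T).ncard = n →
      ∃ pos' T', IsTW pos' lab T' ∧ F ⊆ T' from H _ pos T h rfl
  intro n
  induction n using Nat.strong_induction_on with
  | _ n ih =>
    intro pos T h hn
    by_cases hsub : F ⊆ T
    · exact ⟨pos, T, h, hsub⟩
    · obtain ⟨f, hfF, hfT⟩ := Set.not_subset.mp hsub
      have : ∃ e ∈ T, e ∉ F ∧ alt pos e f = true := by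
        by_contra hcon
        push Not at hcon
        apply hF f hfF
        refine (walk h (f, false) (f, true)).mono ?_
        rintro g ⟨hg, hgne⟩
        have hgalt : alt pos g f = true := by
          simp only [alt]
          revert hgne
          generalize S pos g (pos (f, false)) = x
          generalize S pos g (pos (f, true)) = y
          revert x y; decide
        refine ⟨?_, fun hh => hfT (hh ▸ hg)⟩
        by_contra hgF
        exact absurd hgalt (hcon g hg hgF)
      obtain ⟨e, heT, heF, hal⟩ := this
      obtain ⟨pos', h'⟩ := exchange h heT hfT hal
      refine ih _ ?_ pos' _ h' rfl
      rw [← hn]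
      apply Set.ncard_lt_ncard _ (Set.toFinite _)
      refine ⟨?_, fun hh => ?_⟩
      · rintro x ⟨hxF, hx⟩
        refine ⟨hxF, fun hxT => hx (Or.inr ⟨hxT, fun hxe => heF ?_⟩)⟩
        rw [← (hxe : x = e)]; exact hxF
      · exact (hh ⟨hfF, hfT⟩).2 (Or.inl rfl)

theorem exists_acyc [Finite E] (lab : E × Bool → V) (A : Set E) :
    ∃ C ⊆ A, Acyc lab C ∧ ∀ u v, Reach lab A u v → Reach lab C u v := by
  suffices H : ∀ n : ℕ, ∀ A : Set E, A.ncard = n →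
    ∃ C ⊆ A, Acyc lab C ∧ ∀ u v, Reach lab A u v → Reach lab C u v from H _ A rfl
  intro n
  induction n using Nat.strong_induction_on with
  | _ n ih =>
    intro A hn
    by_cases hA : Acyc lab A
    · exact ⟨A, subset_rfl, hA, fun _ _ h => h⟩
    · simp only [Acyc] at hA
      push Not at hA
      obtain ⟨f, hf, hr⟩ := hA
      obtain ⟨C, hC, hac, hreach⟩ := ih _ (by
        rw [← hn]; exact Set.ncard_sdiff_singleton_lt_of_mem hf (Set.toFinite _)) (A \ {f}) rfl
      refine ⟨C, hC.trans sdiff_subset, hac, fun u v huv => hreach _ _ ?_⟩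
      refine Reach.of_edges (reach_equiv lab (A \ {f})) ?_ huv
      intro e he
      by_cases hef : e = f
      · rw [hef]; exact hr
      · exact Reach.edge (A := A \ {f}) ⟨he, hef⟩ false true

/-- Side of a label. -/
theorem side_invariant {pos : E × Bool → ℤ} {lab : E × Bool → V} {T : Set E}
    (h : IsTW pos lab T) {g : E} (hg : g ∈ T) {A : Set E} (hA : ∀ e ∈ A, alt pos g e = false)
    {d d' : E × Bool} (hr : Reach lab A (lab d) (lab d')) : S pos g (pos d) = S pos g (pos d') := by
  classical
  let s : V → Bool := fun u => decide (∃ d, lab d = u ∧ S pos g (pos d) = true)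
  have hs : ∀ d, s (lab d) = S pos g (pos d) := by
    intro d
    by_cases hd : S pos g (pos d) = true
    · rw [hd]; simp only [s, decide_eq_true_eq]; exact ⟨d, rfl, hd⟩
    · have : ¬ ∃ d', lab d' = lab d ∧ S pos g (pos d') = true := by
        rintro ⟨d', h1, h2⟩
        exact hd (by rw [← (h.L d' d).mp h1 g hg]; exact h2)
      rw [Bool.not_eq_true] at hd
      rw [hd]; simp only [s, decide_eq_false_iff_not]; exact this
  rw [← hs, ← hs]
  refine Reach.of_edges (R := fun u v => s u = s v) ⟨fun _ => rfl, Eq.symm, Eq.trans⟩ ?_ hr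
  intro e he
  rw [hs, hs]
  exact (alt_false_iff false).mp (hA e he)

/-- All tree words have acyclic trees. -/
theorem acyc_tree {pos : E × Bool → ℤ} {lab : E × Bool → V} {T : Set E}
    (h : IsTW pos lab T) : Acyc lab T := by
  intro f hf hr
  have := side_invariant h hf (A := T \ {f}) (fun e he => h.nc f e (fun h => he.2 h.symm)
    (by simp [hf, he.1])) hr
  have h2 := alt_self h.inj f
  rw [alt, this] at h2
  simp at h2

/-- If a subset of the tree connects all labels then it is the whole tree. -/
theorem tree_eq {pos : E × Bool → ℤ} {lab : E × Bool → V} {T C : Set E}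
    (h : IsTW pos lab T) (hC : C ⊆ T) (hconn : ∀ d d', Reach lab C (lab d) (lab d')) : T = C := by
  refine subset_antisymm (fun f hf => ?_) hC
  by_contra hfC
  refine acyc_tree h f hf ((hconn (f, false) (f, true)).mono (B := T \ {f}) ?_)
  intro e he
  refine ⟨hC he, fun hh => hfC ?_⟩
  rw [← (hh : e = f)]; exact he

/-- Restriction of the edge set, keeping tree edges. -/
theorem IsTW.restrict {pos : E × Bool → ℤ} {lab : E × Bool → V} {T : Set E}
    (h : IsTW pos lab T) (P : E → Prop) (hP : ∀ e ∈ T, P e) :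
    IsTW (E := {e // P e}) (fun d => pos (d.1.1, d.2)) (fun d => lab (d.1.1, d.2))
      {e | e.1 ∈ T} := by
  refine ⟨?_, ?_, ?_⟩
  · rintro ⟨⟨e, he⟩, b⟩ ⟨⟨f, hf⟩, b'⟩ hh
    have := h.inj hh
    simp at this ⊢
    exact this
  · intro e f hef hiff
    exact h.nc e.1 f.1 (fun hh => hef (Subtype.ext hh)) hiff
  · intro d d'
    rw [h.L]
    constructor
    · intro H g hg; exact H g.1 hg
    · intro H g hg; exact H ⟨g, hP g hg⟩ hg

/-- Contraction. -/
theorem contraction [Finite E] {V' : Type} {pos : E × Bool → ℤ} {lab : E × Bool → V} {T : Set E}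
    (h : IsTW pos lab T) (lam : V → V') (A : Set E)
    (hA : ∀ e ∈ A, lam (lab (e, false)) = lam (lab (e, true)))
    (hlam : ∀ d d', lam (lab d) = lam (lab d') → Reach lab A (lab d) (lab d')) :
    ∃ (C : Set E) (pos' : E × Bool → ℤ) (T' : Set E), C ⊆ A ∧
      IsTW (E := {e // e ∉ C}) (fun d => pos' (d.1.1, d.2)) (fun d => lam (lab (d.1.1, d.2)))
        {e | e.1 ∈ T'} := by
  obtain ⟨C, hCA, hac, hreach⟩ := exists_acyc lab A
  obtain ⟨pos', T', h', hCT⟩ := forest_ext hac h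
  refine ⟨C, pos', T', hCA, ?_, ?_, ?_⟩
  · rintro ⟨⟨e, he⟩, b⟩ ⟨⟨f, hf⟩, b'⟩ hh
    have := h'.inj hh
    simp at this ⊢
    exact this
  · intro e f hef hiff
    exact h'.nc e.1 f.1 (fun hh => hef (Subtype.ext hh)) hiff
  · intro d d'
    constructor
    · intro H g hg
      have hr := hreach _ _ (hlam (d.1.1, d.2) (d'.1.1, d'.2) H)
      exact side_invariant h' hg (fun e he => h'.nc g.1 e (fun hh => g.2 (hh ▸ he))
        (by have := hCT he; simp only [mem_ofPred_eq] at hg; simp [hg, this])) hr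
    · intro H
      have hw := walk h' (d.1.1, d.2) (d'.1.1, d'.2)
      refine Reach.of_edges (R := fun u v => lam u = lam v) ⟨fun _ => rfl, Eq.symm, Eq.trans⟩ ?_ hw
      rintro e ⟨heT, hene⟩
      apply hA
      apply hCA
      by_contra heC
      exact hene (H ⟨e, heC⟩ heT)

/-- Rotation. -/
theorem rotation [Finite E] {pos : E × Bool → ℤ} {lab : E × Bool → V} {T : Set E}
    (h : IsTW pos lab T) (d0 : E × Bool) :
    ∃ pos' : E × Bool → ℤ, IsTW pos' lab T ∧ ∀ d, pos' d0 ≤ pos' d := by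
  obtain ⟨K, hK⟩ : ∃ K : ℤ, ∀ d d', pos d - pos d' < K := by
    obtain ⟨K, hK⟩ := (Set.finite_range fun p : (E × Bool) × (E × Bool) => pos p.1 - pos p.2).bddAbove
    exact ⟨K + 1, fun d d' => by have := hK ⟨(d, d'), rfl⟩; simp only at this; omega⟩
  let c := pos d0
  let pos' : E × Bool → ℤ := fun d => if pos d < c then pos d + K else pos d
  have plt : ∀ d d', decide (pos' d < pos' d') = (decide (pos d < pos d') ^^
      (decide (pos d < c) ^^ decide (pos d' < c))) := by
    intro d d'
    have h1 := hK d d'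
    have h2 := hK d' d
    have h3 := hK d d0
    have h4 := hK d' d0
    have h5 := hK d0 d
    have h6 := hK d0 d'
    simp only [pos']
    by_cases hd : pos d < c <;> by_cases hd' : pos d' < c <;> by_cases hdd : pos d < pos d' <;>
      simp [hd, hd', hdd] <;> omega
  have hS : ∀ g d, S pos' g (pos' d) = (S pos g (pos d) ^^ S pos g c) := by
    intro g d
    simp only [S, plt]
    have e1 : decide (pos d < c) = decide (pos d < c) := rfl
    generalize decide (pos (g, false) < pos d) = x1
    generalize decide (pos (g, true) < pos d) = x2
    generalize decide (pos (g, false) < c) = x3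
    generalize decide (pos (g, true) < c) = x4
    generalize decide (pos d < c) = x5
    revert x1 x2 x3 x4 x5
    decide
  refine ⟨pos', ⟨?_, ?_, ?_⟩, ?_⟩
  · intro d d' hdd
    have h1 := hK d d'
    have h2 := hK d' d
    apply h.inj
    simp only [pos'] at hdd
    split_ifs at hdd <;> omega
  · intro e f hef hiff
    have := h.nc e f hef hiff
    simp only [alt, hS] at this ⊢
    revert this
    generalize S pos e (pos (f, false)) = x1
    generalize S pos e (pos (f, true)) = x2
    generalize S pos e c = x3
    revert x1 x2 x3
    decide
  · intro d d'
    rw [h.L]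
    simp only [hS, Bool.xor_left_inj]
  · intro d
    have h5 := hK d0 d
    simp only [pos', c, lt_self_iff_false, if_false]
    split_ifs <;> omega

end TW2
end SN


namespace SN
section Planar
variable {V : Type}

/-- A tree word representing (a supergraph of) `G`. -/
structure Rep (G : SimpleGraph V) {E : Type} (pos : E × Bool → ℤ) (lab : E × Bool → V)
    (T : Set E) : Prop where
  tw : IsTW pos lab T
  adj : ∀ u v, G.Adj u v → ∃ e b, lab (e, b) = u ∧ lab (e, !b) = v
  surj : ∀ v, ∃ d, lab d = v

def WPlanar (G : SimpleGraph V) : Prop :=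
  ∃ (E : Type) (_ : Finite E) (pos : E × Bool → ℤ) (lab : E × Bool → V) (T : Set E),
    Rep G pos lab T

/-- Edge maximal. -/
structure IsMax (G : SimpleGraph V) : Prop where
  planar : WPlanar G
  max : ∀ G' : SimpleGraph V, WPlanar G' → G ≤ G' → G' ≤ G

theorem exists_max [Finite V] (G : SimpleGraph V) (h : WPlanar G) :
    ∃ G', G ≤ G' ∧ IsMax G' := by
  have hfin : {G' : SimpleGraph V | G ≤ G' ∧ WPlanar G'}.Finite := Set.toFinite _
  obtain ⟨G', hG', hm⟩ := hfin.exists_maximal ⟨G, le_rfl, h⟩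
  exact ⟨G', hG'.1, hG'.2, fun G'' h'' hle => hm ⟨hG'.1.trans hle, h''⟩ hle⟩

theorem IsMax.adj_of_rep {G : SimpleGraph V} (hM : IsMax G) {E : Type} [Finite E]
    {pos : E × Bool → ℤ} {lab : E × Bool → V} {T : Set E} (h : Rep G pos lab T) {e : E} {b : Bool}
    (hne : lab (e, b) ≠ lab (e, !b)) : G.Adj (lab (e, b)) (lab (e, !b)) := by
  refine hM.max (G ⊔ SimpleGraph.edge (lab (e, b)) (lab (e, !b))) ?_ le_sup_left ?_
  · refine ⟨E, inferInstance, pos, lab, T, h.tw, ?_, h.surj⟩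
    intro u v huv
    rcases huv with huv | huv
    · exact h.adj u v huv
    · rw [SimpleGraph.edge_adj] at huv
      rcases huv.1 with ⟨h1, h2⟩ | ⟨h1, h2⟩
      · exact ⟨e, b, h1.symm, h2.symm⟩
      · exact ⟨e, !b, h1.symm, by simpa using h2.symm⟩
  · right
    rw [SimpleGraph.edge_adj]
    exact ⟨Or.inl ⟨rfl, rfl⟩, hne⟩

theorem xor_ff {a b : Bool} (h : a = b) : (a ^^ b) = false := by rw [h, Bool.xor_self]

theorem insertD {E : Type} {pos : E × Bool → ℤ} {lab : E × Bool → V} {T : Set E}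
    (h : IsTW pos lab T) {eu ev : E} (hu : eu ∈ T) (hv : ev ∈ T) (bu bv : Bool)
    (hM : pos (eu, !bu) < pos (ev, bv)) (hbv : pos (ev, bv) < pos (ev, !bv))
    (hgap : ∀ d, ¬ (pos (eu, !bu) < pos d ∧ pos d < pos (ev, bv)))
    (hS : ∀ g ∈ T, S pos g (pos (ev, bv)) = false) :
    ∃ (pos' : (E ⊕ Fin 3) × Bool → ℤ) (lab' : (E ⊕ Fin 3) × Bool → Option V) (T' : Set (E ⊕ Fin 3)),
      IsTW pos' lab' T' ∧ (∀ e b, lab' (Sum.inl e, b) = some (lab (e, b))) ∧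
      (∀ k, lab' (Sum.inr k, true) = none) ∧ lab' (Sum.inr 0, false) = some (lab (ev, bv)) ∧
      lab' (Sum.inr 1, false) = some (lab (eu, !bu)) ∧
      lab' (Sum.inr 2, false) = some (lab (ev, !bv)) := by
  set M := pos (eu, !bu) with hMdef
  set m := pos (ev, bv) with hmdef
  let pos' : (E ⊕ Fin 3) × Bool → ℤ := fun d => match d with
    | (Sum.inl e, b) => 10 * pos (e, b)
    | (Sum.inr 0, false) => 10 * M + 2
    | (Sum.inr 0, true) => 10 * M + 5
    | (Sum.inr 1, false) => 10 * M - 1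
    | (Sum.inr 1, true) => 10 * M + 3
    | (Sum.inr 2, false) => 10 * m + 1
    | (Sum.inr 2, true) => 10 * M + 4
  let ref : (E ⊕ Fin 3) × Bool → E × Bool := fun d => match d with
    | (Sum.inl e, b) => (e, b)
    | (Sum.inr 0, false) => (ev, bv)
    | (Sum.inr 0, true) => (ev, bv)
    | (Sum.inr 1, false) => (eu, !bu)
    | (Sum.inr 1, true) => (ev, bv)
    | (Sum.inr 2, false) => (ev, !bv)
    | (Sum.inr 2, true) => (ev, bv)
  let isD : (E ⊕ Fin 3) × Bool → Bool := fun d => match d with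
    | (Sum.inl _, _) => false
    | (Sum.inr _, b) => b
  let lab' : (E ⊕ Fin 3) × Bool → Option V := fun d => if isD d then none else some (lab (ref d))
  let T' : Set (E ⊕ Fin 3) := insert (Sum.inr 0) (Sum.inl '' T)
  have hSref : ∀ g ∈ T, ∀ d, S pos' (Sum.inl g) (pos' d) = S pos g (pos (ref d)) := by
    intro g hg d
    have p0 := hgap (g, false)
    have p1 := hgap (g, true)
    rcases d with ⟨d | k, b⟩
    · simp only [S, pos', ref]
      congr 2 <;> exact propext (by omega)
    · have hA : ∀ x : ℤ, 10 * M < x → x < 10 * M + 9 → S pos' (Sum.inl g) x = S pos g m := by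
        intro x hx1 hx2
        simp only [S, pos']
        congr 2 <;> exact propext (by omega)
      match k, b with
      | 0, false => exact hA _ (by simp only [pos']; omega) (by simp only [pos']; omega)
      | 0, true => exact hA _ (by simp only [pos']; omega) (by simp only [pos']; omega)
      | 1, true => exact hA _ (by simp only [pos']; omega) (by simp only [pos']; omega)
      | 2, true => exact hA _ (by simp only [pos']; omega) (by simp only [pos']; omega)
      | 1, false =>
        simp only [S, pos', ref]
        congr 2 <;> exact propext (by omega)
      | 2, false =>
        show S pos' (Sum.inl g) (10 * m + 1) = S pos g (pos (ev, !bv))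
        by_cases hge : g = ev
        · subst hge
          have hr : S pos g (pos (g, !bv)) = true := by
            have h1 : ¬ pos (g, !bv) < pos (g, bv) := by omega
            cases bv <;> simp_all [S]
          rw [hr]
          have hl : m < pos (g, !bv) := hbv
          have h1 : pos (g, bv) < m + 1 := by omega
          have h2 : ¬ pos (g, !bv) < m + 1 := by omega
          cases bv
          · simp only [S, pos', Bool.not_false] at *
            have e1 : 10 * pos (g, false) < 10 * m + 1 := by omega
            have e2 : ¬ 10 * pos (g, true) < 10 * m + 1 := by omega
            simp [e1, e2]
          · simp only [S, pos', Bool.not_true] at *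
            have e1 : 10 * pos (g, true) < 10 * m + 1 := by omega
            have e2 : ¬ 10 * pos (g, false) < 10 * m + 1 := by omega
            simp [e1, e2]
        · have := (alt_false_iff bv).mp (h.nc g ev hge (by simp [hg, hv]))
          rw [← this]
          have q0 : pos (g, false) ≠ m := fun hh => hge (by have := h.inj hh; simp at this; exact this.1)
          have q1 : pos (g, true) ≠ m := fun hh => hge (by have := h.inj hh; simp at this; exact this.1)
          simp only [S, pos']
          congr 2 <;> exact propext (by omega)
  have hS0 : ∀ d, S pos' (Sum.inr 0) (pos' d) = isD d := by
    intro d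
    rcases d with ⟨d | k, b⟩
    · show _ = false
      by_cases hh : 10 * M + 2 < 10 * pos (d, b)
      · have : 10 * M + 5 < 10 * pos (d, b) := by omega
        simp [S, pos', hh, this]
      · have : ¬ 10 * M + 5 < 10 * pos (d, b) := by omega
        simp [S, pos', hh, this]
    · match k, b with
      | 0, false => simp [S, pos', isD]
      | 0, true => simp [S, pos', isD]
      | 1, true => simp [S, pos', isD]
      | 2, true => simp [S, pos', isD]
      | 1, false =>
        have e1 : ¬ 10 * M + 2 < 10 * M - 1 := by omega
        have e2 : ¬ 10 * M + 5 < 10 * M - 1 := by omega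
        simp only [S, pos', isD, e1, e2, decide_false, Bool.xor_false]
      | 2, false =>
        have e1 : 10 * M + 2 < 10 * m + 1 := by omega
        have e2 : 10 * M + 5 < 10 * m + 1 := by omega
        simp [S, pos', isD, e1, e2]
  have hinj : Function.Injective pos' := by
    rintro ⟨d | k, b⟩ ⟨d' | k', b'⟩ hdd
    · have : pos (d, b) = pos (d', b') := by simp only [pos'] at hdd; omega
      have := h.inj this
      simp at this ⊢; exact this
    · exfalso
      fin_cases k' <;> cases b' <;> simp [pos'] at hdd <;> omega
    · exfalso
      fin_cases k <;> cases b <;> simp [pos'] at hdd <;> omega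
    · fin_cases k <;> cases b <;> fin_cases k' <;> cases b' <;> simp [pos'] at hdd ⊢ <;> omega
  refine ⟨pos', lab', T', ⟨hinj, ?_, ?_⟩, ?_, ?_, ?_, ?_, ?_⟩
  · have hT0 : ∀ g ∈ T, alt pos' (Sum.inl g) (Sum.inr 0) = false := by
      intro g hg
      simp only [alt, hSref g hg, ref, Bool.xor_self]
    -- nontree old against new nontree
    have hold : ∀ f, f ∉ T → ∀ k : Fin 3, k ≠ 0 → alt pos' (Sum.inr k) (Sum.inl f) = false := by
      intro f hf k hk
      have q : ∀ b, pos (f, b) ≠ M ∧ pos (f, b) ≠ m := by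
        intro b
        constructor
        · intro hh; have := h.inj hh; simp at this; exact hf (this.1 ▸ hu)
        · intro hh; have := h.inj hh; simp at this; exact hf (this.1 ▸ hv)
      have hz : ∀ b, S pos' (Sum.inr k) (pos' (Sum.inl f, b)) = false := by
        intro b
        have q1 := q b
        have q2 := hgap (f, b)
        match k, hk with
        | 1, _ =>
          refine xor_ff ?_
          simp only [pos']
          congr 1; exact propext (by omega)
        | 2, _ =>
          refine xor_ff ?_
          simp only [pos']
          congr 1; exact propext (by omega)
      simp only [alt, hz, Bool.xor_self]
    have h12 : alt pos' (Sum.inr 1) (Sum.inr 2) = false := by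
      have e1 : 10 * M - 1 < 10 * m + 1 := by omega
      have e2 : 10 * M + 3 < 10 * m + 1 := by omega
      have e3 : 10 * M - 1 < 10 * M + 4 := by omega
      have e4 : 10 * M + 3 < 10 * M + 4 := by omega
      simp only [alt, S, pos', e1, e2, e3, e4]; rfl
    rintro (e | k) (f | l) hef hiff
    · have hef' : e ≠ f := fun hh => hef (by rw [hh])
      have hiff' : e ∈ T ↔ f ∈ T := by simpa [T'] using hiff
      have := h.nc e f hef' hiff'
      have hs : ∀ b, S pos' (Sum.inl e) (pos' (Sum.inl f, b)) = S pos e (pos (f, b)) := by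
        intro b
        simp only [S, pos']
        congr 2 <;> exact propext (by omega)
      simp only [alt, hs] at this ⊢
      exact this
    · by_cases hl : l = 0
      · subst hl
        have : e ∈ T := by simpa [T'] using hiff
        exact hT0 e this
      · have : e ∉ T := by simpa [T', hl] using hiff
        rw [alt_comm hinj hef]
        exact hold e this l hl
    · by_cases hl : k = 0
      · subst hl
        have : f ∈ T := by simpa [T'] using hiff
        rw [alt_comm hinj hef]
        exact hT0 f this
      · have : f ∉ T := by simpa [T', hl] using hiff
        exact hold f this k hl
    · have hkl : k ≠ l := fun hh => hef (by rw [hh])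
      have hiff' : k = 0 ↔ l = 0 := by simpa [T'] using hiff
      have hk0 : k ≠ 0 := fun hh => hkl (hh.trans (hiff'.mp hh).symm)
      have hl0 : l ≠ 0 := fun hh => hk0 (hiff'.mpr hh)
      match k, l with
      | 1, 2 => exact h12
      | 2, 1 => rw [alt_comm hinj (by simp)]; exact h12
      | 1, 1 => exact absurd rfl hkl
      | 2, 2 => exact absurd rfl hkl
  · intro d d'
    have hD : ∀ d, isD d = true → ref d = (ev, bv) := by
      rintro ⟨d | k, b⟩ hd
      · simp [isD] at hd
      · simp only [isD] at hd
        subst hd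
        fin_cases k <;> rfl
    constructor
    · intro hl
      have hDD : isD d = isD d' := by
        simp only [lab'] at hl
        cases h1 : isD d <;> cases h2 : isD d' <;> simp [h1, h2] at hl ⊢
      intro g hg
      rcases hg with rfl | ⟨g, hg, rfl⟩
      · rw [hS0, hS0, hDD]
      · rw [hSref g hg, hSref g hg]
        cases h1 : isD d
        · simp only [lab', h1, ← hDD] at hl
          simp at hl
          exact (h.L _ _).mp hl g hg
        · rw [hD d h1, hD d' (hDD ▸ h1)]
    · intro H
      have hDD : isD d = isD d' := by
        rw [← hS0, ← hS0]; exact H _ (Set.mem_insert _ _)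
      have hr : lab (ref d) = lab (ref d') := by
        rw [h.L]
        intro g hg
        rw [← hSref g hg, ← hSref g hg]
        exact H _ (Set.mem_insert_of_mem _ ⟨g, hg, rfl⟩)
      simp only [lab', hDD, hr]
  · intro e b; rfl
  · intro k; rfl
  · rfl
  · rfl
  · rfl

/-- Add a new vertex adjacent to three given vertices. -/
def addD (G : SimpleGraph V) (a b c : V) : SimpleGraph (Option V) where
  Adj x y := match x, y with
    | none, none => False
    | none, some v => v = a ∨ v = b ∨ v = c
    | some v, none => v = a ∨ v = b ∨ v = c
    | some u, some v => G.Adj u v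
  symm := ⟨fun x y h => by
    rcases x with _ | x <;> rcases y with _ | y
    · exact h
    · exact h
    · exact h
    · exact G.symm.symm _ _ h⟩
  loopless := ⟨fun x h => by
    rcases x with _ | x
    · exact h
    · exact G.loopless.irrefl _ h⟩

end Planar
end SN


namespace SN
section Star
variable {V : Type}

theorem star_gap [Finite V] {G : SimpleGraph V} (hMax : IsMax G) {y z : V} (hz : G.Adj y z)
    (W P : Set V) (hW : ∀ w ∈ W, G.Adj y w) (hWz : ∀ w, G.Adj y w → w ∉ W → w = z)
    (hP : ∃ p ∈ W, p ∈ P) (hQ : ∃ q ∈ W, q ∉ P) :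
    ∃ u ∈ W, ∃ v ∈ W, u ∈ P ∧ v ∉ P ∧ WPlanar (addD G y u v) := by
  classical
  obtain ⟨E, hE, pos0, lab, T0, hrep⟩ := hMax.planar
  have hEn : Nonempty E := by
    obtain ⟨e, _⟩ := hrep.adj y z hz; exact ⟨e⟩
  have hch : ∀ w, ∃ (e : E) (b : Bool), G.Adj y w → lab (e, b) = y ∧ lab (e, !b) = w := by
    intro w
    by_cases hw : G.Adj y w
    · obtain ⟨e, b, h⟩ := hrep.adj y w hw; exact ⟨e, b, fun _ => h⟩
    · exact ⟨Classical.arbitrary E, true, fun h => absurd h hw⟩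
  choose es eb hes using hch
  -- star forest
  let F : Set E := {e | ∃ w, G.Adj y w ∧ e = es w}
  have hac : Acyc lab F := by
    rintro f ⟨w, hw, rfl⟩ hr
    have hr' : Reach lab (F \ {es w}) (lab (es w, eb w)) (lab (es w, !eb w)) := by
      cases eb w
      · exact hr
      · exact hr.symm
    rw [(hes w hw).1, (hes w hw).2] at hr'
    have := Reach.of_edges (R := fun a b => (a = w ↔ b = w))
      ⟨fun _ => Iff.rfl, Iff.symm, Iff.trans⟩ ?_ hr'
    · exact hw.ne (this.mpr rfl)
    · rintro e ⟨⟨w', hw', rfl⟩, hne⟩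
      have hww : w' ≠ w := fun hh => hne (by rw [hh]; rfl)
      have h1 := hes w' hw'
      have h2 := hw.ne
      cases hb : eb w' <;> rw [hb] at h1 <;> simp only [Bool.not_false, Bool.not_true] at h1 <;>
        rw [h1.1, h1.2] <;> simp [h2, hww]
  obtain ⟨pos1, T, htw1, hFT⟩ := forest_ext hac hrep.tw
  obtain ⟨pos, htw, hfirst⟩ := rotation htw1 (es z, eb z)
  have hrep' : Rep G pos lab T := ⟨htw, hrep.adj, hrep.surj⟩
  have hesT : ∀ w, G.Adj y w → es w ∈ T := fun w hw => hFT ⟨w, hw, rfl⟩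
  -- y-darts
  have hS0 : ∀ g, S pos g (pos (es z, eb z)) = false := by
    intro g
    have h1 := hfirst (g, false)
    have h2 := hfirst (g, true)
    exact xor_ff (by rw [decide_eq_false (not_lt.mpr h1), decide_eq_false (not_lt.mpr h2)])
  have hyS : ∀ d, lab d = y ↔ ∀ g ∈ T, S pos g (pos d) = false := by
    intro d
    have := htw.L d (es z, eb z)
    rw [(hes z hz).1] at this
    rw [this]
    simp only [hS0]
  -- min and max positions
  let m : V → ℤ := fun w => pos (es w, eb w)
  let M : V → ℤ := fun w => pos (es w, !eb w)
  have hmM : ∀ w, G.Adj y w → m w < M w ∧ ∀ x, S pos (es w) x = true ↔ m w < x ∧ x ≤ M w := by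
    intro w hw
    obtain ⟨b, hb, hSb⟩ := exists_minmax pos htw.inj (es w)
    have h1 := (hyS (es w, eb w)).mp (hes w hw).1 (es w) (hesT w hw)
    have hbe : b = eb w := by
      by_contra hne
      have : eb w = !b := by revert hne; cases b <;> cases eb w <;> simp
      have h2 : S pos (es w) (pos (es w, eb w)) = true := by rw [hSb, this]; omega
      rw [h1] at h2; simp at h2
    subst hbe
    exact ⟨hb, hSb⟩
  have hdisj : ∀ w w', G.Adj y w → G.Adj y w' → m w < m w' → M w < m w' := by
    intro w w' hw hw' hlt
    have h1 := (hyS (es w', eb w')).mp (hes w' hw').1 (es w) (hesT w hw)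
    have h2 := (hmM w hw).2 (m w')
    by_contra hcon
    have := h2.mpr ⟨hlt, by omega⟩
    rw [show pos (es w', eb w') = m w' from rfl, this] at h1
    simp at h1
  have hminj : ∀ w w', G.Adj y w → G.Adj y w' → m w = m w' → w = w' := by
    intro w w' hw hw' hmm
    have := htw.inj hmm
    have h3 := (hes w hw).2
    have h4 := (hes w' hw').2
    simp only [Prod.mk.injEq] at this
    rw [← h3, ← h4, this.1, this.2]
  -- uniqueness of tree edges at y
  have huniq : ∀ g ∈ T, ∀ b, lab (g, b) = y → G.Adj y (lab (g, !b)) ∧ g = es (lab (g, !b)) ∧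
      b = eb (lab (g, !b)) := by
    intro g hg b hb
    have hne : lab (g, b) ≠ lab (g, !b) := by
      intro hh
      refine acyc_tree htw g hg ?_
      have : lab (g, false) = lab (g, true) := by
        revert hh; cases b
        · exact id
        · exact Eq.symm
      rw [this]; exact Reach.refl _
    have hadj : G.Adj y (lab (g, !b)) := by
      have := hMax.adj_of_rep hrep' hne
      rwa [hb] at this
    have hge : g = es (lab (g, !b)) := by
      by_contra hgne
      refine acyc_tree htw g hg ?_
      have hh := hes _ hadj
      have hr : Reach lab (T \ {g}) (lab (es (lab (g, !b)), eb (lab (g, !b))))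
          (lab (es (lab (g, !b)), !eb (lab (g, !b)))) :=
        Reach.edge (A := T \ {g}) ⟨hesT _ hadj, fun hh => hgne hh.symm⟩ _ _
      rw [hh.1, hh.2, ← hb] at hr
      cases b
      · exact hr
      · exact hr.symm
    refine ⟨hadj, hge, ?_⟩
    have hh := hes _ hadj
    by_contra hbne
    have hb' : eb (lab (g, !b)) = !b := by
      revert hbne; cases b <;> cases eb _ <;> simp
    have h1 := hh.1
    rw [← hge, hb'] at h1
    exact hne (by rw [hb, h1])
  -- closest opposite pair
  obtain ⟨p, hpW, hpP⟩ := hP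
  obtain ⟨q, hqW, hqP⟩ := hQ
  have hfin : {x : V × V | x.1 ∈ W ∧ x.2 ∈ W ∧ (x.1 ∈ P ↔ x.2 ∉ P) ∧ m x.1 < m x.2}.Finite :=
    Set.toFinite _
  have hneq : m p ≠ m q := fun hh => hqP (by rw [← hminj p q (hW p hpW) (hW q hqW) hh]; exact hpP)
  have hnon : {x : V × V | x.1 ∈ W ∧ x.2 ∈ W ∧ (x.1 ∈ P ↔ x.2 ∉ P) ∧ m x.1 < m x.2}.Nonempty := by
    rcases lt_or_gt_of_ne hneq with hlt | hlt
    · exact ⟨(p, q), hpW, hqW, by simp [hpP, hqP], hlt⟩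
    · exact ⟨(q, p), hqW, hpW, by simp [hpP, hqP], hlt⟩
  obtain ⟨⟨u, v⟩, ⟨huW, hvW, huv, hlt⟩, hmin⟩ :=
    Set.exists_min_image _ (fun x : V × V => m x.2 - m x.1) hfin hnon
  simp only at huW hvW huv hlt hmin
  have hcons : ∀ w, G.Adj y w → ¬ (m u < m w ∧ m w < m v) := by
    rintro w hw ⟨h1, h2⟩
    by_cases hwW : w ∈ W
    · by_cases hwP : w ∈ P ↔ v ∉ P
      · have := hmin (w, v) ⟨hwW, hvW, hwP, h2⟩
        simp only at this; omega
      · have := hmin (u, w) ⟨huW, hwW, by tauto, h1⟩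
        simp only at this; omega
    · have := hWz w hw hwW
      have h3 := hfirst (es u, eb u)
      rw [this] at h1
      simp only [m] at h1
      omega
  have hyu := hW u huW
  have hyv := hW v hvW
  -- restrict
  let Q : E → Prop := fun e => e ∈ T ∨ ∀ b, lab (e, b) ≠ y
  have hres := htw.restrict Q (fun e he => Or.inl he)
  have hgap : ∀ d : {e // Q e} × Bool, ¬ (M u < pos (d.1.1, d.2) ∧ pos (d.1.1, d.2) < m v) := by
    rintro ⟨⟨e, he⟩, b⟩ ⟨h1, h2⟩
    simp only at h1 h2
    by_cases hl : lab (e, b) = y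
    · have heT : e ∈ T := by
        rcases he with he | he
        · exact he
        · exact absurd hl (he b)
      obtain ⟨ha, hb, hc⟩ := huniq e heT b hl
      have hpm : pos (e, b) = m (lab (e, !b)) := by
        simp only [m]; rw [← hb, ← hc]
      have := (hmM u hyu).1
      exact hcons _ ha ⟨by omega, by omega⟩
    · have hex : ∃ g ∈ T, S pos g (pos (e, b)) = true := by
        by_contra hcon
        push Not at hcon
        exact hl ((hyS _).mpr fun g hg => by simpa using hcon g hg)
      have hmn : ∀ g, ∃ c, pos (g, c) < pos (g, !c) ∧
          ∀ x, S pos g x = true ↔ (pos (g, c) < x ∧ x ≤ pos (g, !c)) :=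
        fun g => exists_minmax pos htw.inj g
      choose c hc hSc using hmn
      obtain ⟨g, ⟨hgT, hgS⟩, hgmin⟩ := Set.exists_min_image {g | g ∈ T ∧ S pos g (pos (e, b)) = true}
        (fun g => pos (g, c g)) (Set.toFinite _) hex
      have hly : lab (g, c g) = y := by
        rw [hyS]
        intro k hk
        by_contra hkS
        rw [Bool.not_eq_false] at hkS
        have hkg : k ≠ g := by
          rintro rfl
          rw [hSc] at hkS; omega
        have hnc := (alt_false_iff (c g)).mp (htw.nc k g hkg (by simp [hk, hgT]))
        rw [hkS] at hnc
        have h3 := hnc.symm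
        rw [hSc] at h3 hkS hgS
        have := hgmin k ⟨hk, by rw [hSc]; omega⟩
        omega
      obtain ⟨ha, hb, hcc⟩ := huniq g hgT (c g) hly
      set w := lab (g, !(c g))
      have hgm : m w = pos (g, c g) := by simp only [m]; rw [← hb, ← hcc]
      have hgM : M w = pos (g, !(c g)) := by simp only [M]; rw [← hb, ← hcc]
      rw [hSc, ← hgm, ← hgM] at hgS
      have hu := (hmM u hyu).1
      rcases lt_trichotomy (m w) (m u) with h3 | h3 | h3
      · have := hdisj w u ha hyu h3; omega
      · have := hminj w u ha hyu h3
        rw [this] at hgS; omega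
      · exact hcons w ha ⟨h3, by omega⟩
  have huT := hesT u hyu
  have hvT := hesT v hyv
  have hMm := hdisj u v hyu hyv hlt
  obtain ⟨pos', lab', T', htw', hl1, hl2, hl3, hl4, hl5⟩ := insertD hres
    (eu := ⟨es u, Or.inl huT⟩) (ev := ⟨es v, Or.inl hvT⟩) huT hvT (eb u) (eb v) hMm
    (hmM v hyv).1 hgap (fun g hg => (hyS (es v, eb v)).mp (hes v hyv).1 g.1 hg)
  simp only [(hes v hyv).1] at hl3
  simp only [(hes u hyu).2] at hl4
  simp only [(hes v hyv).2] at hl5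
  have hplan : Rep (addD G y u v) pos' lab' T' := by
    refine ⟨htw', ?_, ?_⟩
    · have hnone : ∀ a, (a = y ∨ a = u ∨ a = v) → ∃ k, lab' (Sum.inr k, false) = some a := by
        rintro a (rfl | rfl | rfl)
        · exact ⟨0, hl3⟩
        · exact ⟨1, hl4⟩
        · exact ⟨2, hl5⟩
      rintro (_ | a) (_ | b) hab
      · exact absurd hab (by simp [addD])
      · obtain ⟨k, hk⟩ := hnone b hab
        exact ⟨Sum.inr k, true, hl2 k, hk⟩
      · obtain ⟨k, hk⟩ := hnone a hab
        exact ⟨Sum.inr k, false, hk, hl2 k⟩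
      · have hab' : G.Adj a b := hab
        have key : ∃ e c, Q e ∧ lab (e, c) = a ∧ lab (e, !c) = b := by
          by_cases hay : a = y
          · subst hay
            exact ⟨es b, eb b, Or.inl (hesT b hab'), hes b hab'⟩
          · by_cases hby : b = y
            · subst hby
              exact ⟨es a, !eb a, Or.inl (hesT a hab'.symm), (hes a hab'.symm).2,
                by simpa using (hes a hab'.symm).1⟩
            · obtain ⟨e, c, h1, h2⟩ := hrep.adj a b hab'
              refine ⟨e, c, Or.inr ?_, h1, h2⟩
              intro c' hc'
              rcases Bool.eq_or_eq_not c' c with hh | hh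
              · rw [hh, h1] at hc'; exact hay hc'
              · rw [hh, h2] at hc'; exact hby hc'
        obtain ⟨e, c, hQ, h1, h2⟩ := key
        exact ⟨Sum.inl ⟨e, hQ⟩, c, by rw [hl1]; simp [h1], by rw [hl1]; simp [h2]⟩
    · rintro (_ | a)
      · exact ⟨(Sum.inr 0, true), hl2 0⟩
      · -- every vertex has a neighbour, or is a label of a tree edge
        obtain ⟨⟨e, b⟩, hd⟩ := hrep.surj a
        by_cases hQe : Q e
        · exact ⟨(Sum.inl ⟨e, hQe⟩, b), by rw [hl1]; simp [hd]⟩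
        · -- a is y or adjacent to y
          simp only [Q, not_or, not_forall, not_not] at hQe
          obtain ⟨b', hb'⟩ := hQe.2
          by_cases hay : a = y
          · exact ⟨(Sum.inr 0, false), by rw [hl3, hay]⟩
          · have hbb : b = !b' := by
              rcases Bool.eq_or_eq_not b b' with hh | hh
              · rw [hh, hb'] at hd; exact absurd hd.symm hay
              · exact hh
            have hadj : G.Adj y a := by
              have := hMax.adj_of_rep hrep (e := e) (b := b') (by
                rw [hb', ← hbb, hd]; exact fun hh => hay hh.symm)
              rwa [hb', ← hbb, hd] at this
            exact ⟨(Sum.inl ⟨es a, Or.inl (hesT a hadj)⟩, !eb a), by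
              rw [hl1]; simp [(hes a hadj).2]⟩
  have hfinal : WPlanar (addD G y u v) := ⟨_, inferInstance, pos', lab', T', hplan⟩
  by_cases huP : u ∈ P
  · exact ⟨u, huW, v, hvW, huP, huv.mp huP, hfinal⟩
  · have hvP : v ∈ P := by tauto
    refine ⟨v, hvW, u, huW, hvP, huP, ?_⟩
    have : addD G y v u = addD G y u v := by
      ext a b
      rcases a with _ | a <;> rcases b with _ | b <;> simp only [addD] <;> tauto
    rw [this]; exact hfinal

/-- Contracting the new vertex. -/
theorem adj_of_addD {G : SimpleGraph V} (hMax : IsMax G) {y u v : V} (huv : u ≠ v)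
    (h : WPlanar (addD G y u v)) : G.Adj u v := by
  classical
  obtain ⟨E, hE, pos, lab, T, hrep⟩ := h
  let lam : Option V → V := fun x => x.getD u
  obtain ⟨e0, b0, he0, he0'⟩ := hrep.adj none (some u) (by simp [addD])
  have hnu : Reach lab {e0} none (some u) := by
    rw [← he0, ← he0']; exact Reach.edge (Set.mem_singleton _) _ _
  obtain ⟨C, pos', T', hCA, htw⟩ := contraction hrep.tw lam {e0} (by
      rintro e rfl
      have : lam (lab (e, b0)) = lam (lab (e, !b0)) := by rw [he0, he0']; rfl
      cases b0
      · exact this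
      · exact this.symm) (by
      intro d d' hdd
      generalize lab d = x at hdd ⊢
      generalize lab d' = x' at hdd ⊢
      rcases x with _ | x <;> rcases x' with _ | x' <;> simp only [lam, Option.getD] at hdd
      · exact Reach.refl _
      · rw [← hdd]; exact hnu
      · rw [hdd]; exact hnu.symm
      · rw [hdd]; exact Reach.refl _)
  have hC : ∀ e b, lam (lab (e, b)) ≠ lam (lab (e, !b)) → e ∉ C := by
    intro e b hne heC
    have : e = e0 := hCA heC
    subst this
    rcases Bool.eq_or_eq_not b b0 with hh | hh <;> subst hh
    · apply hne; rw [he0, he0']; rfl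
    · apply hne; rw [he0']; simp only [Bool.not_not]; rw [he0]; rfl
  have hadj : ∀ a b, (G ⊔ SimpleGraph.edge u v).Adj a b →
      ∃ e c, lam (lab (e, c)) = a ∧ lam (lab (e, !c)) = b := by
    intro a b hab
    rcases hab with hab | hab
    · obtain ⟨e, c, h1, h2⟩ := hrep.adj (some a) (some b) hab
      exact ⟨e, c, by rw [h1]; rfl, by rw [h2]; rfl⟩
    · rw [SimpleGraph.edge_adj] at hab
      obtain ⟨e, c, h1, h2⟩ := hrep.adj none (some v) (by simp [addD])
      rcases hab.1 with ⟨rfl, rfl⟩ | ⟨rfl, rfl⟩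
      · exact ⟨e, c, by rw [h1]; rfl, by rw [h2]; rfl⟩
      · exact ⟨e, !c, by rw [h2]; rfl, by rw [Bool.not_not, h1]; rfl⟩
  refine hMax.max (G ⊔ SimpleGraph.edge u v) ?_ le_sup_left (Or.inr ?_)
  · refine ⟨_, inferInstance, _, _, _, htw, ?_, ?_⟩
    · intro a b hab
      obtain ⟨e, c, h1, h2⟩ := hadj a b hab
      exact ⟨⟨e, hC e c (by rw [h1, h2]; exact hab.ne)⟩, c, h1, h2⟩
    · intro a
      have key : ∀ a b, (G ⊔ SimpleGraph.edge u v).Adj a b →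
          ∃ d : {e // e ∉ C} × Bool, lam (lab (d.1.1, d.2)) = a := by
        intro a b hab
        obtain ⟨e, c, h1, h2⟩ := hadj a b hab
        exact ⟨(⟨e, hC e c (by rw [h1, h2]; exact hab.ne)⟩, c), h1⟩
      by_cases hau : a = u
      · rw [hau]; exact key u v (Or.inr (by rw [SimpleGraph.edge_adj]; exact ⟨Or.inl ⟨rfl, rfl⟩, huv⟩))
      · obtain ⟨⟨e, b⟩, hd⟩ := hrep.surj (some a)
        refine ⟨(⟨e, ?_⟩, b), by simp only [hd]; rfl⟩
        intro heC
        have : e = e0 := hCA heC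
        subst this
        rcases Bool.eq_or_eq_not b b0 with hh | hh <;> subst hh
        · rw [he0] at hd; simp at hd
        · rw [he0'] at hd; simp at hd; exact hau hd.symm
  · rw [SimpleGraph.edge_adj]; exact ⟨Or.inl ⟨rfl, rfl⟩, huv⟩

/-- Link property of maximal graphs. -/
theorem star_link [Finite V] {G : SimpleGraph V} (hMax : IsMax G) {y z : V} (hz : G.Adj y z)
    (P : Set V) (hP : ∃ p ∈ P, G.Adj y p ∧ p ≠ z) (hQ : ∃ q, q ∉ P ∧ G.Adj y q ∧ q ≠ z) :
    ∃ p ∈ P, ∃ q, q ∉ P ∧ G.Adj y p ∧ p ≠ z ∧ G.Adj y q ∧ q ≠ z ∧ G.Adj p q := by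
  obtain ⟨p, hp, hp1, hp2⟩ := hP
  obtain ⟨q, hq, hq1, hq2⟩ := hQ
  obtain ⟨u, ⟨huW, huz⟩, v, ⟨hvW, hvz⟩, huP, hvP, hpl⟩ := star_gap hMax hz {w | G.Adj y w ∧ w ≠ z} P
    (fun w hw => hw.1) (fun w hw hn => by by_contra hh; exact hn ⟨hw, hh⟩)
    ⟨p, ⟨hp1, hp2⟩, hp⟩ ⟨q, ⟨hq1, hq2⟩, hq⟩
  exact ⟨u, huP, v, hvP, huW, huz, hvW, hvz,
    adj_of_addD hMax (fun hh => hvP (hh ▸ huP)) hpl⟩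

/-- Facial triangle. -/
theorem exists_face [Finite V] {G : SimpleGraph V} (hMax : IsMax G) {y p q : V} (hp : G.Adj y p)
    (hq : G.Adj y q) (hpq : p ≠ q) :
    ∃ u v, G.Adj y u ∧ G.Adj y v ∧ G.Adj u v ∧ WPlanar (addD G y u v) := by
  obtain ⟨u, hu, v, hv, huP, hvP, hpl⟩ := star_gap hMax hp {w | G.Adj y w} {p}
    (fun w hw => hw) (fun w hw hn => absurd hw hn) ⟨p, hp, rfl⟩ ⟨q, hq, fun h => hpq h.symm⟩
  exact ⟨u, v, hu, hv, adj_of_addD hMax (fun hh => hvP (hh ▸ huP)) hpl, hpl⟩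

theorem IsMax.preconnected {G : SimpleGraph V} (hMax : IsMax G) : G.Preconnected := by
  intro u v
  obtain ⟨E, hE, pos, lab, T, hrep⟩ := hMax.planar
  obtain ⟨d, rfl⟩ := hrep.surj u
  obtain ⟨d', rfl⟩ := hrep.surj v
  refine Reach.of_edges (R := G.Reachable) ⟨SimpleGraph.Reachable.refl, SimpleGraph.Reachable.symm,
    SimpleGraph.Reachable.trans⟩ ?_ (walk hrep.tw d d')
  intro e he
  by_cases hne : lab (e, false) = lab (e, true)
  · rw [hne]
  · exact (hMax.adj_of_rep hrep (e := e) (b := false) hne).reachable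

end Star
end SN


namespace SN
section Order
variable {V : Type}

/-- Cut version of connectedness of a vertex set. -/
def CC (G : SimpleGraph V) (U : Set V) : Prop :=
  ∀ A : Set V, (∃ a ∈ U, a ∈ A) → (∃ b ∈ U, b ∉ A) → ∃ a ∈ U, ∃ b ∈ U, a ∈ A ∧ b ∉ A ∧ G.Adj a b

theorem IsMax.cc {G : SimpleGraph V} (hMax : IsMax G) : CC G univ := by
  intro A ⟨a, _, ha⟩ ⟨b, _, hb⟩
  obtain ⟨w⟩ := hMax.preconnected a b
  obtain ⟨d, hd, h1, h2⟩ := w.exists_boundary_dart A ha hb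
  exact ⟨d.fst, mem_univ _, d.snd, mem_univ _, h1, h2, d.adj⟩

theorem star_link0 [Finite V] {G : SimpleGraph V} (hMax : IsMax G) {y : V}
    (P : Set V) (hP : ∃ p ∈ P, G.Adj y p) (hQ : ∃ q, q ∉ P ∧ G.Adj y q) :
    ∃ p ∈ P, ∃ q, q ∉ P ∧ G.Adj y p ∧ G.Adj y q ∧ G.Adj p q := by
  obtain ⟨p, hp, hp1⟩ := hP
  obtain ⟨q, hq, hq1⟩ := hQ
  obtain ⟨u, huW, v, hvW, huP, hvP, hpl⟩ := star_gap hMax hp1 {w | G.Adj y w} P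
    (fun w hw => hw) (fun w hw hn => absurd hw hn)
    ⟨p, hp1, hp⟩ ⟨q, hq1, hq⟩
  exact ⟨u, huP, v, hvP, huW, hvW,
    adj_of_addD hMax (fun hh => hvP (hh ▸ huP)) hpl⟩

theorem order_init [Finite V] {G : SimpleGraph V} (hMax : IsMax G) {v1 v2 vn : V}
    (h12 : G.Adj v1 v2) (h1n : G.Adj v1 vn) (h2n : G.Adj v2 vn) : CC G ({v1, v2}ᶜ) := by
  have key : ∀ A : Set V, A ⊆ ({v1, v2}ᶜ : Set V) → vn ∈ A → (∃ b ∈ ({v1, v2}ᶜ : Set V), b ∉ A) →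
      ∃ a ∈ A, ∃ b ∈ ({v1, v2}ᶜ : Set V), b ∉ A ∧ G.Adj a b := by
    intro A hAU hn ⟨b, hbU, hbA⟩
    by_contra hcon
    push Not at hcon
    have side : ∀ x y : V, ({x, y}ᶜ : Set V) = {v1, v2}ᶜ → G.Adj x y → G.Adj x vn → ∀ q, q ∈ ({v1, v2}ᶜ : Set V) →
        q ∉ A → ¬ G.Adj x q := by
      intro x y hxy hxy' hxn q hq hqA hadj
      have hny : vn ∈ ({x, y}ᶜ : Set V) := hxy ▸ hAU hn
      have hqy : q ∈ ({x, y}ᶜ : Set V) := hxy ▸ hq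
      simp only [mem_compl_iff, mem_insert_iff, mem_singleton_iff, not_or] at hny hqy
      obtain ⟨p, hp, q', hq', h1, h2, h3, h4, h5⟩ := star_link hMax hxy' A ⟨vn, hn, hxn, hny.2⟩ ⟨q, hqA, hadj, hqy.2⟩
      refine hcon p hp q' ?_ hq' h5
      rw [← hxy]
      simp only [mem_compl_iff, mem_insert_iff, mem_singleton_iff, not_or]
      exact ⟨h3.ne', h4⟩
    have s1 := side v1 v2 rfl h12 h1n
    have s2 := side v2 v1 (by rw [pair_comm]) h12.symm h2n
    obtain ⟨a, _, c, _, ha, hc, hac⟩ := hMax.cc {b | b ∈ ({v1, v2}ᶜ : Set V) ∧ b ∉ A} ⟨b, mem_univ _, hbU, hbA⟩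
      ⟨vn, mem_univ _, fun h => h.2 hn⟩
    by_cases hcU : c ∈ ({v1, v2}ᶜ : Set V)
    · have hcA : c ∈ A := by by_contra hh; exact hc ⟨hcU, hh⟩
      exact hcon c hcA a ha.1 ha.2 hac.symm
    · simp only [mem_compl_iff, mem_insert_iff, mem_singleton_iff, not_not] at hcU
      rcases hcU with rfl | rfl
      · exact s1 a ha.1 ha.2 hac.symm
      · exact s2 a ha.1 ha.2 hac.symm
  have hnU : vn ∈ ({v1, v2}ᶜ : Set V) := by
    simp only [mem_compl_iff, mem_insert_iff, mem_singleton_iff, not_or]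
    exact ⟨h1n.ne', h2n.ne'⟩
  intro A ⟨a, haU, haA⟩ ⟨b, hbU, hbA⟩
  by_cases hn : vn ∈ A
  · obtain ⟨p, hp, q, hq, h1, h2⟩ := key (A ∩ {v1, v2}ᶜ) inter_subset_right ⟨hn, hnU⟩ ⟨b, hbU, fun h => hbA h.1⟩
    exact ⟨p, hp.2, q, hq, hp.1, fun h => h1 ⟨h, hq⟩, h2⟩
  · obtain ⟨p, hp, q, hq, h1, h2⟩ := key (Aᶜ ∩ {v1, v2}ᶜ) inter_subset_right ⟨hn, hnU⟩ ⟨a, haU, fun h => h.1 haA⟩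
    exact ⟨q, hq, p, hp.2, by by_contra hh; exact h1 ⟨hh, hq⟩, hp.1, h2.symm⟩

theorem order_step [Finite V] {G : SimpleGraph V} (hMax : IsMax G) {X : Set V} {vn : V}
    (hX : ∀ x ∈ X, ∃ y ∈ X, G.Adj x y) (hXne : X.Nonempty) (hn : vn ∉ X) (hU : CC G Xᶜ)
    (hne : ∃ u, u ∉ X ∧ u ≠ vn) :
    ∃ p, p ∉ X ∧ p ≠ vn ∧ (∃ a ∈ X, ∃ q ∈ X, G.Adj p a ∧ G.Adj p q ∧ G.Adj a q) ∧
      CC G (insert p X)ᶜ ∧ ∃ w, w ∉ X ∧ w ≠ p ∧ G.Adj p w := by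
  classical
  let Good : Set V → Prop := fun D => D.Nonempty ∧ D ⊆ Xᶜ ∧ vn ∉ D ∧ ∃ z, z ∉ X ∧ z ∉ D ∧
    ∀ d ∈ D, ∀ w, G.Adj d w → w ∉ X → w ∈ D ∨ w = z
  have hfin : {D | Good D}.Finite := Set.toFinite _
  obtain ⟨u, hu, hun⟩ := hne
  obtain ⟨D, hD, hmin⟩ := hfin.exists_minimal ⟨Xᶜ \ {vn}, ⟨u, hu, hun⟩, sdiff_subset, fun h => h.2 rfl, vn, hn,
    fun h => h.2 rfl, fun d hd w _ hw => by
      by_cases h : w = vn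
      · exact Or.inr h
      · exact Or.inl ⟨hw, h⟩⟩
  obtain ⟨⟨d0, hd0⟩, hDX, hnD, z, hzX, hzD, hDz⟩ := hD
  have hDX' : ∀ d ∈ D, d ∉ X := fun d hd => hDX hd
  -- D touches X
  have htouch : ∃ d ∈ D, ∃ a ∈ X, G.Adj d a := by
    by_contra hcon
    push Not at hcon
    have hD' : ∀ d ∈ D, ∀ w, G.Adj d w → w ∈ D ∨ w = z := fun d hd w hw =>
      hDz d hd w hw (fun h => hcon d hd w h hw)
    obtain ⟨x, hx⟩ := hXne
    obtain ⟨a, _, b, _, ha, hb, hab⟩ := hMax.cc D ⟨d0, mem_univ _, hd0⟩ ⟨z, mem_univ _, hzD⟩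
    have hbz : b = z := (hD' a ha b hab).resolve_left hb
    subst hbz
    obtain ⟨a', _, b', _, ha', hb', hab'⟩ := hMax.cc (insert b D) ⟨d0, mem_univ _, Or.inr hd0⟩
      ⟨x, mem_univ _, by
        rintro (h | h)
        · exact hzX (h ▸ hx)
        · exact hDX' _ h hx⟩
    have : a' = b := by
      rcases ha' with h | h
      · exact h
      · rcases hD' a' h b' hab' with h' | h'
        · exact absurd (Or.inr h') hb'
        · exact absurd (Or.inl h') hb'
    subst this
    obtain ⟨p, hp, q, hq, h1, h2, h3⟩ := star_link0 hMax D ⟨a, ha, hab.symm⟩ ⟨b', fun h => hb' (Or.inr h), hab'⟩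
    rcases hD' p hp q h3 with h | h
    · exact hq h
    · exact h2.ne h.symm
  obtain ⟨d, hd, a, haX, hda⟩ := htouch
  obtain ⟨q0, hq0X, haq0⟩ := hX a haX
  have hex : ∃ p ∈ D, ∃ q ∈ X, G.Adj p a ∧ G.Adj p q ∧ G.Adj a q := by
    by_cases haz : G.Adj a z
    · obtain ⟨p, hp, q, hq, h1, h2, h3, h4, h5⟩ := star_link hMax haz D
        ⟨d, hd, hda.symm, fun h => hzD (h ▸ hd)⟩ ⟨q0, fun h => hDX' _ h hq0X, haq0, fun h => hzX (h ▸ hq0X)⟩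
      refine ⟨p, hp, q, ?_, h1.symm, h5, h3⟩
      by_contra hqX
      rcases hDz p hp q h5 hqX with h | h
      · exact hq h
      · exact h4 h
    · obtain ⟨p, hp, q, hq, h1, h3, h5⟩ := star_link0 hMax D
        ⟨d, hd, hda.symm⟩ ⟨q0, fun h => hDX' _ h hq0X, haq0⟩
      refine ⟨p, hp, q, ?_, h1.symm, h5, h3⟩
      by_contra hqX
      rcases hDz p hp q h5 hqX with h | h
      · exact hq h
      · exact haz (h ▸ h3)
  obtain ⟨p, hpD, q, hqX, hpa, hpq, haq⟩ := hex
  have hpX := hDX' p hpD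
  have hpn : p ≠ vn := fun h => hnD (h ▸ hpD)
  refine ⟨p, hpX, hpn, ⟨a, haX, q, hqX, hpa, hpq, haq⟩, ?_, ?_⟩
  · have key : ∀ A : Set V, A ⊆ (insert p X)ᶜ → A.Nonempty → z ∉ A →
        ∃ x ∈ A, ∃ y ∈ (insert p X)ᶜ, y ∉ A ∧ G.Adj x y := by
      intro A hA ⟨a0, ha0⟩ hzA
      by_contra hcon
      push Not at hcon
      have hA' : ∀ x ∈ A, ∀ y, G.Adj x y → y ∉ X → y ∈ A ∨ y = p := by
        intro x hx y hxy hyX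
        by_contra hh
        push Not at hh
        exact hcon x hx y (fun h => h.elim hh.2 hyX) hh.1 hxy
      have hAX : ∀ x ∈ A, x ∉ X ∧ x ≠ p := fun x hx => ⟨fun h => hA hx (Or.inr h), fun h => hA hx (Or.inl h)⟩
      by_cases hAD : A ⊆ D
      · have := hmin (y := A) ⟨⟨a0, ha0⟩, fun x hx => (hAX x hx).1, fun h => hnD (hAD h), p, hpX, fun h => (hAX p h).2 rfl, hA'⟩ hAD
        exact (hAX p (this hpD)).2 rfl
      · obtain ⟨a1, ha1, ha1D⟩ := not_subset.mp hAD
        obtain ⟨x, hx, y, hy, hx', hy', hxy⟩ := hU (A \ D) ⟨a1, (hAX a1 ha1).1, ha1, ha1D⟩ ⟨p, hpX, fun h => h.2 hpD⟩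
        have hyD : y ∈ D := by
          rcases hA' x hx'.1 y hxy hy with h | h
          · by_contra hh; exact hy' ⟨h, hh⟩
          · exact h ▸ hpD
        rcases hDz y hyD x hxy.symm hx with h | h
        · exact hx'.2 h
        · exact hzA (h ▸ hx'.1)
    intro A ⟨a, haU, haA⟩ ⟨b, hbU, hbA⟩
    by_cases hn : z ∈ A
    · obtain ⟨p, hp, q, hq, h1, h2⟩ := key (Aᶜ ∩ (insert p X)ᶜ) inter_subset_right ⟨b, hbA, hbU⟩ (fun h => h.1 hn)
      exact ⟨q, hq, p, hp.2, by by_contra hh; exact h1 ⟨hh, hq⟩, hp.1, h2.symm⟩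
    · obtain ⟨p, hp, q, hq, h1, h2⟩ := key (A ∩ (insert p X)ᶜ) inter_subset_right ⟨a, haA, haU⟩ (fun h => hn h.1)
      exact ⟨p, hp.2, q, hq, hp.1, fun h => h1 ⟨h, hq⟩, h2⟩
  · obtain ⟨x, hx, y, hy, rfl, hy', hxy⟩ := hU {p} ⟨p, hpX, rfl⟩ ⟨vn, hn, fun h => hpn h.symm⟩
    exact ⟨y, hy, hy', hxy⟩

/-- Triangular (canonical) order. -/
structure TriOrd (G : SimpleGraph V) (v1 v2 vn : V) (ord : V → ℕ) : Prop where
  inj : Function.Injective ord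
  h1 : ord v1 = 0
  h2 : ord v2 = 1
  adj12 : G.Adj v1 v2
  tri : ∀ v, 2 ≤ ord v → ∃ a b, ord a < ord v ∧ ord b < ord v ∧ G.Adj v a ∧ G.Adj v b ∧ G.Adj a b
  later : ∀ v, v ≠ vn → ∃ w, G.Adj v w ∧ ord v < ord w

theorem exists_triOrd [Finite V] {G : SimpleGraph V} (hMax : IsMax G) {v1 v2 vn : V}
    (h12 : G.Adj v1 v2) (h1n : G.Adj v1 vn) (h2n : G.Adj v2 vn) : ∃ ord, TriOrd G v1 v2 vn ord := by
  classical
  let Inv : ℕ → Set V → (V → ℕ) → Prop := fun m X ord =>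
    InjOn ord X ∧ (∀ x ∈ X, ord x < m) ∧ v1 ∈ X ∧ v2 ∈ X ∧ ord v1 = 0 ∧ ord v2 = 1 ∧ vn ∉ X ∧ CC G Xᶜ ∧
    (∀ v ∈ X, 2 ≤ ord v → ∃ a ∈ X, ∃ b ∈ X, ord a < ord v ∧ ord b < ord v ∧ G.Adj v a ∧ G.Adj v b ∧ G.Adj a b) ∧
    (∀ v ∈ X, ∃ w, G.Adj v w ∧ (w ∈ X → ord v < ord w)) ∧ (∀ x ∈ X, ∃ y ∈ X, G.Adj x y) ∧ 2 ≤ m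
  have hstart0 : ∃ m ord, Inv m {v1, v2} ord := by
    refine ⟨2, fun x => if x = v1 then 0 else 1, ?_, ?_, by simp, by simp, by simp, by simp [h12.ne'], ?_,
      order_init hMax h12 h1n h2n, ?_, ?_, ?_, le_rfl⟩
    · rintro x (rfl | rfl) y (rfl | rfl) h <;> simp_all [h12.ne, h12.ne']
    · rintro x (rfl | rfl) <;> simp <;> split <;> omega
    · simp [h1n.ne', h2n.ne']
    · intro v _ h; simp only at h; split at h <;> omega
    · rintro v (rfl | rfl)
      · exact ⟨vn, h1n, by simp [h1n.ne', h2n.ne']⟩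
      · exact ⟨vn, h2n, by simp [h1n.ne', h2n.ne']⟩
    · rintro v (rfl | rfl)
      · exact ⟨_, by simp, h12⟩
      · exact ⟨_, by simp, h12.symm⟩
  have hfin : {X | ∃ m ord, Inv m X ord}.Finite := Set.toFinite _
  obtain ⟨X, ⟨m, ord, hI⟩, hmax⟩ := hfin.exists_maximal ⟨_, hstart0⟩
  obtain ⟨i1, i2, i3, i4, i5, i6, i7, i8, i9, i10, i11, i12⟩ := hI
  have hfull : ∀ u, u ∉ X → u = vn := by
    by_contra hcon
    push Not at hcon
    obtain ⟨p, hpX, hpn, ⟨a, ha, q, hq, hpa, hpq, haq⟩, hcc, w, hwX, hwp, hpw⟩ := order_step hMax i11 ⟨v1, i3⟩ i7 i8 hcon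
    have hXp : ∀ x ∈ X, x ≠ p := fun x hx h => hpX (h ▸ hx)
    have hop : ∀ x ∈ X, Function.update ord p m x = ord x := fun x hx => Function.update_of_ne (hXp x hx) _ _
    have := hmax (y := insert p X) ⟨m + 1, Function.update ord p m, by
      refine ⟨?_, ?_, Or.inr i3, Or.inr i4, by rw [hop _ i3, i5], by rw [hop _ i4, i6], ?_, hcc, ?_, ?_, ?_, by omega⟩
      · rintro x (rfl | hx) y (rfl | hy) h
        · rfl
        · rw [hop _ hy, Function.update_self] at h
          have := i2 y hy; omega
        · rw [hop _ hx, Function.update_self] at h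
          have := i2 x hx; omega
        · rw [hop _ hx, hop _ hy] at h
          exact i1 hx hy h
      · rintro x (rfl | hx)
        · rw [Function.update_self]; omega
        · rw [hop _ hx]; have := i2 x hx; omega
      · rintro (h | h)
        · exact hpn h.symm
        · exact i7 h
      · rintro x (rfl | hx) h
        · refine ⟨a, Or.inr ha, q, Or.inr hq, ?_, ?_, hpa, hpq, haq⟩
          · rw [hop _ ha, Function.update_self]; exact i2 a ha
          · rw [hop _ hq, Function.update_self]; exact i2 q hq
        · rw [hop _ hx] at h
          obtain ⟨a, ha, b, hb, h1, h2, h3⟩ := i9 x hx h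
          exact ⟨a, Or.inr ha, b, Or.inr hb, by rwa [hop _ ha, hop _ hx], by rwa [hop _ hb, hop _ hx], h3⟩
      · rintro x (rfl | hx)
        · exact ⟨w, hpw, fun h => (h.elim hwp hwX).elim⟩
        · obtain ⟨w', h1, h2⟩ := i10 x hx
          refine ⟨w', h1, ?_⟩
          rintro (rfl | h)
          · rw [hop _ hx, Function.update_self]; exact i2 x hx
          · rw [hop _ hx, hop _ h]; exact h2 h
      · rintro x (rfl | hx)
        · exact ⟨a, Or.inr ha, hpa⟩
        · obtain ⟨y, h1, h2⟩ := i11 x hx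
          exact ⟨y, Or.inr h1, h2⟩⟩ (subset_insert _ _)
    exact hpX (this (Or.inl rfl))
  have hX : ∀ u, u ≠ vn → u ∈ X := fun u hu => by by_contra h; exact hu (hfull u h)
  have hop : ∀ x ∈ X, Function.update ord vn m x = ord x := fun x hx =>
    Function.update_of_ne (fun (h : x = vn) => i7 (h ▸ hx)) _ _
  refine ⟨Function.update ord vn m, ?_, by rw [hop _ i3, i5], by rw [hop _ i4, i6], h12, ?_, ?_⟩
  · intro x y h
    by_cases hx : x = vn <;> by_cases hy : y = vn
    · rw [hx, hy]
    · rw [hop _ (hX _ hy), hx, Function.update_self] at h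
      have := i2 y (hX _ hy); omega
    · rw [hop _ (hX _ hx), hy, Function.update_self] at h
      have := i2 x (hX _ hx); omega
    · rw [hop _ (hX _ hx), hop _ (hX _ hy)] at h
      exact i1 (hX _ hx) (hX _ hy) h
  · intro v hv
    by_cases hvn : v = vn
    · subst hvn
      refine ⟨v1, v2, ?_, ?_, h1n.symm, h2n.symm, h12⟩
      · rw [hop _ i3, Function.update_self]; exact i2 _ i3
      · rw [hop _ i4, Function.update_self]; exact i2 _ i4
    · have hvX := hX _ hvn
      rw [hop _ hvX] at hv
      obtain ⟨a, ha, b, hb, h1, h2, h3⟩ := i9 v hvX hv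
      exact ⟨a, b, by rwa [hop _ ha, hop _ hvX], by rwa [hop _ hb, hop _ hvX], h3⟩
  · intro v hv
    have hvX := hX _ hv
    obtain ⟨w, h1, h2⟩ := i10 v hvX
    refine ⟨w, h1, ?_⟩
    by_cases hw : w = vn
    · rw [hop _ hvX, hw, Function.update_self]; exact i2 _ hvX
    · rw [hop _ hvX, hop _ (hX _ hw)]; exact h2 (hX _ hw)
end Order
end SN


namespace SN
section Dom
variable {V : Type}

theorem CC.insert {G : SimpleGraph V} {B : Set V} (h : CC G B) {x : V} (hx : x ∈ B ∨ ∃ b ∈ B, G.Adj x b) :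
    CC G (insert x B) := by
  rcases hx with hx | ⟨b0, hb0, hxb⟩
  · rwa [Set.insert_eq_of_mem hx]
  · by_cases hxB : x ∈ B
    · rwa [Set.insert_eq_of_mem hxB]
    rintro A ⟨a, ha, haA⟩ ⟨b, hb, hbA⟩
    by_cases h1 : ∃ a ∈ B, a ∈ A
    · by_cases h2 : ∃ b ∈ B, b ∉ A
      · obtain ⟨a, ha, b, hb, h3⟩ := h A h1 h2
        exact ⟨a, Or.inr ha, b, Or.inr hb, h3⟩
      · push Not at h2
        rcases hb with rfl | hb
        · exact ⟨b0, Or.inr hb0, b, Or.inl rfl, h2 _ hb0, hbA, hxb.symm⟩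
        · exact absurd (h2 b hb) hbA
    · push Not at h1
      rcases ha with rfl | ha
      · exact ⟨a, Or.inl rfl, b0, Or.inr hb0, haA, h1 _ hb0, hxb⟩
      · exact absurd haA (h1 a ha)

theorem dominating_aux [DecidableEq V] {G : SimpleGraph V} (ord : V → ℕ) (hinj : Function.Injective ord) (a b : V → V)
    {v1 v2 : V} (h12 : G.Adj v1 v2) : ∀ (k : ℕ) (X : Finset V), X.card ≤ k → v1 ∈ X → v2 ∈ X →
    (∀ v ∈ X, v ≠ v1 → v ≠ v2 → a v ∈ X ∧ b v ∈ X ∧ ord (a v) < ord v ∧ ord (b v) < ord v ∧ G.Adj v (a v) ∧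
      G.Adj v (b v) ∧ G.Adj (a v) (b v)) →
    ∃ B : Finset V, B ⊆ X ∧ B.Nonempty ∧ 2 * B.card ≤ X.card ∧ CC G (B : Set V) ∧ ∀ v ∈ X, v ∈ B ∨ ∃ b ∈ B, G.Adj v b := by
  intro k
  induction k with
  | zero =>
    intro X hX h1
    exact absurd (Finset.card_pos.mpr ⟨_, h1⟩) (by omega)
  | succ k ih =>
    intro X hXk h1 h2 hdep
    by_cases hall : ∀ v ∈ X, v ≠ v1 → v ≠ v2 → (a v = v1 ∨ a v = v2) ∧ (b v = v1 ∨ b v = v2)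
    · refine ⟨{v1}, by simpa using h1, ⟨v1, by simp⟩, ?_, ?_, ?_⟩
      · have : ({v1, v2} : Finset V).card ≤ X.card := Finset.card_le_card (by
          intro x; simp only [Finset.mem_insert, Finset.mem_singleton]; rintro (rfl | rfl) <;> assumption)
        rw [Finset.card_pair h12.ne] at this
        simpa using this
      · rintro A ⟨x, hx, hxA⟩ ⟨y, hy, hyA⟩
        simp only [Finset.coe_singleton, mem_singleton_iff] at hx hy
        subst hx; subst hy; exact absurd hxA hyA
      · intro v hv
        by_cases e1 : v = v1
        · left; simp [e1]
        · right
          refine ⟨v1, by simp, ?_⟩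
          by_cases e2 : v = v2
          · rw [e2]; exact h12.symm
          · obtain ⟨_, _, _, _, d1, d2, d3⟩ := hdep v hv e1 e2
            rcases hall v hv e1 e2 with ⟨h | h, h' | h'⟩
            · rwa [h] at d1
            · rwa [h] at d1
            · rwa [h'] at d2
            · rw [h, h'] at d3; exact absurd rfl d3.ne
    · push Not at hall
      let Dp : V → Finset V := fun x => X.filter fun v => v ≠ v1 ∧ v ≠ v2 ∧ (a v = x ∨ b v = x)
      let Y := X.filter fun x => x ≠ v1 ∧ x ≠ v2 ∧ (Dp x).Nonempty
      have hY : Y.Nonempty := by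
        obtain ⟨v, hv, e1, e2, h⟩ := hall
        obtain ⟨d1, d2, _⟩ := hdep v hv e1 e2
        by_cases ha : a v = v1 ∨ a v = v2
        · obtain ⟨h1', h2'⟩ := h ha
          exact ⟨b v, Finset.mem_filter.mpr ⟨d2, h1', h2', v, Finset.mem_filter.mpr ⟨hv, e1, e2, Or.inr rfl⟩⟩⟩
        · push Not at ha
          exact ⟨a v, Finset.mem_filter.mpr ⟨d1, ha.1, ha.2, v, Finset.mem_filter.mpr ⟨hv, e1, e2, Or.inl rfl⟩⟩⟩
      obtain ⟨x, hxY, hxmax⟩ := Finset.exists_max_image Y ord hY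
      obtain ⟨hxX, hx1, hx2, hxD⟩ := Finset.mem_filter.mp hxY
      have hmem : ∀ {v x}, v ∈ Dp x ↔ v ∈ X ∧ v ≠ v1 ∧ v ≠ v2 ∧ (a v = x ∨ b v = x) := by
        intro v x; simp only [Dp, Finset.mem_filter]
      have hordD : ∀ w ∈ Dp x, ord x < ord w := by
        intro w hw
        obtain ⟨h, e1, e2, h3⟩ := hmem.mp hw
        obtain ⟨_, _, d3, d4, _⟩ := hdep w h e1 e2
        rcases h3 with rfl | rfl <;> assumption
      have hadjD : ∀ w ∈ Dp x, G.Adj w x := by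
        intro w hw
        obtain ⟨h, e1, e2, h3⟩ := hmem.mp hw
        obtain ⟨_, _, _, _, d5, d6, _⟩ := hdep w h e1 e2
        rcases h3 with rfl | rfl <;> assumption
      have hnoD : ∀ w ∈ X, ord x < ord w → w ≠ v1 → w ≠ v2 → ∀ v, v ∉ Dp w := by
        intro w hw hlt e1 e2 v hv
        have := hxmax w (Finset.mem_filter.mpr ⟨hw, e1, e2, v, hv⟩)
        omega
      by_cases hm : 2 ≤ (Dp x).card
      · have hsub : Dp x ⊆ X := Finset.filter_subset _ _
        have hcard := Finset.card_sdiff_add_card_eq_card hsub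
        obtain ⟨B, hBX, hBne, hBc, hBcc, hBd⟩ := ih (X \ Dp x) (by omega)
          (Finset.mem_sdiff.mpr ⟨h1, fun h => (hmem.mp h).2.1 rfl⟩)
          (Finset.mem_sdiff.mpr ⟨h2, fun h => (hmem.mp h).2.2.1 rfl⟩) (by
            intro v hv e1 e2
            obtain ⟨hv1, hv2⟩ := Finset.mem_sdiff.mp hv
            obtain ⟨d1, d2, d3⟩ := hdep v hv1 e1 e2
            refine ⟨Finset.mem_sdiff.mpr ⟨d1, fun h => ?_⟩, Finset.mem_sdiff.mpr ⟨d2, fun h => ?_⟩, d3⟩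
            · obtain ⟨h', h1', h2', _⟩ := hmem.mp h
              exact hnoD _ h' (hordD _ h) h1' h2' v (hmem.mpr ⟨hv1, e1, e2, Or.inl rfl⟩)
            · obtain ⟨h', h1', h2', _⟩ := hmem.mp h
              exact hnoD _ h' (hordD _ h) h1' h2' v (hmem.mpr ⟨hv1, e1, e2, Or.inr rfl⟩))
        have hxX' : x ∈ X \ Dp x := Finset.mem_sdiff.mpr ⟨hxX, fun h => by have := hordD _ h; omega⟩
        refine ⟨insert x B, ?_, ⟨x, by simp⟩, ?_, ?_, ?_⟩
        · intro y hy
          rcases Finset.mem_insert.mp hy with rfl | hy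
          · exact hxX
          · exact (Finset.mem_sdiff.mp (hBX hy)).1
        · have := Finset.card_insert_le x B
          omega
        · rw [Finset.coe_insert]
          exact hBcc.insert (hBd x hxX')
        · intro v hv
          by_cases hvD : v ∈ Dp x
          · exact Or.inr ⟨x, by simp, hadjD v hvD⟩
          · rcases hBd v (Finset.mem_sdiff.mpr ⟨hv, hvD⟩) with h | ⟨b, h, h'⟩
            · exact Or.inl (Finset.mem_insert_of_mem h)
            · exact Or.inr ⟨b, Finset.mem_insert_of_mem h, h'⟩
      · obtain ⟨w, hw⟩ := Finset.card_eq_one.mp (by have := hxD.card_pos; omega : (Dp x).card = 1)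
        have hwD : w ∈ Dp x := by rw [hw]; simp
        obtain ⟨hwX, hw1, hw2, hwx⟩ := hmem.mp hwD
        obtain ⟨d1, d2, d3, d4, d5, d6, d7⟩ := hdep w hwX hw1 hw2
        obtain ⟨y, hyX, hyx, hyw, hwy⟩ : ∃ y ∈ X, G.Adj x y ∧ G.Adj w y ∧ w ∈ X ∧ (a w = y ∨ b w = y) := by
          rcases hwx with rfl | rfl
          · exact ⟨b w, d2, d7, d6, hwX, Or.inr rfl⟩
          · exact ⟨a w, d1, d7.symm, d5, hwX, Or.inl rfl⟩
        have hxw : x ≠ w := fun h => by have := hordD w hwD; rw [h] at this; omega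
        have hsub : ({x, w} : Finset V) ⊆ X := by
          intro z; simp only [Finset.mem_insert, Finset.mem_singleton]; rintro (rfl | rfl) <;> assumption
        have hcard := Finset.card_sdiff_add_card_eq_card hsub
        rw [Finset.card_pair hxw] at hcard
        have hmem' : ∀ {v}, v ∈ X \ ({x, w} : Finset V) ↔ v ∈ X ∧ v ≠ x ∧ v ≠ w := by
          intro v; simp
        obtain ⟨B, hBX, hBne, hBc, hBcc, hBd⟩ := ih (X \ {x, w}) (by omega)
          (hmem'.mpr ⟨h1, hx1.symm, hw1.symm⟩)
          (hmem'.mpr ⟨h2, hx2.symm, hw2.symm⟩) (by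
            intro v hv e1 e2
            obtain ⟨hv1, hv2, hv3⟩ := hmem'.mp hv
            obtain ⟨d1, d2, d3⟩ := hdep v hv1 e1 e2
            have hvD : v ∉ Dp x := by rw [hw]; simpa using hv3
            have hvD' : v ∉ Dp w := hnoD w hwX (hordD w hwD) hw1 hw2 v
            refine ⟨hmem'.mpr ⟨d1, fun h => ?_, fun h => ?_⟩, hmem'.mpr ⟨d2, fun h => ?_, fun h => ?_⟩, d3⟩
            · exact hvD (hmem.mpr ⟨hv1, e1, e2, Or.inl h⟩)
            · exact hvD' (hmem.mpr ⟨hv1, e1, e2, Or.inl h⟩)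
            · exact hvD (hmem.mpr ⟨hv1, e1, e2, Or.inr h⟩)
            · exact hvD' (hmem.mpr ⟨hv1, e1, e2, Or.inr h⟩))
        have hyX' : y ∈ X \ ({x, w} : Finset V) := hmem'.mpr ⟨hyX, hyx.ne', hyw.ne'⟩
        refine ⟨insert y B, ?_, ⟨y, by simp⟩, ?_, ?_, ?_⟩
        · intro z hz
          rcases Finset.mem_insert.mp hz with rfl | hz
          · exact hyX
          · exact (hmem'.mp (hBX hz)).1
        · have := Finset.card_insert_le y B
          omega
        · rw [Finset.coe_insert]
          exact hBcc.insert (hBd y hyX')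
        · intro v hv
          by_cases hvx : v = x
          · exact Or.inr ⟨y, by simp, hvx ▸ hyx⟩
          by_cases hvw : v = w
          · exact Or.inr ⟨y, by simp, hvw ▸ hyw⟩
          rcases hBd v (hmem'.mpr ⟨hv, hvx, hvw⟩) with h | ⟨b, h, h'⟩
          · exact Or.inl (Finset.mem_insert_of_mem h)
          · exact Or.inr ⟨b, Finset.mem_insert_of_mem h, h'⟩

theorem TriOrd.dominating [Fintype V] {G : SimpleGraph V} {v1 v2 vn : V} {ord : V → ℕ} (h : TriOrd G v1 v2 vn ord) :
    ∃ B : Finset V, B.Nonempty ∧ 2 * B.card ≤ Fintype.card V ∧ CC G (B : Set V) ∧ ∀ v, v ∈ B ∨ ∃ b ∈ B, G.Adj v b := by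
  classical
  have hch : ∀ v, ∃ a b, 2 ≤ ord v → ord a < ord v ∧ ord b < ord v ∧ G.Adj v a ∧ G.Adj v b ∧ G.Adj a b := by
    intro v
    by_cases hv : 2 ≤ ord v
    · obtain ⟨a, b, h⟩ := h.tri v hv
      exact ⟨a, b, fun _ => h⟩
    · exact ⟨v, v, fun h => absurd h hv⟩
  choose a b hab using hch
  obtain ⟨B, _, h1, h2, h3, h4⟩ := dominating_aux ord h.inj a b h.adj12 _ Finset.univ le_rfl (Finset.mem_univ v1) (Finset.mem_univ v2)
    (by
      intro v _ e1 e2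
      have : 2 ≤ ord v := by
        have : ord v ≠ 0 := fun hh => e1 (h.inj (hh.trans h.h1.symm))
        have : ord v ≠ 1 := fun hh => e2 (h.inj (hh.trans h.h2.symm))
        omega
      obtain ⟨c1, c2, c3⟩ := hab v this
      exact ⟨Finset.mem_univ _, Finset.mem_univ _, c1, c2, c3⟩)
  exact ⟨B, h1, h2, h3, fun v => h4 v (Finset.mem_univ _)⟩
end Dom
end SN


namespace SN
section OnePage
variable {E V : Type}

/-- One page slot arrangement. -/
structure OP (sl : E × Bool → ℤ) (lab : E × Bool → V) : Prop where
  inj : Function.Injective sl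
  nce : ∀ e f b c, e ≠ f → sl (e, b) < sl (f, c) → sl (f, c) < sl (e, !b) →
    sl (e, b) < sl (f, !c) ∧ sl (f, !c) < sl (e, !b)
  ncl : ∀ d1 d2 d3 d4, sl d1 < sl d2 → sl d2 < sl d3 → sl d3 < sl d4 → lab d1 = lab d3 →
    lab d2 = lab d4 → lab d1 = lab d2

theorem onePage {pos : E × Bool → ℤ} {lab : E × Bool → V} {T : Set E} (h : IsTW pos lab T) :
    ∃ sl : E × Bool → ℤ, OP sl lab ∧
      (∀ e ∈ T, ∃ b, pos (e, b) < pos (e, !b) ∧ sl (e, !b) = sl (e, b) + 1) ∧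
      (∀ d0, (∀ d, pos d0 ≤ pos d) → ∀ d, sl d0 ≤ sl d) := by
  classical
  choose c hc hS using exists_minmax pos h.inj
  let sl : E × Bool → ℤ := fun d => if d.1 ∈ T ∧ d.2 = !(c d.1) then 2 * pos (d.1, c d.1) + 1 else 2 * pos d
  have sl_nt : ∀ e b, e ∉ T → sl (e, b) = 2 * pos (e, b) := by
    intro e b he; simp [sl, he]
  have sl_min : ∀ e, sl (e, c e) = 2 * pos (e, c e) := by
    intro e; simp [sl]
  have sl_max : ∀ e, e ∈ T → sl (e, !(c e)) = 2 * pos (e, c e) + 1 := by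
    intro e he; simp [sl, he]
  have hcases : ∀ e b, (sl (e, b) = 2 * pos (e, b) ∧ (e ∈ T → b = c e)) ∨
      (e ∈ T ∧ b = !(c e) ∧ sl (e, b) = 2 * pos (e, c e) + 1) := by
    intro e b
    by_cases he : e ∈ T
    · by_cases hb : b = c e
      · left; subst hb; exact ⟨sl_min e, fun _ => rfl⟩
      · right
        have : b = !(c e) := by revert hb; cases b <;> cases c e <;> simp
        subst this; exact ⟨he, rfl, sl_max e he⟩
    · left; exact ⟨sl_nt e b he, fun h => absurd h he⟩
  have pne : ∀ d d', d ≠ d' → pos d ≠ pos d' := fun d d' hd hh => hd (h.inj hh)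
  -- sides in slot coordinates
  have side : ∀ g ∈ T, ∀ d, S pos g (pos d) = true ↔ 2 * pos (g, c g) < sl d ∧ sl d ≤ 2 * pos (g, !(c g)) := by
    rintro g hg ⟨e, b⟩
    rw [hS]
    rcases hcases e b with ⟨h1, h2⟩ | ⟨he, hb, h1⟩
    · rw [h1]; omega
    · rw [h1]
      subst hb
      by_cases heg : e = g
      · subst heg; have := hc e; omega
      · have hnc := (alt_false_iff (c e)).mp (h.nc g e (Ne.symm heg) (by simp [hg, he]))
        have e1 := hS g (pos (e, c e))
        have e2 := hS g (pos (e, !(c e)))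
        rw [← hnc] at e2
        have p1 := pne (e, c e) (g, c g) (by simp [heg])
        have p2 := pne (e, c e) (g, !(c g)) (by simp [heg])
        rw [← e2, e1]; omega
  have hinj : Function.Injective sl := by
    rintro ⟨e, b⟩ ⟨f, b'⟩ hh
    rcases hcases e b with ⟨h1, h2⟩ | ⟨he, hb, h1⟩ <;> rcases hcases f b' with ⟨h1', h2'⟩ | ⟨he', hb', h1'⟩
    · exact h.inj (by omega)
    · omega
    · omega
    · have := h.inj (by omega : pos (e, c e) = pos (f, c f))
      simp only [Prod.mk.injEq] at this
      obtain ⟨rfl, _⟩ := this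
      rw [hb, hb']
  refine ⟨sl, ⟨hinj, ?_, ?_⟩, ?_, ?_⟩
  · intro e f b b' hef hlt hlt'
    have hnn : e ∉ T := by
      intro he
      by_cases hb : b = c e
      · subst hb
        rw [sl_min] at hlt; rw [sl_max e he] at hlt'; omega
      · have : b = !(c e) := by revert hb; cases b <;> cases c e <;> simp
        subst this
        rw [Bool.not_not, sl_min] at hlt'; rw [sl_max e he] at hlt; omega
    rw [sl_nt _ _ hnn, sl_nt _ _ hnn] at *
    by_cases hf : f ∈ T
    · have hne : ∀ b b', pos (e, b) ≠ pos (f, b') := fun b b' => pne _ _ (by simp [hef])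
      by_cases hb : b' = c f
      · subst hb
        have := sl_max f hf
        have h2 := sl_min f
        have := hne b (c f)
        have := hne (!b) (c f)
        omega
      · have : b' = !(c f) := by revert hb; cases b' <;> cases c f <;> simp
        subst this
        rw [Bool.not_not]
        have := sl_max f hf
        have h2 := sl_min f
        have := hne b (c f)
        have := hne (!b) (c f)
        omega
    · rw [sl_nt _ _ hf] at *
      have hnc := (alt_false_iff b').mp (h.nc e f hef (by simp [hnn, hf]))
      have hne : ∀ b b', pos (e, b) ≠ pos (f, b') := fun b b' => pne _ _ (by simp [hef])
      have q1 := hne b b'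
      have q2 := hne (!b) b'
      have q3 := hne b (!b')
      have q4 := hne (!b) (!b')
      have hbc : b = c e := by
        by_contra hb
        have : b = !(c e) := by revert hb; cases b <;> cases c e <;> simp
        subst this
        have := hc e
        rw [Bool.not_not] at hlt'; omega
      subst hbc
      have e1 := hS e (pos (f, b'))
      have e2 := hS e (pos (f, !b'))
      rw [← hnc] at e2
      have := e2.mp (e1.mpr (by omega))
      omega
  · intro d1 d2 d3 d4 h12 h23 h34 h13 h24
    rw [h.L] at h13 h24 ⊢
    intro g hg
    have a1 := h13 g hg
    have a2 := h24 g hg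
    have s1 := side g hg d1
    have s2 := side g hg d2
    have s3 := side g hg d3
    have s4 := side g hg d4
    rw [← a1] at s3
    rw [← a2] at s4
    rw [Bool.eq_iff_iff]
    constructor
    · intro hh
      exact s2.mpr (by have := s1.mp hh; have := s3.mp hh; omega)
    · intro hh
      exact s3.mpr (by have := s2.mp hh; have := s4.mp hh; omega)
  · intro e he
    exact ⟨c e, hc e, by rw [sl_min, sl_max e he]⟩
  · rintro ⟨e0, b0⟩ hmin ⟨e, b⟩
    have hb0 : sl (e0, b0) = 2 * pos (e0, b0) := by
      rcases hcases e0 b0 with ⟨h1, _⟩ | ⟨he, hb, h1⟩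
      · exact h1
      · have := hmin (e0, c e0); have := hc e0; subst hb; omega
    rw [hb0]
    rcases hcases e b with ⟨h1, _⟩ | ⟨he, hb, h1⟩
    · have := hmin (e, b); omega
    · have := hmin (e, c e); omega

theorem OP.inside {sl : E × Bool → ℤ} {lab : E × Bool → V} (h : OP sl lab) {T : Set E}
    (hT : ∀ e ∈ T, ∃ b, sl (e, !b) = sl (e, b) + 1)
    {u : V} {d1 d2 : E × Bool} (hu1 : lab d1 = u) (hu2 : lab d2 = u) {A : Set E}
    (hA : ∀ e ∈ A, e ∈ T ∧ lab (e, false) ≠ u ∧ lab (e, true) ≠ u) {w w' : V} (hw : w ≠ u)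
    (hr : Reach lab A w w') (hd : ∃ d, lab d = w ∧ sl d1 < sl d ∧ sl d < sl d2) :
    ∀ d, lab d = w' → sl d1 < sl d ∧ sl d < sl d2 := by
  have all : ∀ x, x ≠ u → (∃ d, lab d = x ∧ sl d1 < sl d ∧ sl d < sl d2) →
      ∀ d, lab d = x → sl d1 < sl d ∧ sl d < sl d2 := by
    rintro x hx ⟨d, rfl, h1, h2⟩ d' hd'
    have n1 : sl d1 ≠ sl d' := fun hh => hx (by rw [← hd', ← hu1, h.inj hh])
    have n2 : sl d2 ≠ sl d' := fun hh => hx (by rw [← hd', ← hu2, h.inj hh])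
    by_contra hcon
    rcases (by omega : sl d' < sl d1 ∨ sl d2 < sl d') with h3 | h3
    · exact hx (hd'.symm.trans ((h.ncl d' d1 d d2 h3 h1 h2 hd' (hu1.trans hu2.symm)).trans hu1))
    · exact hx ((h.ncl d1 d d2 d' h1 h2 h3 (hu1.trans hu2.symm) hd'.symm).symm.trans hu1)
  let I : V → Prop := fun x => ∀ d, lab d = x → sl d1 < sl d ∧ sl d < sl d2
  have hR : Equivalence (fun x y => I x ↔ I y) := ⟨fun _ => Iff.rfl, fun h => h.symm, fun h h' => h.trans h'⟩
  have hkey : ∀ e ∈ A, ∀ b, I (lab (e, b)) → I (lab (e, !b)) := by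
    intro e he b hI
    have hlt := hI (e, b) rfl
    obtain ⟨heT, hf, ht⟩ := hA e he
    have hneu : ∀ b, lab (e, b) ≠ u := by intro b; cases b <;> assumption
    refine all _ (hneu _) ⟨(e, !b), rfl, ?_⟩
    obtain ⟨b0, hb0⟩ := hT e heT
    have m1 : sl d1 ≠ sl (e, !b) := fun hh => hneu (!b) (by rw [← h.inj hh, hu1])
    have m2 : sl d2 ≠ sl (e, !b) := fun hh => hneu (!b) (by rw [← h.inj hh, hu2])
    by_cases hbb : b = b0
    · subst hbb; omega
    · have : b = !b0 := by revert hbb; cases b <;> cases b0 <;> simp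
      subst this
      rw [Bool.not_not] at *
      omega
  have := Reach.of_edges hR (A := A) (fun e he => ⟨hkey e he false, hkey e he true⟩) hr
  exact this.mp (all w hw hd)
end OnePage
end SN


namespace SN
section Vis
variable {V : Type}

theorem exists_kappa [Finite V] {G : SimpleGraph V} (hP : WPlanar G) {ord : V → ℕ} (hinj : Function.Injective ord)
    {v0 vn : V} (h0n : G.Adj v0 vn) (hv0 : ∀ v, ord v0 ≤ ord v) (hvn : ∀ v, ord v ≤ ord vn)
    (hearly : ∀ v, v ≠ v0 → ∃ w, G.Adj v w ∧ ord w < ord v)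
    (hlate : ∀ v, v ≠ vn → ∃ w, G.Adj v w ∧ ord v < ord w) :
    ∃ κ : V → V → ℤ,
      (∀ u v u' v', G.Adj u v → ord u < ord v → G.Adj u' v' → ord u' < ord v' → κ u v = κ u' v' → u = u' ∧ v = v') ∧
      (∀ u v, G.Adj u v → ord u < ord v → κ v0 vn ≤ κ u v) ∧
      (∀ u v w a b a' b', G.Adj u v → ord u < ord w → ord w < ord v →
        G.Adj a b → ord a < ord b → (w = a ∨ w = b) →
        G.Adj a' b' → ord a' < ord b' → (w = a' ∨ w = b') → ¬ (κ a b < κ u v ∧ κ u v < κ a' b')) := by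
  classical
  obtain ⟨E, hE, pos0, lab, T0, hrep⟩ := hP
  have hEn : Nonempty E := by
    obtain ⟨e, _⟩ := hrep.adj _ _ h0n; exact ⟨e⟩
  have hch : ∀ u v, ∃ (e : E) (b : Bool), G.Adj u v → lab (e, b) = u ∧ lab (e, !b) = v := by
    intro u v
    by_cases huv : G.Adj u v
    · obtain ⟨e, b, h⟩ := hrep.adj u v huv
      exact ⟨e, b, fun _ => h⟩
    · exact ⟨hEn.some, true, fun h => absurd h huv⟩
  choose es eb hes using hch
  have hpar : ∀ v, ∃ w, (v ≠ vn → G.Adj v w ∧ ord v < ord w) ∧ (v = v0 → w = vn) := by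
    intro v
    by_cases hv : v = v0
    · subst hv
      refine ⟨vn, fun _ => ⟨h0n, ?_⟩, fun _ => rfl⟩
      exact lt_of_le_of_ne (hvn _) (fun hh => h0n.ne (hinj hh))
    · by_cases hv' : v = vn
      · exact ⟨v, fun h => absurd hv' h, fun h => absurd h hv⟩
      · obtain ⟨w, hw⟩ := hlate v hv'
        exact ⟨w, fun _ => hw, fun h => absurd h hv⟩
  choose par hpar1 hpar2 using hpar
  let pe : V → E := fun v => es v (par v)
  let pb : V → Bool := fun v => eb v (par v)
  have hpe : ∀ v, v ≠ vn → lab (pe v, pb v) = v ∧ lab (pe v, !(pb v)) = par v := fun v hv =>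
    hes v (par v) (hpar1 v hv).1
  let F : Set E := pe '' {v | v ≠ vn}
  -- chain reachability
  have hchain : ∀ (m : ℕ) (k : ℕ) (x : V), ord vn - ord x ≤ k → m < ord x →
      Reach lab (pe '' {v | v ≠ vn ∧ m < ord v}) x vn := by
    intro m k
    induction k with
    | zero =>
      intro x hx _
      have : x = vn := hinj (by have := hvn x; omega)
      rw [this]; exact Reach.refl _
    | succ k ih =>
      intro x hx hmx
      by_cases hxn : x = vn
      · rw [hxn]; exact Reach.refl _
      · obtain ⟨h1, h2⟩ := hpar1 x hxn
        have hr : Reach lab (pe '' {v | v ≠ vn ∧ m < ord v}) (lab (pe x, pb x)) (lab (pe x, !(pb x))) :=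
          Reach.edge (A := pe '' {v | v ≠ vn ∧ m < ord v}) ⟨x, ⟨hxn, hmx⟩, rfl⟩ _ _
        rw [(hpe x hxn).1, (hpe x hxn).2] at hr
        exact hr.trans (ih _ (by have := hvn (par x); omega) (by omega))
  have hFconn0 : ∀ (k : ℕ) (x : V), ord vn - ord x ≤ k → Reach lab F x vn := by
    intro k
    induction k with
    | zero =>
      intro x hx
      have : x = vn := hinj (by have := hvn x; omega)
      rw [this]; exact Reach.refl _
    | succ k ih =>
      intro x hx
      by_cases hxn : x = vn
      · rw [hxn]; exact Reach.refl _
      · obtain ⟨h1, h2⟩ := hpar1 x hxn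
        have hr : Reach lab F (lab (pe x, pb x)) (lab (pe x, !(pb x))) :=
          Reach.edge (Set.mem_image_of_mem _ hxn) _ _
        rw [(hpe x hxn).1, (hpe x hxn).2] at hr
        exact hr.trans (ih _ (by have := hvn (par x); omega))
  have hacyc : Acyc lab F := by
    rintro f ⟨v, hv, rfl⟩ hr
    let A : V → Prop := fun x => ∃ k, par^[k] x = v ∧ ∀ j < k, par^[j] x ≠ vn
    have hR : Equivalence (fun x y => A x ↔ A y) := ⟨fun _ => Iff.rfl, fun h => h.symm, fun h h' => h.trans h'⟩
    have hstep : ∀ x, x ≠ vn → x ≠ v → (A x ↔ A (par x)) := by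
      intro x hx hxv
      constructor
      · rintro ⟨k, hk, hj⟩
        cases k with
        | zero => exact absurd hk hxv
        | succ k => exact ⟨k, hk, fun j hjk => hj (j + 1) (by omega)⟩
      · rintro ⟨k, hk, hj⟩
        refine ⟨k + 1, hk, ?_⟩
        intro j hjk
        cases j with
        | zero => exact hx
        | succ j => exact hj j (by omega)
    have hmono : ∀ k x, (∀ j < k, par^[j] x ≠ vn) → ord x ≤ ord (par^[k] x) := by
      intro k
      induction k with
      | zero => intro x _; exact le_rfl
      | succ k ih =>
        intro x hx
        have h1 := ih x (fun j hj => hx j (by omega))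
        have h2 := (hpar1 _ (hx k (by omega))).2
        rw [Function.iterate_succ_apply']
        omega
    have h1 := Reach.of_edges hR (A := F \ {pe v}) (by
      rintro e ⟨⟨x, hx, rfl⟩, hne⟩
      have hxv : x ≠ v := fun h => hne (by rw [h]; rfl)
      obtain ⟨l1, l2⟩ := hpe x hx
      have := hstep x hx hxv
      revert l1 l2
      cases pb x
      · intro l1 l2
        rw [l1, show lab (pe x, true) = par x from l2]
        exact this
      · intro l1 l2
        rw [l1, show lab (pe x, false) = par x from l2]
        exact this.symm) hr
    obtain ⟨l1, l2⟩ := hpe v hv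
    have hAv : A v := ⟨0, rfl, fun j hj => absurd hj (by omega)⟩
    have hAp : ¬ A (par v) := by
      rintro ⟨k, hk, hj⟩
      have := hmono k _ hj
      rw [hk] at this
      have := (hpar1 v hv).2
      omega
    revert l1 l2
    cases pb v
    · intro l1 l2
      rw [l1, show lab (pe v, true) = par v from l2] at h1
      exact hAp (h1.mp hAv)
    · intro l1 l2
      rw [l1, show lab (pe v, false) = par v from l2] at h1
      exact hAp (h1.mpr hAv)
  obtain ⟨pos1, T1, htw1, hFT⟩ := forest_ext hacyc hrep.tw
  have hT1 : T1 = F := tree_eq htw1 hFT (fun d d' => (hFconn0 _ _ le_rfl).trans (hFconn0 _ _ le_rfl).symm)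
  subst hT1
  have hv0n : v0 ≠ vn := h0n.ne
  obtain ⟨pos, htw, hmin⟩ := rotation htw1 (pe v0, !(pb v0))
  obtain ⟨sl, hop, hslT, hslmin⟩ := onePage htw
  have hfirst := hslmin _ hmin
  have hlab0 : lab (pe v0, pb v0) = v0 := (hpe v0 hv0n).1
  have hlabn : lab (pe v0, !(pb v0)) = vn := by rw [(hpe v0 hv0n).2, hpar2 v0 rfl]
  have hsec : sl (pe v0, pb v0) = sl (pe v0, !(pb v0)) + 1 := by
    obtain ⟨b, _, hb⟩ := hslT (pe v0) (Set.mem_image_of_mem _ hv0n)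
    by_cases hbb : b = pb v0
    · subst hbb; have := hfirst (pe v0, pb v0); omega
    · have : b = !(pb v0) := by revert hbb; cases b <;> cases pb v0 <;> simp
      subst this
      rwa [Bool.not_not] at hb
  -- K
  have hK : ∀ d1 d d2, sl d1 < sl d → sl d < sl d2 → lab d1 = lab d2 → ¬ ord (lab d1) < ord (lab d) := by
    intro d1 d d2 h1 h2 h12 hlt
    have := hop.inside (T := pe '' {v | v ≠ vn}) (fun e he => (hslT e he).imp fun b hb => hb.2) (u := lab d1) rfl h12.symm
      (A := pe '' {v | v ≠ vn ∧ ord (lab d1) < ord v}) (by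
        rintro e ⟨x, ⟨hx, hx'⟩, rfl⟩
        refine ⟨Set.mem_image_of_mem _ hx, ?_⟩
        obtain ⟨l1, l2⟩ := hpe x hx
        have n1 : x ≠ lab d1 := fun h => by rw [h] at hx'; omega
        have n2 : par x ≠ lab d1 := fun h => by have := (hpar1 x hx).2; rw [h] at this; omega
        revert l1 l2
        cases pb x
        · intro l1 l2
          rw [l1, show lab (pe x, true) = par x from l2]
          exact ⟨n1, n2⟩
        · intro l1 l2
          rw [l1, show lab (pe x, false) = par x from l2]
          exact ⟨n2, n1⟩) (w := lab d) (w' := vn) (fun h => by rw [h] at hlt; omega)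
      (hchain _ _ _ le_rfl hlt) ⟨d, rfl, h1, h2⟩ _ hlabn
    have := hfirst d1
    omega
  -- aux
  have haux : ∀ (W : ℕ) (g : E) (b : Bool), W ≤ ord (lab (g, b)) → W ≤ ord (lab (g, !b)) →
      ∀ d, ord (lab d) < W → ¬ (sl (g, b) < sl d ∧ sl d < sl (g, !b)) := by
    intro W g b hp hq d hd hbetween
    have hI : ∀ d, ord (lab d) < W → (sl (g, b) < sl d ∧ sl d < sl (g, !b)) →
        ∀ d', lab d' = lab d → sl (g, b) < sl d' ∧ sl d' < sl (g, !b) := by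
      intro d hd ⟨h1, h2⟩ d' hd'
      by_contra hcon
      have n1 : sl (g, b) ≠ sl d' := fun h => by rw [hop.inj h, hd'] at hp; omega
      have n2 : sl (g, !b) ≠ sl d' := fun h => by rw [hop.inj h, hd'] at hq; omega
      rcases (by omega : sl d' < sl (g, b) ∨ sl (g, !b) < sl d') with h3 | h3
      · exact hK d' (g, b) d h3 h1 hd' (by rw [hd']; omega)
      · exact hK d (g, !b) d' h2 h3 hd'.symm (by omega)
    have hdown : ∀ (k : ℕ) d, ord (lab d) ≤ k → ord (lab d) < W → (sl (g, b) < sl d ∧ sl d < sl (g, !b)) →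
        ∀ d', lab d' = v0 → sl (g, b) < sl d' ∧ sl d' < sl (g, !b) := by
      intro k
      induction k with
      | zero =>
        intro d hdk hdW hb d' hd'
        refine hI d hdW hb d' (hd'.trans (hinj ?_))
        have := hv0 (lab d); omega
      | succ k ih =>
        intro d hdk hdW hb d' hd'
        by_cases hdv : lab d = v0
        · exact hI d hdW hb d' (hd'.trans hdv.symm)
        · obtain ⟨y, hy, hlt⟩ := hearly _ hdv
          obtain ⟨l1, l2⟩ := hes _ _ hy
          have hin := hI d hdW hb _ l1
          have hne : g ≠ es (lab d) y := by
            intro h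
            have : ∀ b', W ≤ ord (lab (g, b')) := by
              intro b'
              by_cases hbb : b' = b
              · rw [hbb]; exact hp
              · have : b' = !b := by revert hbb; cases b <;> cases b' <;> simp
                rw [this]; exact hq
            have := this (eb (lab d) y)
            rw [h, l1] at this
            omega
          have := hop.nce g _ b _ hne hin.1 hin.2
          exact ih _ (by rw [l2]; omega) (by rw [l2]; omega) this d' hd'
    have h0 := hdown _ d le_rfl hd hbetween _ hlab0
    have h1 := hfirst (g, b)
    have h2 : (g, b) = (pe v0, !(pb v0)) := hop.inj (by omega)
    simp only [Prod.mk.injEq] at h2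
    rw [h2.1, h2.2, Bool.not_not, hlab0] at hq
    have := hv0 (lab d)
    omega
  refine ⟨fun u v => sl (es u v, !(eb u v)), ?_, ?_, ?_⟩
  · intro u v u' v' huv hlt huv' hlt' heq
    have := hop.inj heq
    simp only [Prod.mk.injEq] at this
    obtain ⟨h1, h2⟩ := this
    have h3 : eb u v = eb u' v' := by simpa using h2
    have l := hes u v huv
    have l' := hes u' v' huv'
    rw [← h1, ← h3] at l'
    exact ⟨l.1.symm.trans l'.1, l.2.symm.trans l'.2⟩
  · intro u v huv hlt
    have : sl (es v0 vn, !(eb v0 vn)) = sl (pe v0, !(pb v0)) := by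
      simp only [pe, pb, hpar2 v0 rfl]
    exact this.le.trans (hfirst _)
  · intro u v w a b a' b' huv huw hwv hab hlab hw hab' hlab' hw' ⟨hlt1, hlt2⟩
    simp only at hlt1 hlt2
    obtain ⟨lu, lv⟩ := hes u v huv
    have omega_ex : ∀ a b, G.Adj a b → ord a < ord b → (w = a ∨ w = b) →
        ∃ c, lab (es a b, c) = w ∧ (c = !(eb a b) ∨ ((!c) = (!(eb a b)) ∧ ord w < ord (lab (es a b, !c)))) := by
      intro a b hab hlt hw
      obtain ⟨la, lb⟩ := hes a b hab
      rcases hw with rfl | rfl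
      · exact ⟨eb w b, la, Or.inr ⟨rfl, by rw [lb]; exact hlt⟩⟩
      · exact ⟨!(eb a w), lb, Or.inl rfl⟩
    obtain ⟨c, hc, hc'⟩ := omega_ex a b hab hlab hw
    obtain ⟨c', hcc, hcc'⟩ := omega_ex a' b' hab' hlab' hw'
    have hlv : ∀ d, lab d = w → sl d ≠ sl (es u v, !(eb u v)) := by
      intro d hd h
      rw [hop.inj h, lv] at hd
      rw [hd] at hwv; omega
    have nn := hlv _ hc
    have nn' := hlv _ hcc
    have hk := hK (es a b, c) (es u v, !(eb u v)) (es a' b', c')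
    rw [hc, hcc, lv] at hk
    have hlu : ∀ g b', ord w ≤ ord (lab (g, b')) → ord w ≤ ord (lab (g, !b')) → g ≠ es u v := by
      intro g b' h1 h2 h
      subst h
      have : eb u v = b' ∨ eb u v = !b' := by cases b' <;> cases eb u v <;> simp
      rcases this with h | h
      · rw [← h, lu] at h1; omega
      · rw [← h, lu] at h2; omega
    rcases lt_or_gt_of_ne nn with h1 | h1
    · have h2 : sl (es a' b', c') < sl (es u v, !(eb u v)) := by
        by_contra hh
        exact hk h1 (by omega) rfl hwv
      rcases hcc' with h | ⟨h, hlt⟩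
      · rw [← h] at hlt2; omega
      · rw [← h] at hlt2
        have q1 : ord w ≤ ord (lab (es a' b', c')) := by rw [hcc]
        have := hop.nce _ _ c' (!(eb u v)) (hlu _ c' q1 hlt.le) h2 hlt2
        rw [Bool.not_not] at this
        exact haux (ord w) _ c' q1 hlt.le _ (by rw [lu]; exact huw) this
    · rcases hc' with h | ⟨h, hlt⟩
      · rw [← h] at hlt1; omega
      · rw [← h] at hlt1
        have q1 : ord w ≤ ord (lab (es a b, c)) := by rw [hc]
        have := hop.nce _ _ (!c) (!(eb u v)) (hlu _ c q1 hlt.le) hlt1 (by rwa [Bool.not_not])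
        simp only [Bool.not_not] at this
        exact haux (ord w) _ (!c) hlt.le (by rwa [Bool.not_not]) _ (by rw [lu]; exact huw) (by simpa only [Bool.not_not] using this)
end Vis
end SN


namespace SN
section Straight
variable {V : Type}

/-- Orientation determinant. -/
def dt (a b c : ℝ × ℝ) : ℝ := (b.1 - a.1) * (c.2 - a.2) - (b.2 - a.2) * (c.1 - a.1)

def Dj (P Q R S : ℝ × ℝ) : Prop := 0 < dt P Q R * dt P Q S ∨ 0 < dt R S P * dt R S Q

theorem dt_swap (a b c : ℝ × ℝ) : dt a c b = - dt a b c := by simp only [dt]; ring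
theorem dt_swap' (a b c : ℝ × ℝ) : dt b a c = - dt a b c := by simp only [dt]; ring
theorem dt_cyc (a b c : ℝ × ℝ) : dt b c a = dt a b c := by simp only [dt]; ring

theorem Dj.symm {P Q R S : ℝ × ℝ} (h : Dj P Q R S) : Dj R S P Q := Or.symm h
theorem Dj.swap {P Q R S : ℝ × ℝ} (h : Dj P Q R S) : Dj Q P R S := by
  rcases h with h | h
  · left; rw [dt_swap' P Q R, dt_swap' P Q S]; linarith
  · right; linarith
theorem Dj.swap' {P Q R S : ℝ × ℝ} (h : Dj P Q R S) : Dj P Q S R := h.symm.swap.symm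

/-- Straight line drawing in general position. -/
structure SL (G : SimpleGraph V) (p : V → ℝ × ℝ) : Prop where
  xinj : ∀ u v, u ≠ v → (p u).1 ≠ (p v).1
  gp : ∀ u v w, u ≠ v → u ≠ w → v ≠ w → dt (p u) (p v) (p w) ≠ 0
  dj : ∀ a b c d, G.Adj a b → G.Adj c d → a ≠ c → a ≠ d → b ≠ c → b ≠ d → Dj (p a) (p b) (p c) (p d)

/-- partial invariants -/
structure PInv (G : SimpleGraph V) (κ : V → V → ℤ) (X : Set V) (p : V → ℝ × ℝ) : Prop where
  xinj : ∀ u ∈ X, ∀ v ∈ X, u ≠ v → (p u).1 ≠ (p v).1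
  gp : ∀ u ∈ X, ∀ v ∈ X, ∀ w ∈ X, u ≠ v → u ≠ w → v ≠ w → dt (p u) (p v) (p w) ≠ 0
  dj : ∀ a ∈ X, ∀ b ∈ X, ∀ c ∈ X, ∀ d ∈ X, G.Adj a b → G.Adj c d → a ≠ c → a ≠ d → b ≠ c → b ≠ d →
    Dj (p a) (p b) (p c) (p d)
  srt : ∀ u ∈ X, ∀ v, v ∉ X → ∀ u' ∈ X, ∀ v', v' ∉ X → G.Adj u v → G.Adj u' v' → κ u v < κ u' v' →
    (p u).1 ≤ (p u').1
  see : ∀ u ∈ X, ∀ v, v ∉ X → G.Adj u v → ∀ a ∈ X, ∀ b ∈ X, G.Adj a b → (p a).1 < (p u).1 → (p u).1 < (p b).1 →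
    0 < dt (p a) (p b) (p u)

theorem straight_step [Finite V] {G : SimpleGraph V} {κ : V → V → ℤ} {X : Set V} {p : V → ℝ × ℝ}
    (h : PInv G κ X p) {w : V} (hw : w ∉ X)
    (hκ : ∀ u ∈ X, ∀ v, v ∉ X → ∀ u' ∈ X, ∀ v', v' ∉ X → G.Adj u v → G.Adj u' v' → κ u v = κ u' v' → u = u' ∧ v = v')
    (hvis : ∀ u ∈ X, ∀ v, v ∉ insert w X → G.Adj u v → ∀ a ∈ X, G.Adj a w →
      (∀ b ∈ X, G.Adj b w → ¬ (κ a w < κ u v ∧ κ u v < κ b w)) ∧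
      (∀ z, z ∉ insert w X → G.Adj w z → ¬ (κ a w < κ u v ∧ κ u v < κ w z) ∧ ¬ (κ w z < κ u v ∧ κ u v < κ a w)))
    (h2 : ∃ a ∈ X, ∃ b ∈ X, a ≠ b ∧ G.Adj a w ∧ G.Adj b w) : ∃ p', PInv G κ (insert w X) p' := by
  classical
  have := Fintype.ofFinite V
  obtain ⟨a0, ha0, b0, hb0, hab0, ha0w, hb0w⟩ := h2
  let N : Finset V := Finset.univ.filter fun a => a ∈ X ∧ G.Adj a w
  have hN : N.Nonempty := ⟨a0, by simp [N, ha0, ha0w]⟩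
  have hNm : ∀ {a}, a ∈ N ↔ a ∈ X ∧ G.Adj a w := by intro a; simp [N]
  obtain ⟨aL, haL, hmin⟩ := Finset.exists_min_image N (fun a => κ a w) hN
  obtain ⟨aR, haR, hmax⟩ := Finset.exists_max_image N (fun a => κ a w) hN
  obtain ⟨haLX, haLw⟩ := hNm.mp haL
  obtain ⟨haRX, haRw⟩ := hNm.mp haR
  have hxL : ∀ a ∈ X, G.Adj a w → (p aL).1 ≤ (p a).1 := by
    intro a ha haw
    rcases (hmin a (hNm.mpr ⟨ha, haw⟩)).lt_or_eq with hlt | heq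
    · exact h.srt aL haLX w hw a ha w hw haLw haw hlt
    · rw [(hκ aL haLX w hw a ha w hw haLw haw heq).1]
  have hxR : ∀ a ∈ X, G.Adj a w → (p a).1 ≤ (p aR).1 := by
    intro a ha haw
    rcases (hmax a (hNm.mpr ⟨ha, haw⟩)).lt_or_eq with hlt | heq
    · exact h.srt a ha w hw aR haRX w hw haw haRw hlt
    · rw [(hκ a ha w hw aR haRX w hw haw haRw heq).1]
  have hLR : (p aL).1 < (p aR).1 := by
    have l1 := hxL _ ha0 ha0w
    have l2 := hxL _ hb0 hb0w
    have r1 := hxR _ ha0 ha0w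
    have r2 := hxR _ hb0 hb0w
    rcases lt_or_gt_of_ne (h.xinj _ ha0 _ hb0 hab0) with hh | hh <;> linarith
  obtain ⟨x, hx, hxn⟩ := (Set.Ioo_infinite hLR).exists_notMem_finite (Set.finite_range fun v => (p v).1)
  have hxne : ∀ v, (p v).1 ≠ x := fun v hv => hxn ⟨v, hv⟩
  obtain ⟨y, hy⟩ : ∃ y : ℝ, ∀ a b, (p a).1 < (p b).1 → 0 < dt (p a) (p b) (x, y) := by
    have : ∀ᶠ y : ℝ in Filter.atTop, ∀ a b, (p a).1 < (p b).1 → 0 < dt (p a) (p b) (x, y) := by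
      rw [Filter.eventually_all]; intro a
      rw [Filter.eventually_all]; intro b
      by_cases hab : (p a).1 < (p b).1
      · filter_upwards [Filter.eventually_gt_atTop
          ((p a).2 + ((p b).2 - (p a).2) * (x - (p a).1) / ((p b).1 - (p a).1))] with y hy _
        have hpos : 0 < (p b).1 - (p a).1 := by linarith
        have : ((p b).2 - (p a).2) * (x - (p a).1) / ((p b).1 - (p a).1) < y - (p a).2 := by linarith
        rw [div_lt_iff₀ hpos] at this
        simp only [dt]; linarith
      · exact Filter.Eventually.of_forall fun y hh => absurd hh hab
    exact this.exists
  let p' : V → ℝ × ℝ := Function.update p w (x, y)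
  have hpw : p' w = (x, y) := Function.update_self _ _ _
  have hpX : ∀ v ∈ X, p' v = p v := fun v hv => Function.update_of_ne (fun (hh : v = w) => hw (hh ▸ hv)) _ _
  have hsign : ∀ a ∈ X, ∀ b ∈ X, a ≠ b → dt (p a) (p b) (x, y) ≠ 0 := by
    intro a ha b hb hab
    rcases lt_or_gt_of_ne (h.xinj a ha b hb hab) with hh | hh
    · exact (hy a b hh).ne'
    · rw [dt_swap']; have := hy b a hh; linarith
  -- new edge against old edge
  have hnew : ∀ a ∈ X, ∀ c ∈ X, ∀ d ∈ X, G.Adj a w → G.Adj c d → a ≠ c → a ≠ d → Dj (p a) (x, y) (p c) (p d) := by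
    have hlt : ∀ a ∈ X, ∀ c ∈ X, ∀ d ∈ X, G.Adj a w → G.Adj c d → a ≠ c → a ≠ d → (p c).1 < (p d).1 →
        Dj (p a) (x, y) (p c) (p d) := by
      intro a ha c hc d hd haw hcd hac had hlt
      rcases lt_or_gt_of_ne (h.xinj a ha c hc hac) with h1 | h1
      · left
        have e1 := hy a c h1
        have e2 := hy a d (by linarith)
        rw [dt_swap (p a) (p c), dt_swap (p a) (p d), neg_mul_neg]
        positivity
      · rcases lt_or_gt_of_ne (h.xinj a ha d hd had) with h3 | h3
        · right
          have e1 := h.see a ha w hw haw c hc d hd hcd h1 h3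
          have e2 := hy c d hlt
          positivity
        · left
          have e1 := hy c a h1
          have e2 := hy d a h3
          rw [dt_swap (p a) (p c), dt_swap (p a) (p d), neg_mul_neg, dt_swap' (p c), dt_swap' (p d), neg_mul_neg]
          positivity
    intro a ha c hc d hd haw hcd hac had
    rcases lt_or_gt_of_ne (h.xinj c hc d hd hcd.ne) with h1 | h1
    · exact hlt a ha c hc d hd haw hcd hac had h1
    · exact (hlt a ha d hd c hc haw hcd.symm had hac h1).swap'
  -- edges passing over
  have hside : ∀ u ∈ X, ∀ v, v ∉ insert w X → G.Adj u v →
      (κ u v < κ aL w ∧ (p u).1 ≤ (p aL).1) ∨ (κ aR w < κ u v ∧ (p aR).1 ≤ (p u).1) := by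
    intro u hu v hv huv
    have hvX : v ∉ X := fun hh => hv (Or.inr hh)
    have hvw : v ≠ w := fun hh => hv (Or.inl hh)
    have n1 : κ u v ≠ κ aL w := fun hh => hvw (hκ u hu v hvX aL haLX w hw huv haLw hh).2
    have n2 : κ u v ≠ κ aR w := fun hh => hvw (hκ u hu v hvX aR haRX w hw huv haRw hh).2
    have := (hvis u hu v hv huv aL haLX haLw).1 aR haRX haRw
    rcases lt_or_gt_of_ne n1 with h1 | h1
    · exact Or.inl ⟨h1, h.srt u hu v hvX aL haLX w hw huv haLw h1⟩
    · have h3 : κ aR w < κ u v := by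
        rcases lt_or_gt_of_ne n2 with h3 | h3
        · exact absurd ⟨h1, h3⟩ this
        · exact h3
      exact Or.inr ⟨h3, h.srt aR haRX w hw u hu v hvX haRw huv h3⟩
  have hLRκ : κ aL w ≤ κ aR w := hmin aR haR
  refine ⟨p', ?_, ?_, ?_, ?_, ?_⟩
  · rintro u (rfl | hu) v (rfl | hv) huv
    · exact absurd rfl huv
    · rw [hpw, hpX v hv]; exact (hxne v).symm
    · rw [hpw, hpX u hu]; exact hxne u
    · rw [hpX u hu, hpX v hv]; exact h.xinj u hu v hv huv
  · rintro a (rfl | ha) b (rfl | hb) c (rfl | hc) hab hac hbc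
    · exact absurd rfl hab
    · exact absurd rfl hab
    · exact absurd rfl hac
    · rw [hpw, hpX b hb, hpX c hc, ← dt_cyc]; exact hsign b hb c hc hbc
    · exact absurd rfl hbc
    · rw [hpw, hpX a ha, hpX c hc, dt_swap]; exact neg_ne_zero.mpr (hsign a ha c hc hac)
    · rw [hpw, hpX a ha, hpX b hb]; exact hsign a ha b hb hab
    · rw [hpX a ha, hpX b hb, hpX c hc]; exact h.gp a ha b hb c hc hab hac hbc
  · rintro a (rfl | ha) b (rfl | hb) c (rfl | hc) d (rfl | hd) hab hcd hac had hbc hbd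
    all_goals first
      | exact absurd rfl hab.ne
      | exact absurd rfl hcd.ne
      | exact absurd rfl hac
      | exact absurd rfl had
      | exact absurd rfl hbc
      | exact absurd rfl hbd
      | skip
    · rw [hpw, hpX b hb, hpX c hc, hpX d hd]
      exact (hnew b hb c hc d hd hab.symm hcd hbc hbd).swap
    · rw [hpw, hpX a ha, hpX c hc, hpX d hd]
      exact hnew a ha c hc d hd hab hcd hac had
    · rw [hpw, hpX a ha, hpX b hb, hpX d hd]
      exact (hnew d hd a ha b hb hcd.symm hab had.symm hbd.symm).symm.swap'
    · rw [hpw, hpX a ha, hpX b hb, hpX c hc]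
      exact (hnew c hc a ha b hb hcd hab hac.symm hbc.symm).symm
    · rw [hpX a ha, hpX b hb, hpX c hc, hpX d hd]
      exact h.dj a ha b hb c hc d hd hab hcd hac had hbc hbd
  · rintro u (rfl | hu) v hv u' (rfl | hu') v' hv' huv huv' hlt
    · exact le_rfl
    · rw [hpw, hpX u' hu']
      have hvs := ((hvis u' hu' v' hv' huv' aL haLX haLw).2 v hv huv).2
      rcases hside u' hu' v' hv' huv' with ⟨h1, h2⟩ | ⟨h1, h2⟩
      · exact absurd ⟨hlt, h1⟩ hvs
      · have := hx.2; simp only; linarith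
    · rw [hpw, hpX u hu]
      have hvs := ((hvis u hu v hv huv aR haRX haRw).2 v' hv' huv').1
      rcases hside u hu v hv huv with ⟨h1, h2⟩ | ⟨h1, h2⟩
      · have := hx.1; simp only; linarith
      · exact absurd ⟨h1, hlt⟩ hvs
    · rw [hpX u hu, hpX u' hu']
      exact h.srt u hu v (fun hh => hv (Or.inr hh)) u' hu' v' (fun hh => hv' (Or.inr hh)) huv huv' hlt
  · rintro u (rfl | hu) v hv huv a (rfl | ha) b (rfl | hb) hab h1 h2
    · exact absurd rfl hab.ne
    · exact absurd h1 (lt_irrefl _)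
    · exact absurd h2 (lt_irrefl _)
    · rw [hpX a ha, hpX b hb, hpw]; rw [hpX a ha, hpw] at h1; rw [hpX b hb, hpw] at h2
      exact hy a b (h1.trans h2)
    · exact absurd rfl hab.ne
    · exfalso
      rw [hpw, hpX u hu] at h1
      rw [hpX u hu, hpX b hb] at h2
      have := hxR b hb hab.symm
      have := hx.1
      rcases hside u hu v hv huv with ⟨_, h3⟩ | ⟨_, h3⟩ <;> simp only at * <;> linarith
    · exfalso
      rw [hpw, hpX u hu] at h2
      rw [hpX u hu, hpX a ha] at h1
      have := hxL a ha hab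
      have := hx.2
      rcases hside u hu v hv huv with ⟨_, h3⟩ | ⟨_, h3⟩ <;> simp only at * <;> linarith
    · rw [hpX a ha, hpX b hb, hpX u hu]
      rw [hpX a ha, hpX u hu] at h1
      rw [hpX u hu, hpX b hb] at h2
      exact h.see u hu v (fun hh => hv (Or.inr hh)) huv a ha b hb hab h1 h2

theorem straight_aux [Finite V] {G : SimpleGraph V} {κ : V → V → ℤ} {ord : V → ℕ} (hinj : Function.Injective ord)
    (hκ : ∀ u v u' v', G.Adj u v → ord u < ord v → G.Adj u' v' → ord u' < ord v' → κ u v = κ u' v' → u = u' ∧ v = v')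
    (hvis : ∀ u v w a b a' b', G.Adj u v → ord u < ord w → ord w < ord v →
        G.Adj a b → ord a < ord b → (w = a ∨ w = b) →
        G.Adj a' b' → ord a' < ord b' → (w = a' ∨ w = b') → ¬ (κ a b < κ u v ∧ κ u v < κ a' b'))
    {v0 v1 : V} (h0 : ord v0 = 0) (h1 : ord v1 = 1)
    (hbase : (∀ v z, G.Adj v0 v → v ≠ v1 → G.Adj v1 z → z ≠ v0 → κ v1 z < κ v0 v) ∨
      (∀ v z, G.Adj v0 v → v ≠ v1 → G.Adj v1 z → z ≠ v0 → κ v0 v < κ v1 z))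
    (h2 : ∀ w, 2 ≤ ord w → ∃ a b, a ≠ b ∧ G.Adj w a ∧ G.Adj w b ∧ ord a < ord w ∧ ord b < ord w) :
    ∃ p, SL G p := by
  classical
  have hv01 : v0 ≠ v1 := fun h => by rw [h, h1] at h0; omega
  have hX2 : ∀ v, ord v < 2 ↔ v = v0 ∨ v = v1 := by
    intro v
    constructor
    · intro hv
      rcases (by omega : ord v = 0 ∨ ord v = 1) with h | h
      · left; exact hinj (h.trans h0.symm)
      · right; exact hinj (h.trans h1.symm)
    · rintro (rfl | rfl) <;> omega
  have base : ∃ p, PInv G κ {v | ord v < 2} p := by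
    obtain ⟨s, hs, hsr⟩ : ∃ s : ℝ, s ≠ 0 ∧
        (((∀ v z, G.Adj v0 v → v ≠ v1 → G.Adj v1 z → z ≠ v0 → κ v1 z < κ v0 v) ∧ s ≤ 0) ∨
      ((∀ v z, G.Adj v0 v → v ≠ v1 → G.Adj v1 z → z ≠ v0 → κ v0 v < κ v1 z) ∧ 0 ≤ s)) := by
      rcases hbase with h | h
      · exact ⟨-1, by norm_num, Or.inl ⟨h, by norm_num⟩⟩
      · exact ⟨1, by norm_num, Or.inr ⟨h, by norm_num⟩⟩
    obtain ⟨q, p0, p1⟩ : ∃ q : V → ℝ × ℝ, q v0 = (0, 0) ∧ q v1 = (s, 0) :=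
      ⟨fun v => if v = v0 then (0, 0) else (s, 0), by simp, by simp [hv01.symm]⟩
    refine ⟨q, ?_, ?_, ?_, ?_, ?_⟩
    · intro u hu v hv huv
      rcases (hX2 u).mp hu with rfl | rfl <;> rcases (hX2 v).mp hv with rfl | rfl
      · exact absurd rfl huv
      · rw [p0, p1]; exact hs.symm
      · rw [p0, p1]; exact hs
      · exact absurd rfl huv
    · intro u hu v hv w hw huv huw hvw
      rcases (hX2 u).mp hu with rfl | rfl <;> rcases (hX2 v).mp hv with rfl | rfl <;>
        rcases (hX2 w).mp hw with rfl | rfl <;> contradiction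
    · intro u hu v hv w hw w' hw' huv _ huw huw' hvw
      have := huv.ne
      rcases (hX2 u).mp hu with rfl | rfl <;> rcases (hX2 v).mp hv with rfl | rfl <;>
        rcases (hX2 w).mp hw with rfl | rfl <;> contradiction
    · intro u hu v hv u' hu' v' hv' huv huv' hlt
      have hv1 : ∀ v, v ∉ {v | ord v < 2} → v ≠ v0 ∧ v ≠ v1 := by
        intro v hv
        have : ¬ (v = v0 ∨ v = v1) := fun h => hv ((hX2 v).mpr h)
        exact not_or.mp this
      have n1 := hv1 v hv
      have n2 := hv1 v' hv'
      rcases (hX2 u).mp hu with rfl | rfl <;> rcases (hX2 u').mp hu' with rfl | rfl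
      · exact le_rfl
      · rw [p0, p1]
        rcases hsr with ⟨h, h'⟩ | ⟨h, h'⟩
        · have := h v v' huv n1.2 huv' n2.1; omega
        · exact h'
      · rw [p0, p1]
        rcases hsr with ⟨h, h'⟩ | ⟨h, h'⟩
        · exact h'
        · have := h v' v huv' n2.2 huv n1.1; omega
      · exact le_rfl
    · intro u hu v hv _ a ha b hb _ l1 l2
      rcases (hX2 u).mp hu with rfl | rfl <;> rcases (hX2 a).mp ha with rfl | rfl <;>
        rcases (hX2 b).mp hb with rfl | rfl <;> first | exact absurd l1 (lt_irrefl _) | exact absurd l2 (lt_irrefl _) | (exfalso; linarith)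
  have main : ∀ k, ∃ p, PInv G κ {v | ord v < 2 + k} p := by
    intro k
    induction k with
    | zero => exact base
    | succ k ih =>
      obtain ⟨p, hp⟩ := ih
      by_cases hw : ∃ w, ord w = 2 + k
      · obtain ⟨w, hw⟩ := hw
        have hins : {v | ord v < 2 + (k + 1)} = insert w {v | ord v < 2 + k} := by
          ext v
          simp only [mem_insert_iff, mem_ofPred_eq]
          constructor
          · intro hv
            by_cases h : ord v = 2 + k
            · left; exact hinj (h.trans hw.symm)
            · right; omega
          · rintro (rfl | h) <;> omega
        rw [hins]
        have hni : ∀ v, v ∉ insert w {v | ord v < 2 + k} → ord w < ord v := by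
          intro v hv
          rw [← hins] at hv
          simp only [mem_ofPred_eq, not_lt] at hv
          omega
        refine straight_step hp (w := w) (by simp [hw]) ?_ ?_ ?_
        · intro u hu v hv u' hu' v' hv' huv huv' heq
          simp only [mem_ofPred_eq, not_lt] at hu hv hu' hv'
          exact hκ u v u' v' huv (by omega) huv' (by omega) heq
        · intro u hu v hv huv a ha haw
          have := hni v hv
          simp only [mem_ofPred_eq] at hu ha
          refine ⟨fun b hb hbw => ?_, fun z hz hwz => ⟨?_, ?_⟩⟩
          · simp only [mem_ofPred_eq] at hb
            exact hvis u v w a w b w huv (by omega) this haw (by omega) (Or.inr rfl) hbw (by omega) (Or.inr rfl)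
          · exact hvis u v w a w w z huv (by omega) this haw (by omega) (Or.inr rfl) hwz (hni z hz) (Or.inl rfl)
          · exact hvis u v w w z a w huv (by omega) this hwz (hni z hz) (Or.inl rfl) haw (by omega) (Or.inr rfl)
        · obtain ⟨a, b, hab, ha, hb, hoa, hob⟩ := h2 w (by omega)
          exact ⟨a, by simp only [mem_ofPred_eq]; omega, b, by simp only [mem_ofPred_eq]; omega, hab, ha.symm, hb.symm⟩
      · refine ⟨p, ?_⟩
        have : {v | ord v < 2 + (k + 1)} = {v | ord v < 2 + k} := by
          ext v
          simp only [mem_ofPred_eq]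
          have : ord v ≠ 2 + k := fun h => hw ⟨v, h⟩
          omega
        rw [this]; exact hp
  obtain ⟨M, hM⟩ := (Set.finite_range ord).bddAbove
  obtain ⟨p, hp⟩ := main M
  have hall : ∀ v, v ∈ {v | ord v < 2 + M} := fun v => by
    have := hM ⟨v, rfl⟩; simp only [mem_ofPred_eq]; omega
  exact ⟨p, fun u v => hp.xinj u (hall u) v (hall v), fun u v w => hp.gp u (hall u) v (hall v) w (hall w),
    fun a b c d => hp.dj a (hall a) b (hall b) c (hall c) d (hall d)⟩
end Straight
end SN


namespace SN
section StraightFinal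
variable {V : Type}

theorem exists_deg_two [Fintype V] {G : SimpleGraph V} (hMax : IsMax G) (h3 : 3 ≤ Fintype.card V) :
    ∃ y p q, G.Adj y p ∧ G.Adj y q ∧ p ≠ q := by
  classical
  by_contra hcon
  push Not at hcon
  obtain ⟨a, b, c, hab, hac, hbc⟩ := Fintype.two_lt_card_iff.mp (by omega : 2 < Fintype.card V)
  obtain ⟨w⟩ := hMax.preconnected a b
  obtain ⟨p, hp⟩ : ∃ p, G.Adj a p := by
    cases w with
    | nil => exact absurd rfl hab
    | cons h _ => exact ⟨_, h⟩
  have key : ∀ {x z : V}, G.Walk x z → x = a ∨ x = p → z = a ∨ z = p := by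
    intro x z w
    induction w with
    | nil => exact id
    | cons h _ ih =>
      intro hx
      apply ih
      rcases hx with rfl | rfl
      · right; exact hcon _ _ _ h hp
      · left; exact hcon _ _ _ h hp.symm
  obtain ⟨w'⟩ := hMax.preconnected a c
  have h1 := key w (Or.inl rfl)
  have h2 := key w' (Or.inl rfl)
  grind

theorem exists_triFace [Fintype V] {G : SimpleGraph V} (hMax : IsMax G) (h3 : 3 ≤ Fintype.card V) :
    ∃ v1 v2 vn ord, G.Adj v1 v2 ∧ G.Adj v1 vn ∧ G.Adj v2 vn ∧ WPlanar (addD G v1 v2 vn) ∧ TriOrd G v1 v2 vn ord := by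
  obtain ⟨y, p, q, hp, hq, hpq⟩ := exists_deg_two hMax h3
  obtain ⟨u, v, hu, hv, huv, hW⟩ := exists_face hMax hp hq hpq
  obtain ⟨ord, ho⟩ := exists_triOrd hMax hu hv huv
  exact ⟨y, u, v, ord, hu, hv, huv, hW, ho⟩

theorem TriOrd.le_last [Finite V] {G : SimpleGraph V} {v1 v2 vn : V} {ord : V → ℕ} (h : TriOrd G v1 v2 vn ord) (v : V) :
    ord v ≤ ord vn := by
  have hne : Nonempty V := ⟨v⟩
  obtain ⟨m, hm⟩ := Finite.exists_max ord
  by_cases hmn : m = vn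
  · subst hmn; exact hm v
  · obtain ⟨w, _, hw⟩ := h.later m hmn
    have := hm w; omega

theorem exists_SL_max [Fintype V] {G : SimpleGraph V} (hMax : IsMax G) (h3 : 3 ≤ Fintype.card V) :
    ∃ p, SL G p := by
  classical
  obtain ⟨v1, v2, vn, ord, h12, h1n, h2n, hW, ho⟩ := exists_triFace hMax h3
  let D := addD G v1 v2 vn
  let o : Option V → ℕ := fun x => match x with | none => 0 | some v => ord v + 1
  have ooj : Function.Injective o := by
    intro x y hxy
    rcases x with _ | x <;> rcases y with _ | y <;> simp only [o] at hxy
    · rfl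
    · omega
    · omega
    · rw [ho.inj (by omega : ord x = ord y)]
  have ans : ∀ v, D.Adj none (some v) ↔ v = v1 ∨ v = v2 ∨ v = vn := fun v => Iff.rfl
  have asn : ∀ v, D.Adj (some v) none ↔ v = v1 ∨ v = v2 ∨ v = vn := fun v => Iff.rfl
  have ass : ∀ u v, D.Adj (some u) (some v) ↔ G.Adj u v := fun u v => Iff.rfl
  have on : o none = 0 := rfl
  have os : ∀ v, o (some v) = ord v + 1 := fun v => rfl
  have hvn : ∀ v, o v ≤ o (some vn) := by
    rintro (_ | v)
    · simp [on]
    · have := ho.le_last v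
      rw [os, os]; omega
  obtain ⟨κ, k1, k2, k3⟩ := exists_kappa (G := D) hW ooj (v0 := none) (vn := some vn) ((ans _).mpr (by simp))
    (fun v => by simp [on]) hvn (by
      rintro (_ | v) hv
      · exact absurd rfl hv
      · rcases Nat.lt_or_ge (ord v) 2 with h | h
        · refine ⟨none, ?_, by simp [on, os]⟩
          rw [asn]
          rcases (by omega : ord v = 0 ∨ ord v = 1) with h | h
          · left; exact ho.inj (h.trans ho.h1.symm)
          · right; left; exact ho.inj (h.trans ho.h2.symm)
        · obtain ⟨a, b, ha, _, hva, _⟩ := ho.tri v h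
          exact ⟨some a, (ass _ _).mpr hva, by rw [os, os]; omega⟩) (by
      rintro (_ | v) hv
      · exact ⟨some vn, (ans _).mpr (by simp), by simp [on, os]⟩
      · obtain ⟨w, hw, hlt⟩ := ho.later v (fun h => hv (by rw [h]))
        exact ⟨some w, (ass _ _).mpr hw, by rw [os, os]; omega⟩)
  have hh2 : ∀ w, 2 ≤ o w → ∃ a b, a ≠ b ∧ D.Adj w a ∧ D.Adj w b ∧ o a < o w ∧ o b < o w := by
    rintro (_ | v) hw
    · simp [on] at hw
    · rw [os] at hw
      rcases Nat.lt_or_ge (ord v) 2 with h | h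
      · have : v = v2 := ho.inj (by rw [ho.h2]; omega)
        subst this
        refine ⟨none, some v1, by simp, (asn _).mpr (by simp), (ass _ _).mpr h12.symm, ?_, ?_⟩
        · rw [on, os]; omega
        · rw [os, os, ho.h1]; omega
      · obtain ⟨a, b, ha, hb, hva, hvb, hab⟩ := ho.tri v h
        exact ⟨some a, some b, by simpa using hab.ne, (ass _ _).mpr hva, (ass _ _).mpr hvb,
          by rw [os, os]; omega, by rw [os, os]; omega⟩
  have o1 : o (some v1) = 1 := by rw [os, ho.h1]
  have o2 : o (some v2) = 2 := by rw [os, ho.h2]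
  have hz : ∀ z, D.Adj (some v1) z → z ≠ none → 1 < o z := by
    rintro (_ | z) hz hn
    · exact absurd rfl hn
    · rw [os]
      have : ord z ≠ 0 := fun h => by
        have : z = v1 := ho.inj (h.trans ho.h1.symm)
        subst this; exact hz.ne rfl
      omega
  have d2 : D.Adj none (some v2) := (ans _).mpr (by simp)
  have dn : D.Adj none (some vn) := (ans _).mpr (by simp)
  have e1n : D.Adj (some v1) (some vn) := (ass _ _).mpr h1n
  have on1 : 1 < o (some vn) := hz _ e1n (by simp)
  have hvs : ∀ v, D.Adj none v → v ≠ some v1 → v = some v2 ∨ v = some vn := by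
    rintro (_ | v) h hn
    · exact absurd rfl h.ne
    · rcases (ans v).mp h with rfl | rfl | rfl
      · exact absurd rfl hn
      · left; rfl
      · right; rfl
  have hne : ∀ z, D.Adj (some v1) z → z ≠ none → κ none (some v2) ≠ κ (some v1) z := by
    intro z hz' hn h
    have := (k1 none (some v2) (some v1) z d2 (by rw [on, o2]; omega) hz' (by rw [o1]; exact hz z hz' hn) h).1
    simp at this
  obtain ⟨p, hp⟩ : ∃ p, SL D p := by
    rcases lt_or_gt_of_ne (hne _ e1n (by simp)) with hlt | hgt
    · refine straight_aux (G := D) (v0 := none) (v1 := some v1) ooj k1 k3 on o1 (Or.inr ?_) hh2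
      intro v z hv hv1 hz' hn
      have hoz := hz z hz' hn
      rcases hvs v hv hv1 with rfl | rfl
      · by_contra hc
        have h1 := hne z hz' hn
        exact k3 none (some v2) (some v1) (some v1) z (some v1) (some vn) d2 (by omega) (by omega) hz' (by omega)
          (Or.inl rfl) e1n (by omega) (Or.inl rfl) ⟨by omega, by omega⟩
      · have h1 := k2 (some v1) z hz' (by omega)
        refine lt_of_le_of_ne h1 fun h => ?_
        have := (k1 none (some vn) (some v1) z dn (by omega) hz' (by omega) h).1
        simp at this
    · obtain ⟨M, hM⟩ := (Set.finite_range (fun x : Option V × Option V => κ x.1 x.2)).bddAbove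
      have hM : ∀ u v, κ u v ≤ M := fun u v => hM ⟨(u, v), rfl⟩
      let κ' : Option V → Option V → ℤ := fun u v => if u = none ∧ v = some vn then M + 1 else κ u v
      have κ1 : κ' none (some vn) = M + 1 := by simp [κ']
      have κ2 : ∀ u v, ¬ (u = none ∧ v = some vn) → κ' u v = κ u v := by
        intro u v h; simp only [κ', if_neg h]
      have κle : ∀ u v, κ' u v ≤ M + 1 := by
        intro u v
        by_cases h : u = none ∧ v = some vn
        · rw [h.1, h.2, κ1]
        · rw [κ2 u v h]; have := hM u v; omega
      refine straight_aux (G := D) (v0 := none) (v1 := some v1) (κ := κ') ooj ?_ ?_ on o1 (Or.inl ?_) hh2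
      · intro u v u' v' huv hlt huv' hlt' he
        by_cases h : u = none ∧ v = some vn <;> by_cases h' : u' = none ∧ v' = some vn
        · exact ⟨h.1.trans h'.1.symm, h.2.trans h'.2.symm⟩
        · rw [h.1, h.2, κ1, κ2 _ _ h'] at he; have := hM u' v'; omega
        · rw [h'.1, h'.2, κ1, κ2 _ _ h] at he; have := hM u v; omega
        · rw [κ2 _ _ h, κ2 _ _ h'] at he
          exact k1 _ _ _ _ huv hlt huv' hlt' he
      · intro u v w a b a' b' huv huw hwv hab hab1 hw hab' hab1' hw' hc
        have hw0 : w ≠ none := fun h => by rw [h, on] at huw; omega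
        have hwn : w ≠ some vn := fun h => by have := hvn v; rw [← h] at this; omega
        have n1 : ¬ (a = none ∧ b = some vn) := by
          rintro ⟨rfl, rfl⟩; tauto
        have n2 : ¬ (a' = none ∧ b' = some vn) := by
          rintro ⟨rfl, rfl⟩; tauto
        have n3 : ¬ (u = none ∧ v = some vn) := by
          rintro ⟨rfl, rfl⟩
          have := κle a' b'
          omega
        rw [κ2 _ _ n1, κ2 _ _ n2, κ2 _ _ n3] at hc
        exact k3 u v w a b a' b' huv huw hwv hab hab1 hw hab' hab1' hw' hc
      · intro v z hv hv1 hz' hn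
        have hoz := hz z hz' hn
        rw [κ2 _ _ (by simp)]
        rcases hvs v hv hv1 with rfl | rfl
        · rw [κ2 _ _ (by simp [h2n.ne])]
          by_contra hc
          have h1 := hne z hz' hn
          exact k3 none (some v2) (some v1) (some v1) (some vn) (some v1) z d2 (by omega) (by omega) e1n (by omega)
            (Or.inl rfl) hz' (by omega) (Or.inl rfl) ⟨by omega, by omega⟩
        · rw [κ1]; have := hM (some v1) z; omega
  refine ⟨fun v => p (some v), ?_, ?_, ?_⟩
  · intro u v huv; exact hp.xinj _ _ (by simpa using huv)
  · intro u v w h1 h2 h3; exact hp.gp _ _ _ (by simpa using h1) (by simpa using h2) (by simpa using h3)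
  · intro a b c d h1 h2 h3 h4 h5 h6
    exact hp.dj _ _ _ _ h1 h2 (by simpa using h3) (by simpa using h4) (by simpa using h5) (by simpa using h6)

theorem exists_SL [Fintype V] {G : SimpleGraph V} (hP : WPlanar G) :
    ∃ p, SL G p := by
  classical
  rcases Nat.lt_or_ge (Fintype.card V) 3 with h | h
  · have three : ∀ a b c : V, a ≠ b → a ≠ c → b ≠ c → False := by
      intro a b c h1 h2 h3
      have := Fintype.two_lt_card_iff.mpr ⟨a, b, c, h1, h2, h3⟩
      omega
    refine ⟨fun v => ((Fintype.equivFin V v : ℕ), 0), ?_, ?_, ?_⟩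
    · intro u v huv hh
      apply huv
      have : ((Fintype.equivFin V u : ℕ) : ℝ) = (Fintype.equivFin V v : ℕ) := hh
      exact (Fintype.equivFin V).injective (Fin.ext (by exact_mod_cast this))
    · intro u v w h1 h2 h3; exact (three u v w h1 h2 h3).elim
    · intro a b c d h1 h2 h3 h4 h5 h6; exact (three a b c h1.ne h3 h5).elim
  · obtain ⟨G', hle, hM⟩ := exists_max G hP
    obtain ⟨p, hp⟩ := exists_SL_max hM h
    exact ⟨p, hp.xinj, hp.gp, fun a b c d h1 h2 => hp.dj a b c d (hle h1) (hle h2)⟩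

end StraightFinal
end SN


namespace SN
section Labelling
variable {E U V : Type}

/-- A partial labelling with connected fibres. -/
structure PLab (lab : E × Bool → U) (r : V → U) (l0 l : U → Option V) : Prop where
  ext : ∀ c u, l0 c = some u → l c = some u
  conn : ∀ u c, l c = some u → Reach lab {e | ∀ b, l (lab (e, b)) = some u} (r u) c

theorem extend_labelling [Finite E] [Nonempty V] {pos : E × Bool → ℤ} {lab : E × Bool → U} {T : Set E}
    (h : IsTW pos lab T) (r : V → U) (hr : ∀ u, ∃ d, lab d = r u) (l0 : U → Option V)
    (hr0 : ∀ u, l0 (r u) = some u) (h0 : PLab lab r l0 l0) :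
    ∃ l, PLab lab r l0 l ∧ ∀ d, l (lab d) ≠ none := by
  classical
  suffices H : ∀ n : ℕ, ∀ l, PLab lab r l0 l → {d | l (lab d) = none}.ncard = n →
      ∃ l, PLab lab r l0 l ∧ ∀ d, l (lab d) ≠ none from H _ l0 h0 rfl
  intro n
  induction n using Nat.strong_induction_on with
  | _ n ih =>
    intro l hl hn
    by_cases hall : ∀ d, l (lab d) ≠ none
    · exact ⟨l, hl, hall⟩
    push Not at hall
    obtain ⟨d, hd⟩ := hall
    obtain ⟨d', hd'⟩ := hr (Classical.arbitrary V)
    have hld' : l (lab d') ≠ none := by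
      rw [hd', hl.ext _ _ (hr0 _)]; simp
    obtain ⟨e, b, u, hb, hb'⟩ : ∃ e b u, l (lab (e, b)) = none ∧ l (lab (e, !b)) = some u := by
      by_contra hc
      push Not at hc
      have := Reach.of_edges (R := fun x y => (l x = none ↔ l y = none))
        ⟨fun _ => Iff.rfl, fun h => h.symm, fun h h' => h.trans h'⟩ (fun e _ => by
          constructor
          · intro hx
            cases hy : l (lab (e, true)) with
            | none => rfl
            | some u => exact absurd hy (hc e false u hx)
          · intro hx
            cases hy : l (lab (e, false)) with
            | none => rfl
            | some u => exact absurd hy (hc e true u hx)) (walk h d d')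
      exact hld' (this.mp hd)
    let l' : U → Option V := Function.update l (lab (e, b)) (some u)
    have l's : l' (lab (e, b)) = some u := Function.update_self _ _ _
    have l'o : ∀ c v, l c = some v → l' c = some v := by
      intro c v hc
      have : c ≠ lab (e, b) := fun h => by rw [h, hb] at hc; cases hc
      rw [← hc]; exact Function.update_of_ne this _ _
    have mono : ∀ v, {e | ∀ b, l (lab (e, b)) = some v} ⊆ {e | ∀ b, l' (lab (e, b)) = some v} :=
      fun v e he b => l'o _ _ (he b)
    refine ih ({d | l' (lab d) = none}.ncard) ?_ l' ⟨fun c v hc => l'o _ _ (hl.ext c v hc), ?_⟩ rfl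
    · rw [← hn]
      apply Set.ncard_lt_ncard _ (Set.toFinite _)
      refine ⟨?_, fun hss => ?_⟩
      · intro x hx
        cases hy : l (lab x) with
        | none => exact hy
        | some v => have := l'o _ _ hy; rw [mem_ofPred_eq] at hx; rw [hx] at this; cases this
      · have := hss (show (e, b) ∈ {d | l (lab d) = none} from hb)
        rw [mem_ofPred_eq, l's] at this; cases this
    · intro v c hc
      by_cases hce : c = lab (e, b)
      · subst hce
        rw [l's] at hc; cases hc
        refine ((hl.conn u _ hb').mono (mono u)).trans ?_
        refine Reach.edge (A := {e | ∀ b, l' (lab (e, b)) = some u}) ?_ _ _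
        intro b'
        rcases Bool.eq_or_eq_not b' b with rfl | rfl
        · exact l's
        · exact l'o _ _ hb'
      · have : l c = some v := by rw [← hc]; exact (Function.update_of_ne hce _ _).symm
        exact (hl.conn v c this).mono (mono v)

theorem wplanar_of_labelling [Finite E] [Nontrivial V] {G : SimpleGraph V} {pos : E × Bool → ℤ}
    {lab : E × Bool → U} {T : Set E}
    (h : IsTW pos lab T) (r : V → U) (hr : ∀ u, ∃ d, lab d = r u) (l0 : U → Option V)
    (hr0 : ∀ u, l0 (r u) = some u)
    (h0 : ∀ u c, l0 c = some u → Reach lab {e | ∀ b, l0 (lab (e, b)) = some u} (r u) c)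
    (hadj : ∀ u v, G.Adj u v → ∃ e b, l0 (lab (e, b)) = some u ∧ l0 (lab (e, !b)) = some v) :
    WPlanar G := by
  classical
  obtain ⟨l, hl, htot⟩ := extend_labelling h r hr l0 hr0 ⟨fun _ _ h => h, h0⟩
  have hV : Nonempty V := inferInstance
  let lam : U → V := fun c => (l c).getD hV.some
  have hlam : ∀ c u, l c = some u → lam c = u := by intro c u hc; simp [lam, hc]
  have hlam' : ∀ d, l (lab d) = some (lam (lab d)) := by
    intro d
    obtain ⟨u, hu⟩ := Option.ne_none_iff_exists'.mp (htot d)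
    rw [hu, hlam _ _ hu]
  let A : Set E := {e | lam (lab (e, false)) = lam (lab (e, true))}
  obtain ⟨C, pos', T', hCA, htw⟩ := contraction h lam A (fun e he => he) (by
    intro d d' hdd
    have e1 := hl.conn _ _ (hlam' d)
    have e2 := hl.conn _ _ (hlam' d')
    rw [← hdd] at e2
    have hs : {e | ∀ b, l (lab (e, b)) = some (lam (lab d))} ⊆ A := by
      intro e he
      show lam _ = lam _
      rw [hlam _ _ (he false), hlam _ _ (he true)]
    exact (e1.mono hs).symm.trans (e2.mono hs))
  have hnC : ∀ e, lam (lab (e, false)) ≠ lam (lab (e, true)) → e ∉ C := fun e he hc => he (hCA hc)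
  have hnC' : ∀ e b, lam (lab (e, b)) ≠ lam (lab (e, !b)) → e ∉ C := by
    intro e b he
    cases b
    · exact hnC e he
    · exact hnC e he.symm
  refine ⟨{e // e ∉ C}, inferInstance, _, _, _, htw, ?_, ?_⟩
  · intro u v huv
    obtain ⟨e, b, h1, h2⟩ := hadj u v huv
    have h1 := hlam _ _ (hl.ext _ _ h1)
    have h2 := hlam _ _ (hl.ext _ _ h2)
    exact ⟨⟨e, hnC' e b (by rw [h1, h2]; exact huv.ne)⟩, b, h1, h2⟩
  · intro u
    obtain ⟨v, hv⟩ := exists_ne u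
    obtain ⟨d, hd⟩ := hr u
    obtain ⟨d', hd'⟩ := hr v
    by_contra hc
    push Not at hc
    have key := Reach.of_edges (R := fun x y => (lam x = u ↔ lam y = u))
        ⟨fun _ => Iff.rfl, fun h => h.symm, fun h h' => h.trans h'⟩ (fun e _ => by
          constructor
          · intro hx
            by_contra hy
            exact hc (⟨e, hnC' e false (by rw [hx]; exact fun h => hy h.symm)⟩, false) hx
          · intro hx
            by_contra hy
            exact hc (⟨e, hnC' e true (by rw [hx]; exact fun h => hy h.symm)⟩, true) hx) (walk h d d')
    have h1 : lam (lab d) = u := hlam _ _ (by rw [hd]; exact hl.ext _ _ (hr0 u))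
    have h2 : lam (lab d') = v := hlam _ _ (by rw [hd']; exact hl.ext _ _ (hr0 v))
    exact hv (h2.symm.trans (key.mp h1))

end Labelling
end SN


namespace SN
section Grid

inductive GK | row | col | ver | dia

instance : Finite GK :=
  Finite.of_surjective (fun n : Fin 4 => match n with | 0 => GK.row | 1 => GK.col | 2 => GK.ver | 3 => GK.dia) (by
    intro k
    cases k
    · exact ⟨0, rfl⟩
    · exact ⟨1, rfl⟩
    · exact ⟨2, rfl⟩
    · exact ⟨3, rfl⟩)

/-- Validity of a grid edge. -/
def GV (N M : ℤ) : GK × ℤ × ℤ → Prop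
  | (GK.row, i, j) => 0 ≤ i ∧ i + 1 < N ∧ 0 ≤ j ∧ j < M
  | (GK.col, i, j) => 0 ≤ i ∧ i < 1 ∧ 0 ≤ j ∧ j + 1 < M
  | (GK.ver, i, j) => 0 ≤ i ∧ i < N ∧ 0 ≤ j ∧ j + 1 < M
  | (GK.dia, i, j) => 1 ≤ i ∧ i < N ∧ 0 ≤ j ∧ j + 1 < M

def GJ (M : ℤ) : (GK × ℤ × ℤ) × Bool → ℤ
  | ((GK.row, _, j), _) => j
  | ((GK.col, _, j), false) => j
  | ((GK.col, _, _), true) => M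
  | ((GK.ver, _, j), false) => j
  | ((GK.ver, _, j), true) => j + 1
  | ((GK.dia, _, j), false) => j
  | ((GK.dia, _, j), true) => j + 1

def GR (N M : ℤ) : (GK × ℤ × ℤ) × Bool → ℤ
  | ((GK.row, i, _), false) => 3 * i + 2
  | ((GK.row, i, _), true) => 3 * N + 3 * (N - 1 - (i + 1)) + 2
  | ((GK.col, _, _), false) => 6 * N
  | ((GK.col, _, j), true) => M - j
  | ((GK.ver, i, _), false) => 3 * N + 3 * (N - 1 - i)
  | ((GK.ver, i, _), true) => 3 * i
  | ((GK.dia, i, _), false) => 3 * N + 3 * (N - 1 - i) + 1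
  | ((GK.dia, i, _), true) => 3 * (i - 1) + 1

def GLb : (GK × ℤ × ℤ) × Bool → ℤ × ℤ
  | ((GK.row, i, j), false) => (i, j)
  | ((GK.row, i, j), true) => (i + 1, j)
  | ((GK.col, _, j), false) => (0, j)
  | ((GK.col, _, j), true) => (0, j + 1)
  | ((GK.ver, i, j), false) => (i, j)
  | ((GK.ver, i, j), true) => (i, j + 1)
  | ((GK.dia, i, j), false) => (i, j)
  | ((GK.dia, i, j), true) => (i - 1, j + 1)

theorem lex_lt {Q a b r s : ℤ} (hr : 0 ≤ r) (hr' : r < Q) (hs : 0 ≤ s) (hs' : s < Q) :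
    a * Q + r < b * Q + s ↔ (a < b ∨ (a = b ∧ r < s)) := by
  rcases lt_trichotomy a b with h | h | h
  · have : (a + 1) * Q ≤ b * Q := by
      apply mul_le_mul_of_nonneg_right <;> omega
    constructor
    · intro _; left; exact h
    · intro _; linarith
  · subst h
    constructor
    · intro h; right; exact ⟨rfl, by linarith⟩
    · rintro (h | ⟨_, h⟩)
      · omega
      · linarith
  · have : (b + 1) * Q ≤ a * Q := by
      apply mul_le_mul_of_nonneg_right <;> omega
    constructor
    · intro h'; exfalso; linarith
    · rintro (h' | ⟨h', _⟩) <;> omega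

theorem grid_tw (N M : ℤ) (hN : 1 ≤ N) (hM : 1 ≤ M) :
    IsTW (E := {x // GV N M x}) (fun d => GJ M (d.1.1, d.2) * (6 * N + 1 + M) + GR N M (d.1.1, d.2))
      (fun d => GLb (d.1.1, d.2)) {e | e.1.1 = GK.row ∨ e.1.1 = GK.col} := by
  set pos : {x // GV N M x} × Bool → ℤ := fun d => GJ M (d.1.1, d.2) * (6 * N + 1 + M) + GR N M (d.1.1, d.2) with hpos
  have hR : ∀ d : {x // GV N M x} × Bool, 0 ≤ GR N M (d.1.1, d.2) ∧ GR N M (d.1.1, d.2) < 6 * N + 1 + M := by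
    rintro ⟨⟨⟨k, i, j⟩, hv⟩, b⟩
    cases k <;> cases b <;> simp only [GV, GR] at hv ⊢ <;> omega
  have hlt : ∀ d d' : {x // GV N M x} × Bool, pos d < pos d' ↔
      (GJ M (d.1.1, d.2) < GJ M (d'.1.1, d'.2) ∨ (GJ M (d.1.1, d.2) = GJ M (d'.1.1, d'.2) ∧
        GR N M (d.1.1, d.2) < GR N M (d'.1.1, d'.2))) :=
    fun d d' => lex_lt (hR d).1 (hR d).2 (hR d').1 (hR d').2
  have hS : ∀ g d, S pos g (pos d) = true ↔ ¬ (pos (g, false) < pos d ↔ pos (g, true) < pos d) := by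
    intro g d
    simp only [S]
    by_cases h1 : pos (g, false) < pos d <;> by_cases h2 : pos (g, true) < pos d <;> simp [h1, h2]
  have hrow : ∀ i j h d, S pos ⟨(GK.row, i, j), h⟩ (pos d) = true ↔
      (GLb (d.1.1, d.2)).2 = j ∧ i < (GLb (d.1.1, d.2)).1 := by
    rintro i j h ⟨⟨⟨k, i', j'⟩, hv⟩, b⟩
    rw [hS, hlt, hlt]
    cases k <;> cases b <;> simp only [GV, GR, GJ, GLb, true_and] at h hv ⊢ <;> omega
  have hcol : ∀ i j h d, S pos ⟨(GK.col, i, j), h⟩ (pos d) = true ↔ j < (GLb (d.1.1, d.2)).2 := by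
    rintro i j h ⟨⟨⟨k, i', j'⟩, hv⟩, b⟩
    rw [hS, hlt, hlt]
    cases k <;> cases b <;> simp only [GV, GR, GJ, GLb, true_and] at h hv ⊢ <;> omega
  have hlab : ∀ d : {x // GV N M x} × Bool, 0 ≤ (GLb (d.1.1, d.2)).1 ∧ (GLb (d.1.1, d.2)).1 < N ∧
      0 ≤ (GLb (d.1.1, d.2)).2 ∧ (GLb (d.1.1, d.2)).2 < M := by
    rintro ⟨⟨⟨k, i, j⟩, hv⟩, b⟩
    cases k <;> cases b <;> simp only [GV, GLb] at hv ⊢ <;> omega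
  refine ⟨?_, ?_, ?_⟩
  · intro d d' hdd
    have h1 : ¬ pos d < pos d' := by rw [hdd]; exact lt_irrefl _
    have h2 : ¬ pos d' < pos d := by rw [hdd]; exact lt_irrefl _
    rw [hlt] at h1 h2
    obtain ⟨⟨⟨k, i, j⟩, hv⟩, b⟩ := d
    obtain ⟨⟨⟨k', i', j'⟩, hv'⟩, b'⟩ := d'
    cases k <;> cases b <;> cases k' <;> cases b' <;> simp only [GV, GR, GJ, true_and] at h1 h2 hv hv' <;>
      first
      | (exfalso; omega)
      | (obtain rfl : i = i' := by omega
         obtain rfl : j = j' := by omega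
         rfl)
  · intro e f hef hT
    have hxor : ∀ e f, alt pos e f = false ↔ (S pos e (pos (f, false)) = true ↔ S pos e (pos (f, true)) = true) := by
      intro e f
      simp only [alt]
      cases S pos e (pos (f, false)) <;> cases S pos e (pos (f, true)) <;> simp
    rw [hxor]
    obtain ⟨⟨k, i, j⟩, hv⟩ := e
    obtain ⟨⟨k', i', j'⟩, hv'⟩ := f
    have hne : ¬ (k = k' ∧ i = i' ∧ j = j') := by
      rintro ⟨rfl, rfl, rfl⟩; exact hef rfl
    cases k with
    | row =>
      rw [hrow, hrow]
      cases k' <;> simp at hT hne <;> simp only [GLb, GV] at hv hv' ⊢ <;> omega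
    | col =>
      rw [hcol, hcol]
      cases k' <;> simp at hT hne <;> simp only [GLb, GV] at hv hv' ⊢ <;> omega
    | ver =>
      rw [hS, hS, hlt, hlt, hlt, hlt]
      cases k' <;> simp at hT hne <;> simp only [GR, GJ, GV, true_and] at hv hv' ⊢ <;> omega
    | dia =>
      rw [hS, hS, hlt, hlt, hlt, hlt]
      cases k' <;> simp at hT hne <;> simp only [GR, GJ, GV, true_and] at hv hv' ⊢ <;> omega
  · intro d d'
    constructor
    · intro hdd g hg
      have hdd : GLb (d.1.1, d.2) = GLb (d'.1.1, d'.2) := hdd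
      obtain ⟨⟨k, i, j⟩, hv⟩ := g
      rcases hg with hk | hk
      · simp only at hk; subst hk
        rw [Bool.eq_iff_iff, hrow, hrow, hdd]
      · simp only at hk; subst hk
        rw [Bool.eq_iff_iff, hcol, hcol, hdd]
    · intro hall
      have l1 := hlab d
      have l2 := hlab d'
      show GLb (d.1.1, d.2) = GLb (d'.1.1, d'.2)
      have e2 : (GLb (d.1.1, d.2)).2 = (GLb (d'.1.1, d'.2)).2 := by
        by_contra hc
        rcases lt_or_gt_of_ne hc with h | h
        · have hv : GV N M (GK.col, 0, (GLb (d.1.1, d.2)).2) := ⟨le_rfl, by omega, by omega, by omega⟩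
          have := hall ⟨(GK.col, 0, (GLb (d.1.1, d.2)).2), hv⟩ (Or.inr rfl)
          rw [Bool.eq_iff_iff, hcol, hcol] at this; omega
        · have hv : GV N M (GK.col, 0, (GLb (d'.1.1, d'.2)).2) := ⟨le_rfl, by omega, by omega, by omega⟩
          have := hall ⟨(GK.col, 0, (GLb (d'.1.1, d'.2)).2), hv⟩ (Or.inr rfl)
          rw [Bool.eq_iff_iff, hcol, hcol] at this; omega
      refine Prod.ext ?_ e2
      by_contra hc
      rcases lt_or_gt_of_ne hc with h | h
      · have hv : GV N M (GK.row, (GLb (d.1.1, d.2)).1, (GLb (d.1.1, d.2)).2) := ⟨by omega, by omega, by omega, by omega⟩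
        have := hall ⟨(GK.row, (GLb (d.1.1, d.2)).1, (GLb (d.1.1, d.2)).2), hv⟩ (Or.inl rfl)
        rw [Bool.eq_iff_iff, hrow, hrow] at this; omega
      · have hv : GV N M (GK.row, (GLb (d'.1.1, d'.2)).1, (GLb (d'.1.1, d'.2)).2) := ⟨by omega, by omega, by omega, by omega⟩
        have := hall ⟨(GK.row, (GLb (d'.1.1, d'.2)).1, (GLb (d'.1.1, d'.2)).2), hv⟩ (Or.inl rfl)
        rw [Bool.eq_iff_iff, hrow, hrow] at this; omega

instance grid_finite (N M : ℤ) : Finite {x // GV N M x} := by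
  have : ({x | GV N M x} : Set (GK × ℤ × ℤ)).Finite := by
    apply Set.Finite.subset (s := (univ : Set GK) ×ˢ (Set.Icc (0 : ℤ) (max N 0 + 1) ×ˢ Set.Icc (0 : ℤ) (M + 1)))
    · exact Set.finite_univ.prod ((Set.finite_Icc _ _).prod (Set.finite_Icc _ _))
    · rintro ⟨k, i, j⟩ h
      refine ⟨trivial, ?_⟩
      cases k <;> simp only [GV, mem_ofPred_eq, mem_prod, mem_Icc] at h ⊢ <;> omega
  exact this.to_subtype

/-- The host: a fine tree word on cells. -/
theorem exists_host (R ε : ℝ) (hR : 0 < R) (hε : 0 < ε) :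
    ∃ (E : Type) (_ : Finite E) (pos : E × Bool → ℤ) (lab : E × Bool → ℤ × ℤ) (T : Set E)
      (c : ℝ × ℝ → ℤ × ℤ) (η : ℝ), IsTW pos lab T ∧ 0 < η ∧
      (∀ P, dist P 0 ≤ R → ∃ d, lab d = c P) ∧
      (∀ P P', dist P 0 ≤ R → dist P' 0 ≤ R → dist P P' ≤ η → c P = c P' ∨
        ∃ e b, lab (e, b) = c P ∧ lab (e, !b) = c P') ∧
      (∀ P P', c P = c P' → dist P P' ≤ ε) := by
  let X : ℝ × ℝ → ℝ := fun P => (P.1 + R) / ε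
  let Y : ℝ × ℝ → ℝ := fun P => (P.2 + R) / ε
  let M : ℤ := ⌊2 * R / ε⌋ + 1
  let c : ℝ × ℝ → ℤ × ℤ := fun P => (⌊X P + (M - ⌊Y P⌋ : ℤ) / 2⌋, ⌊Y P⌋)
  let N : ℤ := ⌊2 * R / ε⌋ + M + 2
  have hM0 : 0 ≤ ⌊2 * R / ε⌋ := Int.floor_nonneg.mpr (by positivity)
  have hb : ∀ P : ℝ × ℝ, dist P 0 ≤ R → 0 ≤ X P ∧ X P ≤ 2 * R / ε ∧ 0 ≤ Y P ∧ Y P ≤ 2 * R / ε := by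
    intro P hP
    rw [dist_zero_right, Prod.norm_def, sup_le_iff, Real.norm_eq_abs, Real.norm_eq_abs, abs_le, abs_le] at hP
    refine ⟨div_nonneg (by linarith) hε.le, ?_, div_nonneg (by linarith) hε.le, ?_⟩
    · apply (div_le_div_iff_of_pos_right hε).mpr; linarith
    · apply (div_le_div_iff_of_pos_right hε).mpr; linarith
  have hy : ∀ P : ℝ × ℝ, dist P 0 ≤ R → 0 ≤ ⌊Y P⌋ ∧ ⌊Y P⌋ < M := by
    intro P hP
    obtain ⟨_, _, h3, h4⟩ := hb P hP
    have := Int.floor_le_floor h4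
    exact ⟨Int.floor_nonneg.mpr h3, by simp only [M]; omega⟩
  have hx : ∀ P : ℝ × ℝ, dist P 0 ≤ R → 0 ≤ (c P).1 ∧ (c P).1 < N := by
    intro P hP
    obtain ⟨h1, h2, _, _⟩ := hb P hP
    obtain ⟨h3, h4⟩ := hy P hP
    have h3' : (0 : ℝ) ≤ (⌊Y P⌋ : ℝ) := by exact_mod_cast h3
    have h4' : (⌊Y P⌋ : ℝ) < M := by exact_mod_cast h4
    constructor
    · apply Int.floor_nonneg.mpr
      push_cast
      linarith
    · apply Int.floor_lt.mpr
      have := Int.lt_floor_add_one (2 * R / ε)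
      simp only [N]
      push_cast
      have hM1 : (0 : ℝ) ≤ M := by linarith
      linarith
  refine ⟨{x // GV N M x}, inferInstance, _, _, _, c, ε / 4, grid_tw N M (by simp only [N, M]; omega) (by simp only [M]; omega),
    by positivity, ?_, ?_, ?_⟩
  · intro P hP
    obtain ⟨h1, h2⟩ := hx P hP
    obtain ⟨h3, h4⟩ := hy P hP
    have e : c P = ((c P).1, ⌊Y P⌋) := rfl
    rw [e]
    by_cases h : (c P).1 + 1 < N
    · exact ⟨(⟨(GK.row, (c P).1, ⌊Y P⌋), ⟨h1, h, h3, h4⟩⟩, false), rfl⟩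
    · have hN2 : 2 ≤ N := by simp only [N, M]; omega
      refine ⟨(⟨(GK.row, (c P).1 - 1, ⌊Y P⌋), ⟨by omega, by omega, h3, h4⟩⟩, true), ?_⟩
      simp [GLb]
  · -- closeness
    have step : ∀ P P' : ℝ × ℝ, dist P 0 ≤ R → dist P' 0 ≤ R → dist P P' ≤ ε / 4 → ⌊Y P⌋ ≤ ⌊Y P'⌋ → c P = c P' ∨
        ∃ (e : {x // GV N M x}) (b : Bool), GLb (e.1, b) = c P ∧ GLb (e.1, !b) = c P' := by
      intro P P' hP hP' hd hle
      obtain ⟨h1, h2⟩ := hx P hP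
      obtain ⟨h3, h4⟩ := hy P hP
      obtain ⟨h1', h2'⟩ := hx P' hP'
      obtain ⟨h3', h4'⟩ := hy P' hP'
      rw [Prod.dist_eq, sup_le_iff, Real.dist_eq, Real.dist_eq, abs_le, abs_le] at hd
      have hX : |X P - X P'| ≤ 1 / 4 := by
        have : X P - X P' = (P.1 - P'.1) / ε := by simp only [X]; field_simp; ring
        rw [this, abs_le, le_div_iff₀ hε, div_le_iff₀ hε]
        constructor <;> linarith [hd.1.1, hd.1.2]
      have hY : |Y P - Y P'| ≤ 1 / 4 := by
        have : Y P - Y P' = (P.2 - P'.2) / ε := by simp only [Y]; field_simp; ring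
        rw [this, abs_le, le_div_iff₀ hε, div_le_iff₀ hε]
        constructor <;> linarith [hd.2.1, hd.2.2]
      rw [abs_le] at hX hY
      have hle2 : ⌊Y P'⌋ ≤ ⌊Y P⌋ + 1 := by
        have a1 := Int.floor_le (Y P')
        have a2 := Int.lt_floor_add_one (Y P)
        have : (⌊Y P'⌋ : ℝ) < ⌊Y P⌋ + 2 := by linarith
        have : ⌊Y P'⌋ < ⌊Y P⌋ + 2 := by exact_mod_cast this
        omega
      have a1 := Int.floor_le (X P + (M - ⌊Y P⌋ : ℤ) / 2)
      have a2 := Int.lt_floor_add_one (X P + (M - ⌊Y P⌋ : ℤ) / 2)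
      have b1 := Int.floor_le (X P' + (M - ⌊Y P'⌋ : ℤ) / 2)
      have b2 := Int.lt_floor_add_one (X P' + (M - ⌊Y P'⌋ : ℤ) / 2)
      have c1 : (c P).1 = ⌊X P + (M - ⌊Y P⌋ : ℤ) / 2⌋ := rfl
      have c2 : (c P').1 = ⌊X P' + (M - ⌊Y P'⌋ : ℤ) / 2⌋ := rfl
      rw [← c1] at a1 a2
      rw [← c2] at b1 b2
      push_cast at a1 a2 b1 b2
      have eP : c P = ((c P).1, ⌊Y P⌋) := rfl
      have eP' : c P' = ((c P').1, ⌊Y P'⌋) := rfl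
      rcases (by omega : ⌊Y P'⌋ = ⌊Y P⌋ ∨ ⌊Y P'⌋ = ⌊Y P⌋ + 1) with hh | hh
      · rw [hh] at b1 b2
        have l1 : ((c P).1 : ℝ) < (c P').1 + 2 := by linarith
        have l2 : ((c P').1 : ℝ) < (c P).1 + 2 := by linarith
        have l1 : (c P).1 < (c P').1 + 2 := by exact_mod_cast l1
        have l2 : (c P').1 < (c P).1 + 2 := by exact_mod_cast l2
        rcases (by omega : (c P).1 = (c P').1 ∨ (c P').1 = (c P).1 + 1 ∨ (c P).1 = (c P').1 + 1) with h | h | h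
        · left; rw [eP, eP', h, hh]
        · right
          refine ⟨⟨(GK.row, (c P).1, ⌊Y P⌋), ⟨h1, by omega, h3, h4⟩⟩, false, rfl, ?_⟩
          rw [eP', h, hh]; rfl
        · right
          refine ⟨⟨(GK.row, (c P').1, ⌊Y P⌋), ⟨h1', by omega, h3, h4⟩⟩, true, ?_, ?_⟩
          · rw [eP, h]; rfl
          · show ((c P').1, ⌊Y P⌋) = c P'
            rw [← hh]
      · rw [hh] at b1 b2
        push_cast at b1 b2
        have l1 : ((c P).1 : ℝ) < (c P').1 + 2 := by linarith
        have l2 : ((c P').1 : ℝ) < (c P).1 + 1 := by linarith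
        have l1 : (c P).1 < (c P').1 + 2 := by exact_mod_cast l1
        have l2 : (c P').1 < (c P).1 + 1 := by exact_mod_cast l2
        right
        rcases (by omega : (c P).1 = (c P').1 ∨ (c P).1 = (c P').1 + 1) with h | h
        · refine ⟨⟨(GK.ver, (c P).1, ⌊Y P⌋), ⟨h1, h2, h3, by omega⟩⟩, false, rfl, ?_⟩
          rw [eP', ← h, hh]; rfl
        · refine ⟨⟨(GK.dia, (c P).1, ⌊Y P⌋), ⟨by omega, h2, h3, by omega⟩⟩, false, rfl, ?_⟩
          show ((c P).1 - 1, ⌊Y P⌋ + 1) = c P'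
          rw [eP', hh, h]
          simp
    intro P P' hP hP' hd
    rcases le_total ⌊Y P⌋ ⌊Y P'⌋ with h | h
    · exact step P P' hP hP' hd h
    · rcases step P' P hP' hP (by rw [dist_comm]; exact hd) h with h | ⟨e, b, h1, h2⟩
      · left; exact h.symm
      · right; exact ⟨e, !b, h2, by rw [Bool.not_not]; exact h1⟩
  · intro P P' hc
    have h2 : ⌊Y P⌋ = ⌊Y P'⌋ := congrArg Prod.snd hc
    have h1 : ⌊X P + (M - ⌊Y P⌋ : ℤ) / 2⌋ = ⌊X P' + (M - ⌊Y P'⌋ : ℤ) / 2⌋ := congrArg Prod.fst hc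
    have d2 := Int.abs_sub_lt_one_of_floor_eq_floor h2
    have d1 := Int.abs_sub_lt_one_of_floor_eq_floor h1
    rw [h2] at d1
    have e1 : X P + (M - ⌊Y P'⌋ : ℤ) / 2 - (X P' + (M - ⌊Y P'⌋ : ℤ) / 2) = (P.1 - P'.1) / ε := by
      simp only [X]; field_simp; ring
    have e2 : Y P - Y P' = (P.2 - P'.2) / ε := by
      simp only [Y]; field_simp; ring
    rw [e1, abs_lt, lt_div_iff₀ hε, div_lt_iff₀ hε] at d1
    rw [e2, abs_lt, lt_div_iff₀ hε, div_lt_iff₀ hε] at d2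
    rw [Prod.dist_eq, sup_le_iff, Real.dist_eq, Real.dist_eq, abs_le, abs_le]
    refine ⟨⟨by linarith, by linarith⟩, ⟨by linarith, by linarith⟩⟩

end Grid
end SN


namespace SN
section Topo

theorem sample {f : ℝ → Pt} (hf : ContinuousOn f (Set.Icc 0 1)) {η : ℝ} (hη : 0 < η) :
    ∃ (L : ℕ) (q : ℕ → Pt), q 0 = f 0 ∧ q L = f 1 ∧ (∀ k ≤ L, q k ∈ f '' Set.Icc 0 1) ∧
      ∀ k < L, dist (q k) (q (k + 1)) ≤ η := by
  have hu := isCompact_Icc.uniformContinuousOn_of_continuous hf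
  rw [Metric.uniformContinuousOn_iff] at hu
  obtain ⟨δ, hδ, hu⟩ := hu η hη
  obtain ⟨L, hL⟩ := exists_nat_gt (1 / δ)
  have hL0 : (0 : ℝ) < L := lt_trans (by positivity) hL
  have hmem : ∀ k ≤ L, ((k : ℝ) / L) ∈ Set.Icc (0 : ℝ) 1 := by
    intro k hk
    have : (k : ℝ) ≤ L := by exact_mod_cast hk
    exact ⟨by positivity, (div_le_one hL0).mpr this⟩
  refine ⟨L, fun k => f (k / L), by simp, by simp [div_self hL0.ne'], ?_, ?_⟩
  · intro k hk; exact ⟨_, hmem k hk, rfl⟩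
  · intro k hk
    refine (hu _ (hmem k hk.le) _ (hmem (k + 1) hk) ?_).le
    rw [Real.dist_eq]
    have : (k : ℝ) / L - ((k + 1 : ℕ) : ℝ) / L = - (1 / L) := by push_cast; field_simp; ring
    rw [this, abs_neg, abs_of_pos (by positivity)]
    rw [div_lt_iff₀ hδ] at hL
    rw [div_lt_iff₀ hL0]; linarith

theorem gap {U : Type} (γ : ℕ → U) (L : ℕ) (P Q : Set U) (h0 : γ 0 ∈ P) (hL : γ L ∈ Q) (hPQ : Disjoint P Q) :
    ∃ k0 k1, k0 < k1 ∧ k1 ≤ L ∧ γ k0 ∈ P ∧ γ k1 ∈ Q ∧ ∀ k, k0 < k → k < k1 → γ k ∉ P ∧ γ k ∉ Q := by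
  classical
  have hex : ∃ k, γ k ∈ Q := ⟨L, hL⟩
  let k1 := Nat.find hex
  have hk1 : γ k1 ∈ Q := Nat.find_spec hex
  let k0 := Nat.findGreatest (fun k => γ k ∈ P) k1
  have hk0 : γ k0 ∈ P := Nat.findGreatest_spec (P := fun k => γ k ∈ P) (Nat.zero_le k1) h0
  have hle : k0 ≤ k1 := Nat.findGreatest_le _
  refine ⟨k0, k1, lt_of_le_of_ne hle fun h => ?_, Nat.find_min' hex hL, hk0, hk1, ?_⟩
  · rw [h] at hk0; exact Set.disjoint_left.mp hPQ hk0 hk1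
  · intro k h1 h2
    exact ⟨Nat.findGreatest_is_greatest (P := fun k => γ k ∈ P) h1 h2.le, Nat.find_min hex h2⟩

theorem compact_sep {K K' : Set Pt} (hK : IsCompact K) (hK' : IsCompact K') (hd : Disjoint K K') :
    ∀ᶠ ε in nhdsWithin (0 : ℝ) (Set.Ioi 0), ∀ P ∈ K, ∀ Q ∈ K', ε < dist P Q := by
  have : ∃ ε0 > (0 : ℝ), ∀ P ∈ K, ∀ Q ∈ K', ε0 ≤ dist P Q := by
    rcases (K ×ˢ K').eq_empty_or_nonempty with he | hne
    · refine ⟨1, one_pos, fun P hP Q hQ => ?_⟩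
      have : (P, Q) ∈ K ×ˢ K' := ⟨hP, hQ⟩
      rw [he] at this; exact this.elim
    · obtain ⟨⟨P0, Q0⟩, h0, hmin⟩ := (hK.prod hK').exists_isMinOn hne
        (f := fun x : Pt × Pt => dist x.1 x.2) (by fun_prop)
      refine ⟨dist P0 Q0, dist_pos.mpr fun h => ?_, fun P hP Q hQ => hmin (show (P, Q) ∈ K ×ˢ K' from ⟨hP, hQ⟩)⟩
      exact Set.disjoint_left.mp hd h0.1 (h ▸ h0.2)
  obtain ⟨ε0, hε0, h⟩ := this
  filter_upwards [Ioo_mem_nhdsGT hε0] with ε hε P hP Q hQ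
  exact lt_of_lt_of_le hε.2 (h P hP Q hQ)

theorem wplanar_of_drawing {V : Type} [Fintype V] [Nontrivial V] {G : SimpleGraph V} (Γ : PlanarDrawing G) :
    WPlanar G := by
  classical
  -- orientation and parametrisation
  have hor : ∀ e : G.edgeSet, ∃ u v, s(u, v) = e.1 ∧ G.Adj u v := by
    rintro ⟨e, he⟩
    induction e with
    | _ u v => exact ⟨u, v, rfl, he⟩
  choose tl hd hs hadj using hor
  have harc : ∀ e : G.edgeSet, IsArcBetween (Γ.arc e.1) (Γ.ρ (tl e)) (Γ.ρ (hd e)) := by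
    intro e; rw [← hs e]; exact Γ.arc_isArc _ _ (hadj e)
  choose f fc fi f0 f1 fA using harc
  have hcomp : ∀ e : G.edgeSet, IsCompact (Γ.arc e.1) := by
    intro e; rw [fA e]; exact isCompact_Icc.image_of_continuousOn (fc e)
  have hmem : ∀ (e : G.edgeSet) w, w ∈ e.1 ↔ w = tl e ∨ w = hd e := by
    intro e w; rw [← hs e]; exact Sym2.mem_iff
  -- radius
  have ev1 : ∀ᶠ x in nhdsWithin (0 : ℝ) (Set.Ioi 0), ∀ u v, u ≠ v → 3 * x < dist (Γ.ρ u) (Γ.ρ v) := by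
    rw [Filter.eventually_all]; intro u
    rw [Filter.eventually_all]; intro v
    by_cases huv : u = v
    · exact Filter.Eventually.of_forall fun x h => absurd huv h
    · have : 0 < dist (Γ.ρ u) (Γ.ρ v) := dist_pos.mpr (Γ.inj.ne huv)
      filter_upwards [Ioo_mem_nhdsGT (show (0 : ℝ) < dist (Γ.ρ u) (Γ.ρ v) / 3 by positivity)] with x hx _
      linarith [hx.2]
  have ev2 : ∀ᶠ x in nhdsWithin (0 : ℝ) (Set.Ioi 0), ∀ (e : G.edgeSet) w, w ∉ e.1 →
      ∀ P ∈ Γ.arc e.1, ∀ Q ∈ ({Γ.ρ w} : Set Pt), 2 * x < dist P Q := by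
    rw [Filter.eventually_all]; intro e
    rw [Filter.eventually_all]; intro w
    by_cases hw : w ∈ e.1
    · exact Filter.Eventually.of_forall fun x h => absurd hw h
    · have h := compact_sep (hcomp e) (isCompact_singleton (x := Γ.ρ w)) (by
        rw [Set.disjoint_singleton_right]; exact fun h => hw (Γ.vertex_mem _ e.2 _ h))
      have hten : Filter.Tendsto (fun x : ℝ => 2 * x) (nhdsWithin 0 (Set.Ioi 0)) (nhdsWithin 0 (Set.Ioi 0)) := by
        apply tendsto_nhdsWithin_of_tendsto_nhds_of_eventually_within
        · have : Filter.Tendsto (fun x : ℝ => 2 * x) (nhds 0) (nhds (2 * 0)) := by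
            exact (continuous_const.mul continuous_id).tendsto 0
          rw [mul_zero] at this
          exact this.mono_left nhdsWithin_le_nhds
        · filter_upwards [self_mem_nhdsWithin] with x hx
          have : (0 : ℝ) < x := hx
          show 0 < 2 * x
          linarith
      filter_upwards [hten.eventually h] with x hx _
      exact hx
  obtain ⟨r, ⟨hr1, hr2⟩, hr⟩ := ((ev1.and ev2).and (self_mem_nhdsWithin)).exists
  have hr : 0 < r := hr
  -- cores
  let K : G.edgeSet → Set Pt := fun e => Γ.arc e.1 ∩ {P | r ≤ dist P (Γ.ρ (tl e)) ∧ r ≤ dist P (Γ.ρ (hd e))}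
  have hKc : ∀ e, IsCompact (K e) := by
    intro e
    apply (hcomp e).inter_right
    apply IsClosed.inter
    · exact isClosed_le continuous_const (continuous_id.dist continuous_const)
    · exact isClosed_le continuous_const (continuous_id.dist continuous_const)
  have hKd : ∀ e e', e ≠ e' → Disjoint (K e) (K e') := by
    intro e e' hne
    rw [Set.disjoint_left]
    intro P hP hP'
    obtain ⟨w, hw, _, rfl⟩ := Γ.arcs_cross _ e.2 _ e'.2 (fun h => hne (Subtype.ext h)) P ⟨hP.1, hP'.1⟩
    rcases (hmem e w).mp hw with rfl | rfl
    · have := hP.2.1; rw [dist_self] at this; linarith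
    · have := hP.2.2; rw [dist_self] at this; linarith
  have ev3 : ∀ᶠ x in nhdsWithin (0 : ℝ) (Set.Ioi 0), ∀ e e', e ≠ e' → ∀ P ∈ K e, ∀ Q ∈ K e', x < dist P Q := by
    rw [Filter.eventually_all]; intro e
    rw [Filter.eventually_all]; intro e'
    by_cases h : e = e'
    · exact Filter.Eventually.of_forall fun x h' => absurd h h'
    · filter_upwards [compact_sep (hKc e) (hKc e') (hKd e e' h)] with x hx _
      exact hx
  obtain ⟨ε, ⟨hε3, hε⟩⟩ := (ev3.and (Ioo_mem_nhdsGT hr)).exists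
  -- bound
  have hbd : IsBounded ((⋃ e : G.edgeSet, Γ.arc e.1) ∪ ⋃ u, Metric.closedBall (Γ.ρ u) r) := by
    rw [isBounded_union]
    constructor
    · rw [isBounded_iUnion]; exact fun e => (hcomp e).isBounded
    · rw [isBounded_iUnion]; exact fun u => Metric.isBounded_closedBall
  obtain ⟨R0, hR0⟩ := hbd.subset_closedBall (0 : Pt)
  let R := max R0 1
  have hRarc : ∀ (e : G.edgeSet), ∀ P ∈ Γ.arc e.1, dist P 0 ≤ R := fun e P hP =>
    le_trans (hR0 (Or.inl (mem_iUnion.mpr ⟨e, hP⟩))) (le_max_left _ _)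
  have hRball : ∀ u, ∀ P ∈ Metric.closedBall (Γ.ρ u) r, dist P 0 ≤ R := fun u P hP =>
    le_trans (hR0 (Or.inr (mem_iUnion.mpr ⟨u, hP⟩))) (le_max_left _ _)
  obtain ⟨E, hE, pos, lab, T, c, η, htw, hη, hc1, hc2, hc3⟩ := exists_host R ε (lt_of_lt_of_le one_pos (le_max_right _ _)) hε.1
  -- ball cells
  let B : V → Set (ℤ × ℤ) := fun u => c '' Metric.closedBall (Γ.ρ u) r
  have hBd : ∀ u v x, x ∈ B u → x ∈ B v → u = v := by
    rintro u v x ⟨P, hP, rfl⟩ ⟨Q, hQ, hPQ⟩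
    by_contra huv
    have h1 := hr1 u v huv
    have h2 := hc3 _ _ hPQ
    rw [Metric.mem_closedBall] at hP hQ
    have h3 := dist_triangle4 (Γ.ρ u) P Q (Γ.ρ v)
    rw [dist_comm (Γ.ρ u) P, dist_comm P Q] at h3
    linarith [hε.2]
  have hcen : ∀ u, c (Γ.ρ u) ∈ B u := fun u => ⟨_, Metric.mem_closedBall_self hr.le, rfl⟩
  -- samples
  have hsm := fun e : G.edgeSet => sample (fc e) hη
  choose L q q0 qL qA qd using hsm
  have qA : ∀ e, ∀ k ≤ L e, q e k ∈ Γ.arc e.1 := by intro e k hk; rw [fA e]; exact qA e k hk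
  have hgap := fun e : G.edgeSet => gap (fun k => c (q e k)) (L e) (B (tl e)) (B (hd e))
    (by rw [q0, f0]; exact hcen _) (by rw [qL, f1]; exact hcen _)
    (by rw [Set.disjoint_left]; exact fun x h1 h2 => (hadj e).ne (hBd _ _ x h1 h2))
  choose k0 k1 k01 k1L hk0 hk1 hkm using hgap
  let Pc : G.edgeSet → Set (ℤ × ℤ) := fun e => {x | ∃ k, k0 e < k ∧ k < k1 e ∧ c (q e k) = x}
  have hPB : ∀ e x, x ∈ Pc e → ∀ w, x ∉ B w := by
    rintro e x ⟨k, h1, h2, rfl⟩ w hw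
    by_cases hwe : w ∈ e.1
    · rcases (hmem e w).mp hwe with rfl | rfl
      · exact (hkm e k h1 h2).1 hw
      · exact (hkm e k h1 h2).2 hw
    · obtain ⟨Q, hQ, hQc⟩ := hw
      have a1 := hr2 e w hwe _ (qA e k (h2.le.trans (k1L e))) _ rfl
      have a2 := hc3 _ _ hQc
      rw [Metric.mem_closedBall] at hQ
      have a3 := dist_triangle (q e k) Q (Γ.ρ w)
      rw [dist_comm (q e k) Q] at a3
      linarith [hε.2]
  have hPK : ∀ e k, k0 e < k → k < k1 e → q e k ∈ K e := by
    intro e k h1 h2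
    refine ⟨qA e k (h2.le.trans (k1L e)), ?_, ?_⟩
    · by_contra h
      push Not at h
      exact (hkm e k h1 h2).1 ⟨q e k, Metric.mem_closedBall.mpr h.le, rfl⟩
    · by_contra h
      push Not at h
      exact (hkm e k h1 h2).2 ⟨q e k, Metric.mem_closedBall.mpr h.le, rfl⟩
  have hPd : ∀ e e' x, x ∈ Pc e → x ∈ Pc e' → e = e' := by
    rintro e e' x ⟨k, h1, h2, rfl⟩ ⟨k', h1', h2', hx⟩
    by_contra hne
    have a1 := hε3 e e' hne _ (hPK e k h1 h2) _ (hPK e' k' h1' h2')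
    have a2 := hc3 _ _ hx
    rw [dist_comm] at a2
    linarith
  let l0 : ℤ × ℤ → Option V := fun x => if h : ∃ u, x ∈ B u then some h.choose else
    if h : ∃ e, x ∈ Pc e then some (tl h.choose) else none
  have lB : ∀ u x, x ∈ B u → l0 x = some u := by
    intro u x hx
    have h : ∃ u, x ∈ B u := ⟨u, hx⟩
    simp only [l0, dif_pos h]
    rw [hBd _ _ x h.choose_spec hx]
  have lP : ∀ e x, x ∈ Pc e → l0 x = some (tl e) := by
    intro e x hx
    have h : ¬ ∃ u, x ∈ B u := fun ⟨u, hu⟩ => hPB e x hx u hu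
    have h' : ∃ e, x ∈ Pc e := ⟨e, hx⟩
    simp only [l0, dif_neg h, dif_pos h']
    rw [hPd _ _ x h'.choose_spec hx]
  have lC : ∀ u x, l0 x = some u → x ∈ B u ∨ ∃ e, x ∈ Pc e ∧ tl e = u := by
    intro u x hx
    by_cases h : ∃ u, x ∈ B u
    · simp only [l0, dif_pos h, Option.some.injEq] at hx
      left; rw [← hx]; exact h.choose_spec
    · by_cases h' : ∃ e, x ∈ Pc e
      · simp only [l0, dif_neg h, dif_pos h', Option.some.injEq] at hx
        right; exact ⟨_, h'.choose_spec, hx⟩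
      · simp only [l0, dif_neg h, dif_neg h'] at hx
        cases hx
  have stp : ∀ u P Q, dist P 0 ≤ R → dist Q 0 ≤ R → dist P Q ≤ η → l0 (c P) = some u → l0 (c Q) = some u →
      Reach lab {e | ∀ b, l0 (lab (e, b)) = some u} (c P) (c Q) := by
    intro u P Q hP hQ hPQ h1 h2
    rcases hc2 P Q hP hQ hPQ with h | ⟨e, b, e1, e2⟩
    · rw [h]; exact Reach.refl _
    · rw [← e1, ← e2]
      refine Reach.edge (A := {e | ∀ b, l0 (lab (e, b)) = some u}) ?_ _ _
      intro b'
      rcases Bool.eq_or_eq_not b' b with rfl | rfl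
      · rw [e1]; exact h1
      · rw [e2]; exact h2
  have connB : ∀ u x, x ∈ B u → Reach lab {e | ∀ b, l0 (lab (e, b)) = some u} (c (Γ.ρ u)) x := by
    rintro u x ⟨P, hP, rfl⟩
    obtain ⟨L', p, p0, pL, pA, pd⟩ := sample (f := fun t => AffineMap.lineMap (Γ.ρ u) P t)
      (by fun_prop) hη
    simp only [AffineMap.lineMap_apply_zero] at p0
    simp only [AffineMap.lineMap_apply_one] at pL
    have pb : ∀ k ≤ L', p k ∈ Metric.closedBall (Γ.ρ u) r := by
      intro k hk
      obtain ⟨t, ht, hp⟩ := pA k hk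
      rw [← hp]
      exact (convex_closedBall (Γ.ρ u) r).lineMap_mem (Metric.mem_closedBall_self hr.le) hP ht
    have : ∀ k ≤ L', Reach lab {e | ∀ b, l0 (lab (e, b)) = some u} (c (Γ.ρ u)) (c (p k)) := by
      intro k
      induction k with
      | zero => intro _; rw [p0]; exact Reach.refl _
      | succ k ih =>
        intro hk
        exact (ih (by omega)).trans (stp u _ _ (hRball u _ (pb k (by omega))) (hRball u _ (pb _ hk)) (pd k hk)
          (lB u _ ⟨_, pb k (by omega), rfl⟩) (lB u _ ⟨_, pb _ hk, rfl⟩))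
    have := this L' le_rfl
    rwa [pL] at this
  have lq : ∀ e k, k0 e ≤ k → k < k1 e → l0 (c (q e k)) = some (tl e) := by
    intro e k h1 h2
    rcases h1.eq_or_lt with h | h
    · rw [← h]; exact lB _ _ (hk0 e)
    · exact lP e _ ⟨k, h, h2, rfl⟩
  refine wplanar_of_labelling htw (fun u => c (Γ.ρ u)) (fun u => hc1 _ (hRball u _ (Metric.mem_closedBall_self hr.le))) l0
    (fun u => lB u _ (hcen u)) ?_ ?_
  · intro u x hx
    rcases lC u x hx with h | ⟨e, ⟨k, h1, h2, rfl⟩, rfl⟩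
    · exact connB u x h
    · have : ∀ j, k0 e + j < k1 e → Reach lab {e' | ∀ b, l0 (lab (e', b)) = some (tl e)} (c (Γ.ρ (tl e))) (c (q e (k0 e + j))) := by
        intro j
        induction j with
        | zero => intro _; exact connB _ _ (hk0 e)
        | succ j ih =>
          intro hj
          have := k1L e
          exact (ih (by omega)).trans (stp _ _ _ (hRarc e _ (qA e _ (by omega))) (hRarc e _ (qA e _ (by omega)))
            (qd e _ (by omega)) (lq e _ (by omega) (by omega)) (lq e _ (by omega) (by omega)))
      have := this (k - k0 e) (by omega)
      rwa [Nat.add_sub_cancel' h1.le] at this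
  · intro u v huv
    let e : G.edgeSet := ⟨s(u, v), huv⟩
    obtain ⟨e', b, h1, h2⟩ : ∃ e' b, l0 (lab (e', b)) = some (tl e) ∧ l0 (lab (e', !b)) = some (hd e) := by
      have a0 := k01 e
      have a1 := k1L e
      have hq := qd e (k1 e - 1) (by omega)
      rw [Nat.sub_add_cancel (by omega)] at hq
      have b1 := lq e (k1 e - 1) (by omega) (by omega)
      have b2 := lB _ _ (hk1 e)
      rcases hc2 _ _ (hRarc e _ (qA e (k1 e - 1) (by omega))) (hRarc e _ (qA e _ a1)) hq with h | ⟨e', b, h1, h2⟩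
      · rw [h, b2] at b1
        exact absurd (Option.some.inj b1).symm (hadj e).ne
      · exact ⟨e', b, by rw [h1]; exact b1, by rw [h2]; exact b2⟩
    have hse : s(tl e, hd e) = s(u, v) := hs e
    rcases Sym2.eq_iff.mp hse with ⟨x1, x2⟩ | ⟨x1, x2⟩
    · rw [x1] at h1; rw [x2] at h2; exact ⟨e', b, h1, h2⟩
    · rw [x1] at h1; rw [x2] at h2; exact ⟨e', !b, h2, by rw [Bool.not_not]; exact h1⟩

end Topo
end SN


namespace SN
section Slots
variable {V : Type}

theorem exists_slots {G : SimpleGraph V} (hP : WPlanar G) {B : Set V} {b0 : V} (hb0 : b0 ∈ B) (hCC : CC G B)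
    (hdom : ∀ v, v ∈ B ∨ ∃ b ∈ B, G.Adj v b) :
    ∃ (E : Type) (_ : Finite E) (sl : E × Bool → ℤ) (lab : E × Bool → V), OP sl lab ∧
      (∀ u v, G.Adj u v → ∃ e b, lab (e, b) = u ∧ lab (e, !b) = v) ∧ (∀ v, ∃ d, lab d = v) ∧
      (∀ s, s ∉ B → ∀ d1 d d2, lab d1 = s → lab d2 = s → sl d1 < sl d → sl d < sl d2 → lab d = s) := by
  classical
  obtain ⟨E, hfin, pos, lab, T, hR⟩ := hP
  obtain ⟨d0, hd0⟩ := hR.surj b0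
  have hell : ∀ v, ∃ e : E, v ∉ B → ∃ b, lab (e, b) = v ∧ lab (e, !b) ∈ B := by
    intro v
    rcases hdom v with h | ⟨b, hb, hadj⟩
    · exact ⟨d0.1, fun h' => absurd h h'⟩
    · obtain ⟨e, c, h1, h2⟩ := hR.adj _ _ hadj
      exact ⟨e, fun _ => ⟨c, h1, h2 ▸ hb⟩⟩
  choose ell hell using hell
  let A : Set E := {e | (∀ b, lab (e, b) ∈ B) ∨ ∃ v, v ∉ B ∧ e = ell v}
  have conn : ∀ x, Reach lab A b0 x := by
    have hB : ∀ x ∈ B, Reach lab A b0 x := by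
      intro x hx
      by_contra hcon
      obtain ⟨a, ha, b, hb, h1, h2, h3⟩ := hCC {y | Reach lab A b0 y} ⟨b0, hb0, Reach.refl _⟩ ⟨x, hx, hcon⟩
      obtain ⟨e, c, rfl, rfl⟩ := hR.adj _ _ h3
      refine h2 (Reach.trans (h1 : Reach lab A b0 _) (Reach.edge (A := A) (Or.inl ?_) c (!c)))
      intro b'
      cases b' <;> cases c <;> assumption
    intro x
    by_cases hx : x ∈ B
    · exact hB x hx
    · obtain ⟨b, h1, h2⟩ := hell x hx
      have := Reach.edge (lab := lab) (A := A) (e := ell x) (Or.inr ⟨x, hx, rfl⟩) (!b) b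
      rw [h1] at this
      exact (hB _ h2).trans this
  obtain ⟨C, hCA, hac, hCR⟩ := exists_acyc lab A
  obtain ⟨pos1, T1, hT1, hCT⟩ := forest_ext hac hR.tw
  have hTC : T1 = C := tree_eq hT1 hCT fun d d' =>
    (hCR _ _ (conn (lab d))).symm.trans (hCR _ _ (conn (lab d')))
  subst hTC
  obtain ⟨pos2, hT2, hmin⟩ := rotation hT1 d0
  obtain ⟨sl, hOP, hTs, hms⟩ := onePage hT2
  refine ⟨E, hfin, sl, lab, hOP, hR.adj, hR.surj, ?_⟩
  intro s hs d1 d d2 h1 h2 hlt1 hlt2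
  by_contra hne
  obtain ⟨bs, hbs1, hbs2⟩ := hell s hs
  let C' : Set E := {e | e ∈ T1 ∧ lab (e, false) ≠ s ∧ lab (e, true) ≠ s}
  let φ : V → V := fun x => if x = s then lab (ell s, !bs) else x
  have hb0s : b0 ≠ s := fun h => hs (h ▸ hb0)
  have hreach : Reach lab C' (φ (lab d)) (φ b0) := by
    refine Reach.of_edges (R := fun x y => Reach lab C' (φ x) (φ y))
      ⟨fun _ => Reach.refl _, fun h => h.symm, fun h h' => h.trans h'⟩ ?_
      (hCR _ _ (conn (lab d))).symm
    intro e he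
    by_cases h : lab (e, false) ≠ s ∧ lab (e, true) ≠ s
    · simp only [φ, if_neg h.1, if_neg h.2]
      exact Reach.edge (A := C') ⟨he, h⟩ _ _
    · have hes : e = ell s := by
        rcases hCA he with h' | ⟨v, hv, rfl⟩
        · exfalso; apply h
          exact ⟨fun hh => hs (hh ▸ h' _), fun hh => hs (hh ▸ h' _)⟩
        · obtain ⟨c, hc1, hc2⟩ := hell v hv
          have : v = s := by
            by_contra hvs
            apply h
            have hc2' : lab (ell v, !c) ≠ s := fun hh => hs (hh ▸ hc2)
            have hc1' : lab (ell v, c) ≠ s := fun hh => hvs (hc1 ▸ hh)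
            cases c
            · exact ⟨hc1', hc2'⟩
            · exact ⟨hc2', hc1'⟩
          rw [this]
      subst hes
      have hB' : lab (ell s, !bs) ≠ s := fun hh => hs (hh ▸ hbs2)
      have : ∀ c, φ (lab (ell s, c)) = lab (ell s, !bs) := by
        intro c
        by_cases hc : c = bs
        · subst hc; simp [φ, hbs1]
        · have : c = !bs := by cases c <;> cases bs <;> simp_all
          subst this; simp [φ, hB']
      rw [this, this]
      exact Reach.refl _
  have hφ1 : φ (lab d) = lab d := if_neg hne
  have hφ2 : φ b0 = b0 := if_neg hb0s
  rw [hφ1, hφ2] at hreach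
  have := hOP.inside (T := T1) (fun e he => (hTs e he).imp fun _ h => h.2) h1 h2 (A := C') (fun e he => he) hne hreach
    ⟨d, rfl, hlt1, hlt2⟩ d0 hd0
  have := hms d0 hmin d1
  omega

end Slots
end SN


namespace SN
section Arcs

theorem IsArc.symm {A : Set Pt} {p q : Pt} (h : IsArcBetween A p q) : IsArcBetween A q p := by
  obtain ⟨f, hc, hi, h0, h1, rfl⟩ := h
  have hm : MapsTo (fun s : ℝ => 1 - s) (Icc 0 1) (Icc 0 1) := by
    intro s hs; simp only [mem_Icc] at *; constructor <;> linarith [hs.1, hs.2]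
  refine ⟨fun s => f (1 - s), hc.comp (by fun_prop) hm, ?_, by simp [h1], by simp [h0], ?_⟩
  · intro a ha b hb hab
    have := hi (hm ha) (hm hb) hab
    linarith
  · ext P
    constructor
    · rintro ⟨s, hs, rfl⟩; exact ⟨1 - s, hm hs, by simp⟩
    · rintro ⟨s, hs, rfl⟩; exact ⟨1 - s, hm hs, rfl⟩

theorem IsArc.concat {A A' : Set Pt} {p q r : Pt} (h : IsArcBetween A p q) (h' : IsArcBetween A' q r)
    (hd : ∀ P, P ∈ A → P ∈ A' → P = q) : IsArcBetween (A ∪ A') p r := by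
  obtain ⟨f, hc, hi, h0, h1, rfl⟩ := h
  obtain ⟨g, hc', hi', h0', h1', rfl⟩ := h'
  have hm1 : MapsTo (fun s : ℝ => 2 * s) (Icc 0 (1/2)) (Icc 0 1) := by
    intro s hs; simp only [mem_Icc] at *; constructor <;> linarith [hs.1, hs.2]
  have hm2 : MapsTo (fun s : ℝ => 2 * s - 1) (Icc (1/2) 1) (Icc 0 1) := by
    intro s hs; simp only [mem_Icc] at *; constructor <;> linarith [hs.1, hs.2]
  let F : ℝ → Pt := fun s => if s ≤ 1/2 then f (2 * s) else g (2 * s - 1)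
  have hF1 : ∀ s ∈ Icc (0:ℝ) (1/2), F s = f (2 * s) := fun s hs => if_pos hs.2
  have hF2 : ∀ s ∈ Icc (1/2:ℝ) 1, F s = g (2 * s - 1) := by
    intro s hs
    by_cases h : s ≤ 1/2
    · have : s = 1/2 := le_antisymm h hs.1
      subst this
      simp only [F, le_refl, if_true]
      norm_num [h1, h0']
    · exact if_neg h
  have hU : Icc (0:ℝ) 1 = Icc 0 (1/2) ∪ Icc (1/2) 1 := (Icc_union_Icc_eq_Icc (by norm_num) (by norm_num)).symm
  have hx : ∀ a ∈ Icc (0:ℝ) (1/2), ∀ b ∈ Icc (1/2:ℝ) 1, F a = F b → a = b := by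
    intro a ha b hb hab
    rw [hF1 a ha, hF2 b hb] at hab
    have hq := hd (f (2 * a)) ⟨_, hm1 ha, rfl⟩ (hab ▸ ⟨_, hm2 hb, rfl⟩)
    have e1 := hi (hm1 ha) (by simp : (1:ℝ) ∈ Icc (0:ℝ) 1) (hq.trans h1.symm)
    have e2 := hi' (hm2 hb) (by simp : (0:ℝ) ∈ Icc (0:ℝ) 1) ((hab.symm.trans hq).trans h0'.symm)
    simp only at e1 e2
    linarith
  refine ⟨F, ?_, ?_, ?_, ?_, ?_⟩
  · rw [hU]
    refine ContinuousOn.union_of_isClosed ?_ ?_ isClosed_Icc isClosed_Icc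
    · exact (hc.comp (by fun_prop) hm1).congr hF1
    · exact (hc'.comp (by fun_prop) hm2).congr hF2
  · rw [hU]
    rintro a (ha | ha) b (hb | hb) hab
    · rw [hF1 a ha, hF1 b hb] at hab
      have := hi (hm1 ha) (hm1 hb) hab
      simp only at this; linarith
    · exact hx a ha b hb hab
    · exact (hx b hb a ha hab.symm).symm
    · rw [hF2 a ha, hF2 b hb] at hab
      have := hi' (hm2 ha) (hm2 hb) hab
      simp only at this; linarith
  · rw [hF1 0 (by simp)]; simpa using h0
  · rw [hF2 1 (by norm_num)]; norm_num [h1']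
  · have hFU : F '' Icc (0:ℝ) 1 = F '' Icc (0:ℝ) (1/2) ∪ F '' Icc (1/2:ℝ) 1 := by rw [← image_union, ← hU]
    rw [hFU]
    congr 1
    · ext P; constructor
      · rintro ⟨s, hs, rfl⟩
        have hs' : s / 2 ∈ Icc (0:ℝ) (1/2) := by simp only [mem_Icc] at *; constructor <;> linarith [hs.1, hs.2]
        exact ⟨s / 2, hs', by rw [hF1 _ hs']; congr 1; ring⟩
      · rintro ⟨s, hs, rfl⟩
        exact ⟨2 * s, hm1 hs, (hF1 s hs).symm⟩
    · ext P; constructor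
      · rintro ⟨s, hs, rfl⟩
        have hs' : (s + 1) / 2 ∈ Icc (1/2:ℝ) 1 := by simp only [mem_Icc] at *; constructor <;> linarith [hs.1, hs.2]
        exact ⟨(s + 1) / 2, hs', by rw [hF2 _ hs']; congr 1; ring⟩
      · rintro ⟨s, hs, rfl⟩
        exact ⟨2 * s - 1, hm2 hs, (hF2 s hs).symm⟩

theorem IsArc.map {A : Set Pt} {p q : Pt} (h : IsArcBetween A p q) (φ : Pt ≃ₜ Pt) :
    IsArcBetween (φ '' A) (φ p) (φ q) := by
  obtain ⟨f, hc, hi, rfl, rfl, rfl⟩ := h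
  exact ⟨φ ∘ f, φ.continuous.comp_continuousOn hc, φ.injective.comp_injOn hi, rfl, rfl, (image_comp _ _ _).symm⟩

theorem IsArc.segment {p q : Pt} (h : p ≠ q) : IsArcBetween (segment ℝ p q) p q := by
  refine ⟨fun s => AffineMap.lineMap p q s, (AffineMap.lineMap_continuous).continuousOn, ?_, by simp, by simp, ?_⟩
  · exact fun a _ b _ hab => AffineMap.lineMap_injective ℝ h hab
  · exact segment_eq_image_lineMap ℝ p q

/-- possibly degenerate arcs -/
def Arc' (A : Set Pt) (p q : Pt) : Prop := (p = q ∧ A = {p}) ∨ IsArcBetween A p q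

theorem IsArc.right_mem {A : Set Pt} {p q : Pt} (h : IsArcBetween A p q) : q ∈ A := by
  obtain ⟨f, hc, hi, rfl, rfl, rfl⟩ := h
  exact ⟨1, by simp, rfl⟩

theorem IsArc.left_mem {A : Set Pt} {p q : Pt} (h : IsArcBetween A p q) : p ∈ A := by
  obtain ⟨f, hc, hi, rfl, rfl, rfl⟩ := h
  exact ⟨0, by simp, rfl⟩

theorem arc3 {A A' A'' : Set Pt} {p q r s : Pt} (h : Arc' A p q) (h' : IsArcBetween A' q r) (h'' : Arc' A'' r s)
    (hd : ∀ P, P ∈ A → P ∈ A' → P = q) (hd' : ∀ P, P ∈ A' → P ∈ A'' → P = r) (hd'' : ∀ P, P ∈ A → P ∈ A'' → P = r) :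
    IsArcBetween (A ∪ A' ∪ A'') p s := by
  have h1 : IsArcBetween (A ∪ A') p r := by
    rcases h with ⟨rfl, rfl⟩ | h
    · rw [union_eq_self_of_subset_left (by simpa using IsArc.left_mem h')]; exact h'
    · exact IsArc.concat h h' hd
  rcases h'' with ⟨rfl, rfl⟩ | h''
  · rw [union_eq_self_of_subset_right (by simpa using IsArc.right_mem h1)]; exact h1
  · refine IsArc.concat h1 h'' ?_
    rintro P (hP | hP) hP'
    · exact hd'' P hP hP'
    · exact hd' P hP hP'

/-- image of a drawing under a homeomorphism -/
def PDmap {V : Type} [Fintype V] {G : SimpleGraph V} (Γ : PlanarDrawing G) (φ : Pt ≃ₜ Pt) : PlanarDrawing G where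
  ρ v := φ (Γ.ρ v)
  inj := φ.injective.comp Γ.inj
  arc e := φ '' Γ.arc e
  arc_isArc u v h := IsArc.map (Γ.arc_isArc u v h) φ
  vertex_mem e he w hw := Γ.vertex_mem e he w ((φ.injective.mem_set_image).mp hw)
  arcs_cross e he e' he' hne x hx := by
    obtain ⟨⟨y, hy, rfl⟩, hx2⟩ := hx
    obtain ⟨w, h1, h2, rfl⟩ := Γ.arcs_cross e he e' he' hne y ⟨hy, (φ.injective.mem_set_image).mp hx2⟩
    exact ⟨w, h1, h2, rfl⟩

/-- restriction of a drawing to a subgraph -/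
def PDmono {V : Type} [Fintype V] {G G' : SimpleGraph V} (hle : G ≤ G') (Γ : PlanarDrawing G') : PlanarDrawing G where
  ρ := Γ.ρ
  inj := Γ.inj
  arc := Γ.arc
  arc_isArc u v h := Γ.arc_isArc u v (hle h)
  vertex_mem e he w hw := Γ.vertex_mem e (SimpleGraph.edgeSet_mono hle he) w hw
  arcs_cross e he e' he' hne x hx :=
    Γ.arcs_cross e (SimpleGraph.edgeSet_mono hle he) e' (SimpleGraph.edgeSet_mono hle he') hne x hx

/-- parabola curve -/
def Cv (σ x y : ℝ) : Set Pt := (fun s : ℝ => ((x + s * (y - x), σ * ((y - x) ^ 2 * (s * (1 - s)))) : Pt)) '' Icc 0 1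

theorem Cv_arc {σ x y : ℝ} : Arc' (Cv σ x y) (x, 0) (y, 0) := by
  by_cases h : x = y
  · left
    subst h
    refine ⟨rfl, ?_⟩
    ext P
    simp only [Cv, sub_self, mul_zero, add_zero, mem_image, mem_singleton_iff]
    constructor
    · rintro ⟨s, _, rfl⟩; simp
    · rintro rfl; exact ⟨0, by simp, by simp⟩
  · right
    refine ⟨_, ?_, ?_, ?_, ?_, rfl⟩
    · exact Continuous.continuousOn (by fun_prop)
    · intro a _ b _ hab
      simp only [Prod.mk.injEq] at hab
      have : y - x ≠ 0 := fun h' => h (by linarith)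
      exact mul_right_cancel₀ this (by linarith [hab.1])
    · simp
    · simp

theorem Cv_mem {σ x y : ℝ} {P : Pt} (h : P ∈ Cv σ x y) :
    (P.2 = 0 ∧ (P.1 = x ∨ P.1 = y)) ∨
      (((x < P.1 ∧ P.1 < y) ∨ (y < P.1 ∧ P.1 < x)) ∧ P.2 = σ * ((P.1 - x) * (y - P.1))) := by
  obtain ⟨s, hs, rfl⟩ := h
  simp only
  rcases hs.1.eq_or_lt with h0 | h0
  · left; subst h0; simp
  rcases hs.2.eq_or_lt with h1 | h1
  · left; subst h1; simp
  rcases lt_trichotomy x y with h | h | h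
  · right
    refine ⟨Or.inl ⟨by nlinarith, by nlinarith⟩, by ring⟩
  · left; subst h; simp
  · right
    refine ⟨Or.inr ⟨by nlinarith, by nlinarith⟩, by ring⟩

theorem crv {a b c d t : ℝ} (h1 : a < t) (h2 : t < b) (h3 : c < t) (h4 : t < d)
    (h : (t - a) * (b - t) = (t - c) * (d - t)) :
    (a < c ∧ b < d) ∨ (c < a ∧ d < b) ∨ (a = c ∧ b = d) := by
  rcases lt_trichotomy a c with hac | hac | hac
  · left; refine ⟨hac, ?_⟩; by_contra hh; nlinarith
  · right; right; refine ⟨hac, ?_⟩; subst hac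
    have := mul_left_cancel₀ (by linarith : t - a ≠ 0) h
    linarith
  · right; left; refine ⟨hac, ?_⟩; by_contra hh; nlinarith

theorem Cv_seg (x y : ℝ) : (fun P : Pt => ((P.1, P.2 - P.1 ^ 2) : Pt)) '' Cv (-1) x y = segment ℝ ((x, - x ^ 2) : Pt) (y, - y ^ 2) := by
  rw [segment_eq_image_lineMap, Cv, image_image]
  congr 1
  ext s
  · simp [AffineMap.lineMap_apply]; ring
  · simp [AffineMap.lineMap_apply]; ring

end Arcs
end SN


namespace SN
section BaseDrawing
variable {V : Type}

/-- the shear homeomorphism -/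
def shear : Pt ≃ₜ Pt where
  toFun P := (P.1, P.2 - P.1 ^ 2)
  invFun P := (P.1, P.2 + P.1 ^ 2)
  left_inv P := by ext <;> simp
  right_inv P := by ext <;> simp
  continuous_toFun := by fun_prop
  continuous_invFun := by fun_prop

set_option maxHeartbeats 1000000 in
theorem base_drawing [Fintype V] {G : SimpleGraph V} {E : Type} {sl : E × Bool → ℤ} {lab : E × Bool → V}
    (hOP : OP sl lab) (hadj : ∀ u v, G.Adj u v → ∃ e b, lab (e, b) = u ∧ lab (e, !b) = v)
    (hsurj : ∀ v, ∃ d, lab d = v) {S : Set V}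
    (hcont : ∀ s ∈ S, ∀ d1 d d2, lab d1 = s → lab d2 = s → sl d1 < sl d → sl d < sl d2 → lab d = s) :
    ∃ Γ : PlanarDrawing G, ∃ x : V → ℝ, Function.Injective x ∧ (∀ v, Γ.ρ v = (x v, - (x v) ^ 2)) ∧
      (∀ u ∈ S, ∀ v ∈ S, G.Adj u v → Γ.arc s(u, v) = segment ℝ ((x u, - (x u) ^ 2) : Pt) (x v, - (x v) ^ 2)) ∧
      (∀ a ∈ S, ∀ b ∈ S, ∀ c ∈ S, ∀ d ∈ S, x a < x b → x b < x c → x c < x d → G.Adj a c → G.Adj b d → False) := by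
  classical
  choose m hm using hsurj
  let σ : E × Bool → E × Bool := fun d => if lab d ∈ S then m (lab d) else d
  have hσ1 : ∀ d, lab d ∈ S → σ d = m (lab d) := fun d h => if_pos h
  have hσ2 : ∀ d, lab d ∉ S → σ d = d := fun d h => if_neg h
  have hσl : ∀ d, lab (σ d) = lab d := by
    intro d
    by_cases h : lab d ∈ S
    · rw [hσ1 d h, hm]
    · rw [hσ2 d h]
  have mono : ∀ d d', sl d < sl d' → sl (σ d) ≤ sl (σ d') := by
    intro d d' hlt
    by_contra hcon
    push Not at hcon
    by_cases hl : lab d = lab d'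
    · by_cases h : lab d ∈ S
      · rw [hσ1 d h, hσ1 d' (hl ▸ h), hl] at hcon; omega
      · rw [hσ2 d h, hσ2 d' (hl ▸ h)] at hcon; omega
    · by_cases h : lab d' ∈ S
      · have h1 : ¬ sl (σ d') < sl d := fun hh => hl (hcont _ h _ _ _ (hσl d') rfl hh hlt)
        by_cases h' : lab d ∈ S
        · have h2 : ¬ sl d < sl (σ d') := fun hh =>
            hl ((hσl d').symm.trans (hcont _ h' _ _ _ rfl (hσl d) hh hcon)).symm
          have h3 : sl d = sl (σ d') := by omega
          exact hl ((congrArg lab (hOP.inj h3)).trans (hσl d'))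
        · rw [hσ2 d h'] at hcon; exact h1 hcon
      · rw [hσ2 d' h] at hcon
        by_cases h' : lab d ∈ S
        · exact hl (hcont _ h' _ _ _ rfl (hσl d) hlt hcon).symm
        · rw [hσ2 d h'] at hcon; omega
  have mono' : ∀ d d', sl (σ d) < sl (σ d') → sl d < sl d' := by
    intro d d' h
    by_contra hcon
    rcases (by omega : sl d' < sl d ∨ sl d = sl d') with h1 | h1
    · have := mono _ _ h1; omega
    · rw [hOP.inj h1] at h; omega
  let x : V → ℝ := fun v => (sl (m v) : ℝ)
  let τ : E × Bool → ℝ := fun d => (sl (σ d) : ℝ)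
  have sl_inj : ∀ d d', (sl d : ℝ) = sl d' → d = d' := fun d d' h => hOP.inj (by exact_mod_cast h)
  have xinj : Function.Injective x := by
    intro u v h
    rw [← hm u, ← hm v, sl_inj _ _ h]
  have xτ : ∀ u d, x u = τ d → u = lab d := by
    intro u d h
    rw [← hm u, sl_inj _ _ h, hσl]
  have ττ : ∀ d d', τ d = τ d' → lab d = lab d' := by
    intro d d' h
    rw [← hσl d, ← hσl d', sl_inj _ _ h]
  have τlt : ∀ d d', τ d < τ d' → sl (σ d) < sl (σ d') := fun d d' h => Int.cast_lt.mp h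
  have xS : ∀ d, lab d ∈ S → τ d = x (lab d) := by
    intro d h; simp only [τ, x, hσ1 d h]
  let Up : E × Bool → Set Pt := fun d => Cv 1 (x (lab d)) (τ d)
  let Lo : E → Set Pt := fun g => Cv (-1) (τ (g, false)) (τ (g, true))
  let Arc : E → Set Pt := fun g => Up (g, false) ∪ Lo g ∪ Cv 1 (τ (g, true)) (x (lab (g, true)))
  have Cv_comm : ∀ a b c, Cv a b c = Cv a c b := by
    intro a b c
    ext P; constructor
    · rintro ⟨s, hs, rfl⟩; exact ⟨1 - s, by simp only [mem_Icc] at *; constructor <;> linarith, by simp only [Prod.mk.injEq]; constructor <;> ring⟩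
    · rintro ⟨s, hs, rfl⟩; exact ⟨1 - s, by simp only [mem_Icc] at *; constructor <;> linarith, by simp only [Prod.mk.injEq]; constructor <;> ring⟩
  have ArcE : ∀ g, Arc g = Up (g, false) ∪ Lo g ∪ Up (g, true) := by
    intro g; simp only [Arc, Up]; rw [Cv_comm 1 (τ (g, true))]
  -- up parts
  have upup : ∀ d d', d ≠ d' → ∀ P : Pt, P ∈ Up d → P ∈ Up d' → P.2 = 0 := by
    intro d d' hne P hP hP'
    by_contra h0
    rcases Cv_mem hP with ⟨h, _⟩ | ⟨h1, h2⟩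
    · exact h0 h
    rcases Cv_mem hP' with ⟨h, _⟩ | ⟨h1', h2'⟩
    · exact h0 h
    have nS : ∀ d, ((x (lab d) < P.1 ∧ P.1 < τ d) ∨ (τ d < P.1 ∧ P.1 < x (lab d))) → σ d = d := by
      intro d h
      apply hσ2
      intro hS
      rw [xS d hS] at h
      rcases h with h | h <;> linarith [h.1, h.2]
    have e1 := nS d h1
    have e2 := nS d' h1'
    have hτ : τ d = sl d := by simp only [τ, e1]
    have hτ' : τ d' = sl d' := by simp only [τ, e2]
    rw [hτ] at h1 h2
    rw [hτ'] at h1' h2'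
    have heq : (P.1 - x (lab d)) * ((sl d : ℝ) - P.1) = (P.1 - x (lab d')) * ((sl d' : ℝ) - P.1) := by linarith
    by_cases hl : lab d = lab d'
    · rw [hl] at heq
      have : P.1 - x (lab d') ≠ 0 := by
        intro h
        rcases h1' with h' | h' <;> linarith [h'.1, h'.2]
      have := mul_left_cancel₀ this heq
      exact hne (sl_inj _ _ (by linarith))
    · have key : ∀ d1 d2 d3 d4 : E × Bool, lab d1 = lab d2 → lab d3 = lab d4 → lab d1 ≠ lab d3 →
          (sl d1 : ℝ) < P.1 → P.1 < sl d2 → (sl d3 : ℝ) < P.1 → P.1 < sl d4 →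
          (P.1 - sl d1) * (sl d2 - P.1) = (P.1 - sl d3) * (sl d4 - P.1) → False := by
        intro d1 d2 d3 d4 l1 l2 l3 a1 a2 a3 a4 a5
        rcases crv a1 a2 a3 a4 a5 with ⟨c1, c2⟩ | ⟨c1, c2⟩ | ⟨c1, c2⟩
        · have c3 : (sl d3 : ℝ) < sl d2 := a3.trans a2
          exact l3 ((hOP.ncl d1 d3 d2 d4 (by exact_mod_cast c1) (by exact_mod_cast c3) (by exact_mod_cast c2) l1 l2))
        · have c3 : (sl d1 : ℝ) < sl d4 := a1.trans a4
          exact l3 ((hOP.ncl d3 d1 d4 d2 (by exact_mod_cast c1) (by exact_mod_cast c3) (by exact_mod_cast c2) l2 l1)).symm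
        · exact l3 (congrArg lab (sl_inj _ _ c1))
      have n1 := hm (lab d)
      have n2 := hm (lab d')
      rcases h1 with ⟨p1, p2⟩ | ⟨p1, p2⟩ <;> rcases h1' with ⟨q1, q2⟩ | ⟨q1, q2⟩
      · exact key _ _ _ _ n1 n2 (by rw [n1, n2]; exact hl) p1 p2 q1 q2 heq
      · exact key _ _ _ _ n1 n2.symm (by rw [n1]; exact hl) p1 p2 q1 q2 (by simp only [x] at heq; linarith)
      · exact key _ _ _ _ n1.symm n2 (by rw [n2]; exact hl) p1 p2 q1 q2 (by simp only [x] at heq; linarith)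
      · exact key _ _ _ _ n1.symm n2.symm hl p1 p2 q1 q2 (by simp only [x] at heq; linarith)
  have up_nonneg : ∀ d, ∀ P : Pt, P ∈ Up d → 0 ≤ P.2 := by
    rintro d P ⟨s, hs, rfl⟩
    have := mul_nonneg hs.1 (sub_nonneg.2 hs.2)
    simp only
    positivity
  have lo_nonpos : ∀ g, ∀ P : Pt, P ∈ Lo g → P.2 ≤ 0 := by
    rintro g P ⟨s, hs, rfl⟩
    have := mul_nonneg hs.1 (sub_nonneg.2 hs.2)
    have : 0 ≤ (τ (g, true) - τ (g, false)) ^ 2 * (s * (1 - s)) := by positivity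
    simp only; linarith
  have up0 : ∀ d, ∀ P : Pt, P ∈ Up d → P.2 = 0 → P.1 = x (lab d) ∨ P.1 = τ d := by
    intro d P hP h0
    rcases Cv_mem hP with ⟨h, h'⟩ | ⟨h1, h2⟩
    · exact h'
    · exfalso
      rw [h0] at h2
      rcases h1 with ⟨h1, h3⟩ | ⟨h1, h3⟩
      · nlinarith [mul_pos (sub_pos.2 h1) (sub_pos.2 h3)]
      · nlinarith [mul_pos (sub_pos.2 h1) (sub_pos.2 h3)]
  have lo0 : ∀ g, ∀ P : Pt, P ∈ Lo g → P.2 = 0 → P.1 = τ (g, false) ∨ P.1 = τ (g, true) := by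
    intro d P hP h0
    rcases Cv_mem hP with ⟨h, h'⟩ | ⟨h1, h2⟩
    · exact h'
    · exfalso
      rw [h0] at h2
      rcases h1 with ⟨h1, h3⟩ | ⟨h1, h3⟩
      · nlinarith [mul_pos (sub_pos.2 h1) (sub_pos.2 h3)]
      · nlinarith [mul_pos (sub_pos.2 h1) (sub_pos.2 h3)]
  have nocross : ∀ g g' c c', g ≠ g' → sl (σ (g, c)) < sl (σ (g', c')) → sl (σ (g', c')) < sl (σ (g, !c)) →
      sl (σ (g, !c)) < sl (σ (g', !c')) → False := by
    intro g g' c c' hne h1 h2 h3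
    have k1 := mono' _ _ h1
    have k2 := mono' _ _ h2
    have k3 := mono' _ _ h3
    have := hOP.nce g g' c c' hne k1 k2
    omega
  have lolo : ∀ g g', g ≠ g' → s(lab (g, false), lab (g, true)) ≠ s(lab (g', false), lab (g', true)) →
      ∀ P : Pt, P ∈ Lo g → P ∈ Lo g' → P.2 = 0 := by
    intro g g' hne hs P hP hP'
    by_contra h0
    rcases Cv_mem hP with ⟨h, _⟩ | ⟨h1, h2⟩
    · exact h0 h
    rcases Cv_mem hP' with ⟨h, _⟩ | ⟨h1', h2'⟩
    · exact h0 h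
    have heq : (P.1 - τ (g, false)) * (τ (g, true) - P.1) = (P.1 - τ (g', false)) * (τ (g', true) - P.1) := by linarith
    have hs' : ∀ c c', s(lab (g, c), lab (g, !c)) ≠ s(lab (g', c'), lab (g', !c')) := by
      intro c c'
      cases c <;> cases c' <;> simp only [Bool.not_false, Bool.not_true]
      · exact hs
      · rw [Sym2.eq_swap (a := lab (g', true))]; exact hs
      · rw [Sym2.eq_swap (a := lab (g, true))]; exact hs
      · rw [Sym2.eq_swap (a := lab (g', true)), Sym2.eq_swap (a := lab (g, true))]; exact hs
    have key : ∀ c c', τ (g, c) < P.1 → P.1 < τ (g, !c) → τ (g', c') < P.1 → P.1 < τ (g', !c') →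
        (P.1 - τ (g, c)) * (τ (g, !c) - P.1) = (P.1 - τ (g', c')) * (τ (g', !c') - P.1) → False := by
      intro c c' a1 a2 a3 a4 a5
      rcases crv a1 a2 a3 a4 a5 with ⟨c1, c2⟩ | ⟨c1, c2⟩ | ⟨c1, c2⟩
      · have c3 := a3.trans a2
        exact nocross g g' c c' hne (τlt _ _ c1) (τlt _ _ c3) (τlt _ _ c2)
      · have c3 := a1.trans a4
        exact nocross g' g c' c hne.symm (τlt _ _ c1) (τlt _ _ c3) (τlt _ _ c2)
      · apply hs' c c'
        rw [ττ _ _ c1, ττ _ _ c2]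
    rcases h1 with ⟨p1, p2⟩ | ⟨p1, p2⟩ <;> rcases h1' with ⟨q1, q2⟩ | ⟨q1, q2⟩
    · exact key false false p1 p2 q1 q2 heq
    · exact key false true p1 p2 q1 q2 (by simp only [Bool.not_false, Bool.not_true]; linarith)
    · exact key true false p1 p2 q1 q2 (by simp only [Bool.not_false, Bool.not_true]; linarith)
    · exact key true true p1 p2 q1 q2 (by simp only [Bool.not_true]; linarith)
  -- zero points of arcs
  have arc0 : ∀ g, ∀ P : Pt, P ∈ Arc g → P.2 = 0 → ∃ c, P.1 = x (lab (g, c)) ∨ P.1 = τ (g, c) := by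
    intro g P hP h0
    rw [ArcE] at hP
    rcases hP with (hP | hP) | hP
    · exact ⟨_, up0 _ _ hP h0⟩
    · rcases lo0 _ _ hP h0 with h | h
      · exact ⟨_, Or.inr h⟩
      · exact ⟨_, Or.inr h⟩
    · exact ⟨_, up0 _ _ hP h0⟩
  have arcarc : ∀ g g', g ≠ g' → s(lab (g, false), lab (g, true)) ≠ s(lab (g', false), lab (g', true)) →
      ∀ P : Pt, P ∈ Arc g → P ∈ Arc g' → P.2 = 0 := by
    intro g g' hne hs P hP hP'
    rw [ArcE] at hP hP'
    have hdne : ∀ c c' : Bool, (g, c) ≠ (g', c') := fun c c' h => hne (congrArg Prod.fst h)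
    rcases hP with (hP | hP) | hP <;> rcases hP' with (hP' | hP') | hP'
    · exact upup _ _ (hdne _ _) _ hP hP'
    · exact le_antisymm (lo_nonpos _ _ hP') (up_nonneg _ _ hP)
    · exact upup _ _ (hdne _ _) _ hP hP'
    · exact le_antisymm (lo_nonpos _ _ hP) (up_nonneg _ _ hP')
    · exact lolo _ _ hne hs _ hP hP'
    · exact le_antisymm (lo_nonpos _ _ hP) (up_nonneg _ _ hP')
    · exact upup _ _ (hdne _ _) _ hP hP'
    · exact le_antisymm (lo_nonpos _ _ hP') (up_nonneg _ _ hP)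
    · exact upup _ _ (hdne _ _) _ hP hP'
  have isarc : ∀ g, lab (g, false) ≠ lab (g, true) →
      IsArcBetween (Arc g) (x (lab (g, false)), 0) (x (lab (g, true)), 0) := by
    intro g hne
    have hττ : τ (g, false) ≠ τ (g, true) := fun h => hne (ττ _ _ h)
    have hLo : IsArcBetween (Lo g) (τ (g, false), 0) (τ (g, true), 0) := by
      rcases Cv_arc (σ := -1) (x := τ (g, false)) (y := τ (g, true)) with h | h
      · exact absurd (congrArg Prod.fst h.1) hττ
      · exact h
    refine arc3 Cv_arc hLo Cv_arc ?_ ?_ ?_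
    · intro P hP hP'
      have h0 := le_antisymm (lo_nonpos _ _ hP') (up_nonneg _ _ hP)
      ext
      · rcases up0 _ _ hP h0 with h | h
        · rcases lo0 _ _ hP' h0 with h' | h'
          · exact h'
          · exact absurd (xτ _ _ (h.symm.trans h')) hne
        · exact h
      · exact h0
    · intro P hP' hP
      rw [Cv_comm] at hP
      have h0 := le_antisymm (lo_nonpos _ _ hP') (up_nonneg _ _ hP)
      ext
      · rcases up0 _ _ hP h0 with h | h
        · rcases lo0 _ _ hP' h0 with h' | h'
          · exact absurd (xτ _ _ (h.symm.trans h')).symm hne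
          · exact h'
        · exact h
      · exact h0
    · intro P hP hP'
      rw [Cv_comm] at hP'
      have h0 := upup (g, false) (g, true) (by simp) P hP hP'
      ext
      · rcases up0 _ _ hP' h0 with h | h
        · rcases up0 _ _ hP h0 with h' | h'
          · exact absurd (xinj (h'.symm.trans h)) hne
          · exact absurd (xτ _ _ (h.symm.trans h')).symm hne
        · exact h
      · exact h0
  -- choose representatives
  have hrep : ∀ e : Sym2 V, ∃ g : Option E, e ∈ G.edgeSet → ∃ g', g = some g' ∧ s(lab (g', false), lab (g', true)) = e := by
    intro e
    induction e using Sym2.ind with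
    | _ u v =>
      by_cases h : G.Adj u v
      · obtain ⟨g, b, h1, h2⟩ := hadj u v h
        refine ⟨some g, fun _ => ⟨g, rfl, ?_⟩⟩
        cases b
        · rw [h1]; rw [Bool.not_false] at h2; rw [h2]
        · rw [h1]; rw [Bool.not_true] at h2; rw [h2, Sym2.eq_swap]
      · exact ⟨none, fun h' => absurd h' h⟩
  choose rep hrep using hrep
  let arc : Sym2 V → Set Pt := fun e => match rep e with
    | some g => Arc g
    | none => ∅
  have harc : ∀ e ∈ G.edgeSet, ∃ g, arc e = Arc g ∧ s(lab (g, false), lab (g, true)) = e := by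
    intro e he
    obtain ⟨g, h1, h2⟩ := hrep e he
    exact ⟨g, by simp only [arc, h1], h2⟩
  have hmem : ∀ g c, lab (g, c) ∈ s(lab (g, false), lab (g, true)) := by
    intro g c; cases c <;> simp
  let Γ0 : PlanarDrawing G :=
    { ρ := fun v => (x v, 0)
      inj := fun u v h => xinj (congrArg Prod.fst h)
      arc := arc
      arc_isArc := by
        intro u v huv
        obtain ⟨g, h1, h2⟩ := harc s(u, v) huv
        rw [h1]
        rcases Sym2.eq_iff.mp h2 with ⟨rfl, rfl⟩ | ⟨rfl, rfl⟩
        · exact isarc g huv.ne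
        · exact IsArc.symm (isarc g huv.ne.symm)
      vertex_mem := by
        intro e he w hw
        obtain ⟨g, h1, rfl⟩ := harc e he
        rw [h1] at hw
        obtain ⟨c, h | h⟩ := arc0 g _ hw rfl
        · rw [xinj h]; exact hmem g c
        · rw [xτ _ _ h]; exact hmem g c
      arcs_cross := by
        intro e he e' he' hne P ⟨hP, hP'⟩
        obtain ⟨g, h1, rfl⟩ := harc e he
        obtain ⟨g', h1', rfl⟩ := harc e' he'
        rw [h1] at hP
        rw [h1'] at hP'
        have hgg : g ≠ g' := fun h => hne (by rw [h])
        have h0 := arcarc g g' hgg hne P hP hP'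
        obtain ⟨c, h⟩ := arc0 g P hP h0
        obtain ⟨c', h'⟩ := arc0 g' P hP' h0
        have hx : ∀ g c, P.1 = x (lab (g, c)) → P = (x (lab (g, c)), 0) := fun g c h => Prod.ext h h0
        rcases h with h | h <;> rcases h' with h' | h'
        · refine ⟨lab (g, c), hmem g c, ?_, hx _ _ h⟩
          rw [xinj (h.symm.trans h')]; exact hmem g' c'
        · refine ⟨lab (g, c), hmem g c, ?_, hx _ _ h⟩
          rw [xτ _ _ (h.symm.trans h')]; exact hmem g' c'
        · refine ⟨lab (g', c'), ?_, hmem g' c', hx _ _ h'⟩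
          rw [xτ _ _ (h'.symm.trans h)]; exact hmem g c
        · have hl := ττ _ _ (h.symm.trans h')
          by_cases hS : lab (g, c) ∈ S
          · rw [xS _ hS] at h
            refine ⟨lab (g, c), hmem g c, ?_, hx _ _ h⟩
            rw [hl]; exact hmem g' c'
          · exfalso
            have := sl_inj _ _ (h.symm.trans h')
            rw [hσ2 _ hS, hσ2 _ (hl ▸ hS)] at this
            exact hgg (congrArg Prod.fst this) }
  refine ⟨PDmap Γ0 shear, x, xinj, ?_, ?_, ?_⟩
  · intro v
    simp only [PDmap, shear, Γ0, Homeomorph.homeomorph_mk_coe, Equiv.coe_fn_mk, zero_sub]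
  · intro u hu v hv huv
    obtain ⟨g, h1, h2⟩ := harc s(u, v) huv
    have hgS : ∀ c, lab (g, c) ∈ S := by
      rcases Sym2.eq_iff.mp h2 with ⟨rfl, rfl⟩ | ⟨rfl, rfl⟩ <;> intro c <;> cases c <;> assumption
    have hne : lab (g, false) ≠ lab (g, true) := by
      rcases Sym2.eq_iff.mp h2 with ⟨rfl, rfl⟩ | ⟨rfl, rfl⟩
      · exact huv.ne
      · exact huv.ne.symm
    have hA : Arc g = Cv (-1) (x (lab (g, false))) (x (lab (g, true))) := by
      have hc1 : ∀ a, Cv 1 a a = {((a, 0) : Pt)} := by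
        intro a
        rcases Cv_arc (σ := 1) (x := a) (y := a) with h | h
        · exact h.2
        · obtain ⟨f, _, hi, e0, e1, _⟩ := h
          exact absurd (hi (by simp) (by simp) (e0.trans e1.symm)) zero_ne_one
      have hl := Cv_arc (σ := -1) (x := x (lab (g, false))) (y := x (lab (g, true)))
      have hl' : IsArcBetween (Cv (-1) (x (lab (g, false))) (x (lab (g, true)))) (x (lab (g, false)), 0) (x (lab (g, true)), 0) := by
        rcases hl with h | h
        · exact absurd (xinj (congrArg Prod.fst h.1)) hne
        · exact h
      simp only [Arc, Up, Lo]
      rw [xS _ (hgS false), xS _ (hgS true), hc1, hc1]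
      rw [union_eq_self_of_subset_left (singleton_subset_iff.mpr (IsArc.left_mem hl')),
        union_eq_self_of_subset_right (singleton_subset_iff.mpr (IsArc.right_mem hl'))]
    change shear '' arc s(u, v) = _
    rw [h1, hA]
    have := Cv_seg (x (lab (g, false))) (x (lab (g, true)))
    refine Eq.trans this ?_
    rcases Sym2.eq_iff.mp h2 with ⟨e1, e2⟩ | ⟨e1, e2⟩
    · rw [e1, e2]
    · rw [e1, e2, segment_symm]
  · intro a ha b hb c hc d hd hab hbc hcd h1 h2
    obtain ⟨g, i, rfl, rfl⟩ := hadj _ _ h1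
    obtain ⟨g', i', rfl, rfl⟩ := hadj _ _ h2
    rw [← xS _ ha, ← xS _ hb] at hab
    rw [← xS _ hb, ← xS _ hc] at hbc
    rw [← xS _ hc, ← xS _ hd] at hcd
    have hgg : g ≠ g' := by
      rintro rfl
      by_cases hi : i = i'
      · subst hi; exact lt_irrefl _ hab
      · have : i' = !i := Bool.eq_not_of_ne (Ne.symm hi)
        subst this; exact lt_irrefl _ hbc
    exact nocross g g' i i' hgg (τlt _ _ hab) (τlt _ _ hbc) (τlt _ _ hcd)

end BaseDrawing
end SN


namespace SN
section Move

/-- affine functionals -/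
abbrev Fn : Type := ℝ × ℝ × ℝ

def ev (l : Fn) (P : Pt) : ℝ := l.1 * P.1 + l.2.1 * P.2 + l.2.2

theorem ev_cont (l : Fn) : Continuous (ev l) := by unfold ev; fun_prop

theorem ev_comb (l : Fn) (p q : Pt) (s : ℝ) : ev l ((1 - s) • p + s • q) = (1 - s) * ev l p + s * ev l q := by
  simp only [ev, Prod.fst_add, Prod.snd_add, Prod.smul_fst, Prod.smul_snd, smul_eq_mul]; ring

/-- the functional of an oriented line -/
def lf (a b : Pt) : Fn := (-(b.2 - a.2), b.1 - a.1, (b.2 - a.2) * a.1 - (b.1 - a.1) * a.2)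

theorem ev_lf (a b P : Pt) : ev (lf a b) P = dt a b P := by simp only [ev, lf, dt]; ring

def ng (l : Fn) : Fn := (-l.1, -l.2.1, -l.2.2)

theorem ev_ng (l : Fn) (P : Pt) : ev (ng l) P = - ev l P := by simp only [ev, ng]; ring

def InK (K : List Fn) (P : Pt) : Prop := ∀ l ∈ K, 0 < ev l P

noncomputable def mu : List Fn → Pt → Pt → ℝ
  | [], _, _ => 1
  | l :: K, x, P => min (ev l P / ev l x) (mu K x P)

theorem mu_cont (K : List Fn) (x : Pt) : Continuous (mu K x) := by
  induction K with
  | nil => exact continuous_const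
  | cons l K ih => exact ((ev_cont l).div_const _).min ih

theorem mu_le_one (K : List Fn) (x P : Pt) : mu K x P ≤ 1 := by
  induction K with
  | nil => exact le_rfl
  | cons l K ih => exact (min_le_right _ _).trans ih

theorem mu_le (K : List Fn) (x P : Pt) : ∀ l ∈ K, mu K x P ≤ ev l P / ev l x := by
  induction K with
  | nil => simp
  | cons l K ih =>
    intro l' hl'
    rcases List.mem_cons.mp hl' with rfl | h
    · exact min_le_left _ _
    · exact (min_le_right _ _).trans (ih _ h)

theorem mu_att (K : List Fn) (x P : Pt) : mu K x P = 1 ∨ ∃ l ∈ K, mu K x P = ev l P / ev l x := by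
  induction K with
  | nil => exact Or.inl rfl
  | cons l K ih =>
    rcases min_choice (ev l P / ev l x) (mu K x P) with h | h
    · exact Or.inr ⟨l, by simp, h⟩
    · rcases ih with h' | ⟨l', hl', h'⟩
      · exact Or.inl (h.trans h')
      · exact Or.inr ⟨l', List.mem_cons_of_mem _ hl', h.trans h'⟩

theorem mu_eq {K : List Fn} {x P : Pt} {m : ℝ} (h1 : m ≤ 1) (h2 : ∀ l ∈ K, m ≤ ev l P / ev l x)
    (h3 : m = 1 ∨ ∃ l ∈ K, m = ev l P / ev l x) : mu K x P = m := by
  apply le_antisymm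
  · rcases h3 with h3 | ⟨l, hl, h3⟩
    · rw [h3]; exact mu_le_one K x P
    · rw [h3]; exact mu_le K x P l hl
  · rcases mu_att K x P with h | ⟨l, hl, h⟩
    · rw [h]; exact h1
    · rw [h]; exact h2 l hl

noncomputable def mv (K : List Fn) (x y P : Pt) : Pt := P + max 0 (mu K x P) • (y - x)

theorem mv_cont (K : List Fn) (x y : Pt) : Continuous (mv K x y) :=
  continuous_id.add ((continuous_const.max (mu_cont K x)).smul continuous_const)

theorem mu_nonpos {K : List Fn} {x P : Pt} (hx : InK K x) : mu K x P ≤ 0 ↔ ¬ InK K P := by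
  constructor
  · intro h hP
    rcases mu_att K x P with h' | ⟨l, hl, h'⟩
    · linarith
    · have := div_pos (hP l hl) (hx l hl); linarith
  · intro h
    simp only [InK, not_forall] at h
    obtain ⟨l, hl, h⟩ := h
    exact (mu_le K x P l hl).trans (div_nonpos_of_nonpos_of_nonneg (not_lt.mp h) (hx l hl).le)

theorem mv_id {K : List Fn} {x y P : Pt} (hx : InK K x) (hP : ¬ InK K P) : mv K x y P = P := by
  rw [mv, max_eq_left ((mu_nonpos hx).mpr hP), zero_smul, add_zero]

theorem ev_add_smul (l : Fn) (P x y : Pt) (m : ℝ) : ev l (P + m • (y - x)) = ev l P + m * (ev l y - ev l x) := by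
  simp only [ev, Prod.fst_add, Prod.snd_add, Prod.smul_fst, Prod.smul_snd, smul_eq_mul, Prod.fst_sub, Prod.snd_sub]; ring

theorem mv_inv {K : List Fn} {x y : Pt} (hx : InK K x) (hy : InK K y) (P : Pt) : mv K y x (mv K x y P) = P := by
  by_cases hP : InK K P
  · have hpos : 0 < mu K x P := by
      by_contra h
      exact (mu_nonpos hx).mp (not_lt.mp h) hP
    have h1 : mv K x y P = P + mu K x P • (y - x) := by rw [mv, max_eq_right hpos.le]
    have h2 : mu K y (mv K x y P) = mu K x P := by
      rw [h1]
      apply mu_eq (mu_le_one K x P)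
      · intro l hl
        rw [ev_add_smul, le_div_iff₀ (hy l hl)]
        have := mu_le K x P l hl
        rw [le_div_iff₀ (hx l hl)] at this
        nlinarith
      · rcases mu_att K x P with h | ⟨l, hl, h⟩
        · exact Or.inl h
        · right
          refine ⟨l, hl, ?_⟩
          rw [ev_add_smul, eq_div_iff (hy l hl).ne']
          rw [eq_div_iff (hx l hl).ne'] at h
          nlinarith
    rw [mv, h2, max_eq_right hpos.le, h1]
    rw [add_assoc, ← smul_add]; simp
  · rw [mv_id hx hP, mv_id hy hP]

noncomputable def mvH (K : List Fn) (x y : Pt) (hx : InK K x) (hy : InK K y) : Pt ≃ₜ Pt where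
  toFun := mv K x y
  invFun := mv K y x
  left_inv := mv_inv hx hy
  right_inv := mv_inv hy hx
  continuous_toFun := mv_cont K x y
  continuous_invFun := mv_cont K y x

/-- affine predicate -/
def Aff (f : Pt → Pt) : Prop := ∀ (p q : Pt) (s : ℝ), f ((1 - s) • p + s • q) = (1 - s) • f p + s • f q

theorem Aff.comp {f g : Pt → Pt} (hf : Aff f) (hg : Aff g) : Aff (f ∘ g) := by
  intro p q s; simp only [Function.comp]; rw [hg, hf]

noncomputable def cen (a b c : Pt) : Pt := (1/3 : ℝ) • (a + b + c)

theorem Aff.cen {f : Pt → Pt} (hf : Aff f) (a b c : Pt) : f (cen a b c) = cen (f a) (f b) (f c) := by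
  have h1 := hf a b (1/2)
  have h2 := hf ((1 - (1/2 : ℝ)) • a + (1/2 : ℝ) • b) c (1/3)
  have e1 : SN.cen a b c = (1 - (1/3 : ℝ)) • ((1 - (1/2 : ℝ)) • a + (1/2 : ℝ) • b) + (1/3 : ℝ) • c := by
    ext <;> simp [SN.cen] <;> ring
  rw [e1, h2, h1]
  ext <;> simp [SN.cen] <;> ring

theorem seg_eq (p q : Pt) : segment ℝ p q = (fun s : ℝ => (1 - s) • p + s • q) '' Icc 0 1 := segment_eq_image ℝ p q

theorem Aff.seg {f : Pt → Pt} (hf : Aff f) (p q : Pt) : f '' segment ℝ p q = segment ℝ (f p) (f q) := by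
  rw [seg_eq, seg_eq, image_image]
  congr 1
  ext1 s
  exact hf p q s

theorem Aff.convex {f : Pt → Pt} (hf : Aff f) {C : Set Pt} (hC : Convex ℝ C) : Convex ℝ (f ⁻¹' C) := by
  rw [convex_iff_segment_subset] at *
  intro p hp q hq P hP
  refine hC hp hq ?_
  rw [← hf.seg]
  exact ⟨P, hP, rfl⟩

def Tr (a b c : Pt) : Set Pt := convexHull ℝ {a, b, c}

theorem Tr_convex (a b c : Pt) : Convex ℝ (Tr a b c) := convex_convexHull ℝ _
theorem Tr_a (a b c : Pt) : a ∈ Tr a b c := subset_convexHull ℝ _ (by simp)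
theorem Tr_b (a b c : Pt) : b ∈ Tr a b c := subset_convexHull ℝ _ (by simp)
theorem Tr_c (a b c : Pt) : c ∈ Tr a b c := subset_convexHull ℝ _ (by simp)
theorem Tr_min {a b c : Pt} {C : Set Pt} (hC : Convex ℝ C) (ha : a ∈ C) (hb : b ∈ C) (hc : c ∈ C) : Tr a b c ⊆ C := by
  refine convexHull_min ?_ hC
  rintro P (rfl | rfl | rfl) <;> assumption

theorem ev_convex (l : Fn) : Convex ℝ {P | 0 ≤ ev l P} := by
  rw [convex_iff_segment_subset]
  intro p hp q hq P hP
  rw [seg_eq] at hP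
  obtain ⟨s, hs, rfl⟩ := hP
  simp only [mem_ofPred_eq] at *
  rw [ev_comb]
  have := mul_nonneg (sub_nonneg.mpr hs.2) hp
  have := mul_nonneg hs.1 hq
  linarith

theorem cen_mem (a b c : Pt) : cen a b c ∈ Tr a b c := by
  have e1 : SN.cen a b c = (1 - (1/3 : ℝ)) • ((1 - (1/2 : ℝ)) • a + (1/2 : ℝ) • b) + (1/3 : ℝ) • c := by
    ext <;> simp [SN.cen] <;> ring
  rw [e1]
  have hc := Tr_convex a b c
  exact hc (hc (Tr_a a b c) (Tr_b a b c) (by norm_num) (by norm_num) (by norm_num)) (Tr_c a b c) (by norm_num) (by norm_num) (by norm_num)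

theorem ev_cen (l : Fn) (a b c : Pt) : ev l (cen a b c) = (ev l a + ev l b + ev l c) / 3 := by
  simp only [ev, cen, Prod.fst_add, Prod.snd_add, Prod.smul_fst, Prod.smul_snd, smul_eq_mul]; ring

/-- linear combination of functionals -/
def lc (s t : ℝ) (l m : Fn) : Fn := (s * l.1 + t * m.1, s * l.2.1 + t * m.2.1, s * l.2.2 + t * m.2.2)
theorem ev_lc (s t : ℝ) (l m : Fn) (P : Pt) : ev (lc s t l m) P = s * ev l P + t * ev m P := by
  simp only [ev, lc]; ring

noncomputable def af (l : Fn) (x y P : Pt) : Pt := P + (ev l P / ev l x) • (y - x)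

theorem af_aff (l : Fn) (x y : Pt) : Aff (af l x y) := by
  intro p q s
  simp only [af, ev_comb]
  ext <;> simp <;> ring

theorem mv_af {K : List Fn} {x y a b : Pt} (hx : InK K x) {l : Fn} (hl : l ∈ K) (ha : ∀ l ∈ K, 0 ≤ ev l a)
    (hb : ∀ l ∈ K, 0 ≤ ev l b) (hla : ev l a = 0) (hlb : ev l b = 0) {P : Pt} (hP : P ∈ Tr a b x) :
    mv K x y P = af l x y P := by
  have hlx := hx l hl
  have h0 : 0 ≤ ev l P := Tr_min (ev_convex l) hla.ge hlb.ge hlx.le hP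
  have h1 : ev l P ≤ ev l x := by
    have : 0 ≤ ev (lc (-1) (ev l x) l (0, 0, 1)) P :=
      Tr_min (ev_convex _) (by simp only [mem_ofPred_eq, ev_lc, hla]; simp [ev]; simpa [ev] using hlx.le)
        (by simp only [mem_ofPred_eq, ev_lc, hlb]; simp [ev]; simpa [ev] using hlx.le)
        (by simp only [mem_ofPred_eq, ev_lc]; simp [ev]; linarith) hP
    rw [ev_lc] at this
    simp [ev] at this ⊢
    linarith
  have h2 : ∀ m ∈ K, 0 ≤ ev m P * ev l x - ev l P * ev m x := by
    intro m hm
    have : 0 ≤ ev (lc (ev l x) (- ev m x) m l) P :=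
      Tr_min (ev_convex _) (by simp only [mem_ofPred_eq, ev_lc, hla]; simpa using mul_nonneg hlx.le (ha m hm))
        (by simp only [mem_ofPred_eq, ev_lc, hlb]; simpa using mul_nonneg hlx.le (hb m hm))
        (by simp only [mem_ofPred_eq, ev_lc]; linarith) hP
    rw [ev_lc] at this
    linarith
  have : mu K x P = ev l P / ev l x := by
    apply mu_eq
    · rw [div_le_one hlx]; exact h1
    · intro m hm
      rw [div_le_div_iff₀ hlx (hx m hm)]
      linarith [h2 m hm]
    · exact Or.inr ⟨l, hl, rfl⟩
  rw [mv, this, max_eq_right (div_nonneg h0 hlx.le), af]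

theorem af_zero {l : Fn} {x y P : Pt} (h : ev l P = 0) : af l x y P = P := by simp [af, h]
theorem af_x {l : Fn} {x y : Pt} (h : ev l x ≠ 0) : af l x y x = y := by simp [af, h]

/-- segment preservation -/
def Sg (h : Pt → Pt) (p q : Pt) : Prop := h '' segment ℝ p q = segment ℝ (h p) (h q)

theorem Sg.comp {g h : Pt → Pt} {p q : Pt} (hh : Sg h p q) (hg : Sg g (h p) (h q)) : Sg (g ∘ h) p q := by
  unfold Sg at *; rw [image_comp, hh, hg]; rfl

theorem Sg.of_aff {h f : Pt → Pt} {C : Set Pt} (hC : Convex ℝ C) (hf : Aff f) (heq : ∀ P ∈ C, h P = f P) {p q : Pt}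
    (hp : p ∈ C) (hq : q ∈ C) : Sg h p q := by
  unfold Sg
  rw [heq p hp, heq q hq, ← hf.seg]
  exact image_congr fun P hP => heq P (hC.segment_subset hp hq hP)

theorem Aff.id : Aff (fun P => P) := fun _ _ _ => rfl

end Move
end SN


namespace SN
section Trees

/-- binary trees with labelled inner nodes -/
inductive BT (α : Type) : Type
  | leaf : BT α
  | node : BT α → α → BT α → BT α

def BT.map {α β : Type} (f : α → β) : BT α → BT β
  | .leaf => .leaf
  | .node l w r => .node (l.map f) (f w) (r.map f)

def BT.Ed {α : Type} : BT α → α → α → α → α → Prop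
  | .leaf, _, _, _, _ => False
  | .node l w r, a, b, p, q => (p = a ∧ q = w) ∨ (p = w ∧ q = b) ∨ l.Ed a w p q ∨ r.Ed w b p q

def BT.Al {α : Type} (P : α → Prop) : BT α → Prop
  | .leaf => True
  | .node l w r => l.Al P ∧ P w ∧ r.Al P

theorem BT.map_map {α β γ : Type} (f : α → β) (g : β → γ) (t : BT α) : (t.map f).map g = t.map (g ∘ f) := by
  induction t with
  | leaf => rfl
  | node l w r ihl ihr => simp only [BT.map, ihl, ihr]; rfl

theorem BT.map_congr {α β : Type} {f g : α → β} {t : BT α} (h : t.Al (fun x => f x = g x)) : t.map f = t.map g := by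
  induction t with
  | leaf => rfl
  | node l w r ihl ihr => simp only [BT.map]; rw [ihl h.1, ihr h.2.2, h.2.1]

theorem BT.map_id {α : Type} (t : BT α) : t.map (fun x => x) = t := by
  induction t with
  | leaf => rfl
  | node l w r ihl ihr => simp only [BT.map, ihl, ihr]

theorem BT.Al.imp {α : Type} {P Q : α → Prop} {t : BT α} (h : t.Al P) (hPQ : ∀ x, P x → Q x) : t.Al Q := by
  induction t with
  | leaf => trivial
  | node l w r ihl ihr => exact ⟨ihl h.1, hPQ _ h.2.1, ihr h.2.2⟩

theorem BT.Al_map {α β : Type} {f : α → β} {P : β → Prop} {t : BT α} : (t.map f).Al P ↔ t.Al (fun x => P (f x)) := by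
  induction t with
  | leaf => exact Iff.rfl
  | node l w r ihl ihr => simp only [BT.map, BT.Al, ihl, ihr]

theorem BT.Ed_map {α β : Type} (f : α → β) (t : BT α) {a b p q : α} (h : t.Ed a b p q) :
    (t.map f).Ed (f a) (f b) (f p) (f q) := by
  induction t generalizing a b with
  | leaf => exact h
  | node l w r ihl ihr =>
    rcases h with ⟨rfl, rfl⟩ | ⟨rfl, rfl⟩ | h | h
    · exact Or.inl ⟨rfl, rfl⟩
    · exact Or.inr (Or.inl ⟨rfl, rfl⟩)
    · exact Or.inr (Or.inr (Or.inl (ihl h)))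
    · exact Or.inr (Or.inr (Or.inr (ihr h)))

theorem BT.Ed_mem {α : Type} {P : α → Prop} {t : BT α} {a b p q : α} (h : t.Ed a b p q) (ha : P a) (hb : P b)
    (ht : t.Al P) : P p ∧ P q := by
  induction t generalizing a b with
  | leaf => exact h.elim
  | node l w r ihl ihr =>
    rcases h with ⟨rfl, rfl⟩ | ⟨rfl, rfl⟩ | h | h
    · exact ⟨ha, ht.2.1⟩
    · exact ⟨ht.2.1, hb⟩
    · exact ihl h ha ht.2.1 ht.1
    · exact ihr h ht.2.1 hb ht.2.2

/-- forget the labels -/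
def BT.sh {α : Type} (t : BT α) : BT Unit := t.map (fun _ => ())

noncomputable def std (a b d : Pt) : BT Unit → BT Pt
  | .leaf => .leaf
  | .node l _ r => .node (std a (cen a b d) (cen a (cen a b d) d) l) (cen a b d) (std (cen a b d) b (cen (cen a b d) b d) r)

theorem std_aff {f : Pt → Pt} (hf : Aff f) (s : BT Unit) (a b d : Pt) :
    (std a b d s).map f = std (f a) (f b) (f d) s := by
  induction s generalizing a b d with
  | leaf => rfl
  | node l w r ihl ihr => simp only [std, BT.map, ihl, ihr, hf.cen]

theorem std_mem (s : BT Unit) (a b d : Pt) : (std a b d s).Al (fun P => P ∈ Tr a b d) := by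
  induction s generalizing a b d with
  | leaf => trivial
  | node l w r ihl ihr =>
    refine ⟨(ihl _ _ _).imp fun x hx => ?_, cen_mem a b d, (ihr _ _ _).imp fun x hx => ?_⟩
    · exact Tr_min (Tr_convex a b d) (Tr_a _ _ _) (cen_mem a b d)
        (Tr_min (Tr_convex a b d) (Tr_a _ _ _) (cen_mem a b d) (Tr_c _ _ _) (cen_mem _ _ _)) hx
    · exact Tr_min (Tr_convex a b d) (cen_mem a b d) (Tr_b _ _ _)
        (Tr_min (Tr_convex a b d) (cen_mem a b d) (Tr_b _ _ _) (Tr_c _ _ _) (cen_mem _ _ _)) hx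

def RealT : BT Pt → List Fn → Pt → Pt → Prop
  | .leaf, _, _, _ => True
  | .node l w r, K, a, b => InK K w ∧ ∃ m : Fn, ev m w = 0 ∧ ev m a < 0 ∧ 0 < ev m b ∧
      RealT l (lf a w :: ng m :: K) a w ∧ RealT r (lf w b :: m :: K) w b

theorem RealT.pos {t : BT Pt} {K : List Fn} {a b : Pt} (h : RealT t K a b) : t.Al (fun P => InK K P) := by
  induction t generalizing K a b with
  | leaf => trivial
  | node l w r ihl ihr =>
    obtain ⟨hw, m, _, _, _, h1, h2⟩ := h
    exact ⟨(ihl h1).imp fun x hx f hf => hx f (by simp [hf]), hw, (ihr h2).imp fun x hx f hf => hx f (by simp [hf])⟩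

theorem small_eps (K : List Fn) (w c : Pt) (hw : InK K w) : ∃ e0 : ℝ, 0 < e0 ∧ ∀ e, 0 < e → e ≤ e0 → InK K (w + e • (w - c)) := by
  induction K with
  | nil => exact ⟨1, one_pos, fun _ _ _ l hl => by simp at hl⟩
  | cons l K ih =>
    obtain ⟨e0, he0, h0⟩ := ih fun f hf => hw f (by simp [hf])
    have hlw := hw l (by simp)
    have hpos : 0 < |ev l c| + 1 := by positivity
    refine ⟨min e0 (ev l w / (|ev l c| + 1)), lt_min he0 (by positivity), fun e he hle f hf => ?_⟩
    rcases List.mem_cons.mp hf with rfl | hf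
    · rw [ev_add_smul]
      have h1 := hle.trans (min_le_right _ _)
      rw [le_div_iff₀ hpos] at h1
      have h2 : e * ev f c ≤ e * |ev f c| := mul_le_mul_of_nonneg_left (le_abs_self _) he.le
      have h3 : 0 < e * ev f w := mul_pos he hlw
      nlinarith
    · exact h0 e he (hle.trans (min_le_left _ _)) f hf

theorem bary (l : Fn) (a b d P : Pt) : ev l P * dt a b d = dt b d P * ev l a + dt d a P * ev l b + dt a b P * ev l d := by
  simp only [ev, dt]; ring

end Trees
end SN


namespace SN
section Claim

theorem dt_self1 (a b : Pt) : dt a b a = 0 := by simp only [dt]; ring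
theorem dt_self2 (a b : Pt) : dt a b b = 0 := by simp only [dt]; ring

theorem Tr_swap (a b c : Pt) : Tr a b c = Tr b a c := by unfold Tr; congr 1; exact Set.insert_comm a b {c}

theorem straighten (t : BT Pt) : ∀ (K : List Fn) (a b d : Pt), RealT t K a b → lf a b ∈ K →
    (∀ l ∈ K, 0 ≤ ev l a) → (∀ l ∈ K, 0 ≤ ev l b) → InK K d →
    ∃ h : Pt ≃ₜ Pt, (∀ P, ¬ InK K P → h P = P) ∧ t.map h = std a b d t.sh ∧ ∀ p q, t.Ed a b p q → Sg h p q := by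
  induction t with
  | leaf => exact fun K a b d _ _ _ _ _ => ⟨Homeomorph.refl _, fun _ _ => rfl, rfl, fun _ _ h => h.elim⟩
  | node l w r ihl ihr =>
    intro K a b d hR hab haK hbK hd
    obtain ⟨hw, m, hmw, hma, hmb, hRl, hRr⟩ := hR
    have habw : 0 < dt a b w := by rw [← ev_lf]; exact hw _ hab
    -- the point c
    obtain ⟨s, hs0, hs1, hs⟩ : ∃ s : ℝ, 0 < s ∧ s < 1 ∧ (1 - s) * ev m a + s * ev m b = 0 := by
      refine ⟨- ev m a / (ev m b - ev m a), div_pos (by linarith) (by linarith), ?_, ?_⟩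
      · rw [div_lt_one (by linarith)]; linarith
      · have : ev m b - ev m a ≠ 0 := by linarith
        field_simp; ring
    obtain ⟨e, he, hKd⟩ : ∃ e : ℝ, 0 < e ∧ InK K (w + e • (w - ((1 - s) • a + s • b))) := by
      obtain ⟨e0, he0, h⟩ := small_eps K w ((1 - s) • a + s • b) hw
      exact ⟨e0, he0, h e0 he0 le_rfl⟩
    obtain ⟨d1, hd1⟩ : ∃ d1, d1 = w + e • (w - ((1 - s) • a + s • b)) := ⟨_, rfl⟩
    have evd : ∀ f : Fn, ev f d1 = ev f w + e * (ev f w - ((1 - s) * ev f a + s * ev f b)) := by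
      intro f; rw [hd1, ev_add_smul, ev_comb]
    rw [← hd1] at hKd
    have hmd : ev m d1 = 0 := by rw [evd, hs, hmw]; ring
    have hawd : 0 < dt a w d1 := by
      have := evd (lf a w)
      simp only [ev_lf, dt_self1, dt_self2] at this
      rw [this, dt_swap a b w]
      have : 0 < e * s * dt a b w := by positivity
      nlinarith
    have hwbd : 0 < dt w b d1 := by
      have h1 := evd (lf w b)
      simp only [ev_lf, dt_self1, dt_self2] at h1
      have h2 : dt w b a = - dt a b w := by simp only [dt]; ring
      rw [h1, h2]
      have : 0 < e * (1 - s) * dt a b w := mul_pos (mul_pos he (by linarith)) habw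
      nlinarith
    have habd : 0 < dt a b d1 := by rw [← ev_lf]; exact hKd _ hab
    -- induction
    obtain ⟨hl, hl1, hl2, hl3⟩ := ihl (lf a w :: ng m :: K) a w (cen a w d1) hRl (by simp) (by
        intro f hf
        simp only [List.mem_cons] at hf
        rcases hf with rfl | rfl | hf
        · rw [ev_lf, dt_self1]
        · rw [ev_ng]; linarith
        · exact haK f hf) (by
        intro f hf
        simp only [List.mem_cons] at hf
        rcases hf with rfl | rfl | hf
        · rw [ev_lf, dt_self2]
        · rw [ev_ng]; linarith
        · exact (hw f hf).le) (by
        intro f hf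
        simp only [List.mem_cons] at hf
        rw [ev_cen]
        rcases hf with rfl | rfl | hf
        · rw [ev_lf, ev_lf, ev_lf, dt_self1, dt_self2]; linarith
        · rw [ev_ng, ev_ng, ev_ng]; linarith
        · linarith [haK f hf, hw f hf, hKd f hf])
    obtain ⟨hr, hr1, hr2, hr3⟩ := ihr (lf w b :: m :: K) w b (cen w b d1) hRr (by simp) (by
        intro f hf
        simp only [List.mem_cons] at hf
        rcases hf with rfl | rfl | hf
        · rw [ev_lf, dt_self1]
        · linarith
        · exact (hw f hf).le) (by
        intro f hf
        simp only [List.mem_cons] at hf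
        rcases hf with rfl | rfl | hf
        · rw [ev_lf, dt_self2]
        · linarith
        · exact hbK f hf) (by
        intro f hf
        simp only [List.mem_cons] at hf
        rw [ev_cen]
        rcases hf with rfl | rfl | hf
        · rw [ev_lf, ev_lf, ev_lf, dt_self1, dt_self2]; linarith
        · linarith
        · linarith [hbK f hf, hw f hf, hKd f hf])
    -- where hl, hr are the identity
    have hlm : ∀ P, 0 ≤ ev m P → hl P = P := fun P hP => hl1 P fun h => by
      have := h (ng m) (by simp); rw [ev_ng] at this; linarith
    have hrm : ∀ P, ev m P ≤ 0 → hr P = P := fun P hP => hr1 P fun h => by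
      have := h m (by simp); linarith
    have hl0 : ∀ P, dt a w P ≤ 0 → hl P = P := fun P hP => hl1 P fun h => by
      have := h (lf a w) (by simp); rw [ev_lf] at this; linarith
    have hr0 : ∀ P, dt w b P ≤ 0 → hr P = P := fun P hP => hr1 P fun h => by
      have := h (lf w b) (by simp); rw [ev_lf] at this; linarith
    -- the second map
    obtain ⟨T, hT⟩ : ∃ T : List Fn, T = [lf a b, lf b d1, lf d1 a] := ⟨_, rfl⟩
    have hTw : InK T w := by
      intro f hf; rw [hT] at hf
      simp only [List.mem_cons, List.not_mem_nil, or_false] at hf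
      rcases hf with rfl | rfl | rfl <;> rw [ev_lf]
      · exact habw
      · rw [dt_cyc]; exact hwbd
      · have : dt d1 a w = dt a w d1 := (dt_cyc d1 a w).symm
        rw [this]; exact hawd
    have hTc : InK T (cen a b d1) := by
      intro f hf; rw [hT] at hf
      simp only [List.mem_cons, List.not_mem_nil, or_false] at hf
      have h1 : dt b d1 a = dt a b d1 := dt_cyc a b d1
      have h2 : dt d1 a b = dt a b d1 := (dt_cyc d1 a b).symm
      rcases hf with rfl | rfl | rfl <;> rw [ev_cen, ev_lf, ev_lf, ev_lf, dt_self1, dt_self2] <;> linarith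
    have hTK : ∀ P, InK T P → InK K P := by
      intro P hP f hf
      have h1 := hP (lf a b) (by simp [hT])
      have h2 := hP (lf b d1) (by simp [hT])
      have h3 := hP (lf d1 a) (by simp [hT])
      rw [ev_lf] at h1 h2 h3
      have h4 := bary f a b d1 P
      have h5 : 0 < ev f P * dt a b d1 := by
        rw [h4]
        have := mul_nonneg h2.le (haK f hf)
        have := mul_nonneg h3.le (hbK f hf)
        have := mul_pos h1 (hKd f hf)
        linarith
      exact (pos_iff_pos_of_mul_pos h5).mpr habd
    have hTa : ∀ f ∈ T, 0 ≤ ev f a := by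
      intro f hf; rw [hT] at hf
      simp only [List.mem_cons, List.not_mem_nil, or_false] at hf
      rcases hf with rfl | rfl | rfl <;> rw [ev_lf]
      · rw [dt_self1]
      · rw [dt_cyc]; exact habd.le
      · rw [dt_self2]
    have hTb : ∀ f ∈ T, 0 ≤ ev f b := by
      intro f hf; rw [hT] at hf
      simp only [List.mem_cons, List.not_mem_nil, or_false] at hf
      rcases hf with rfl | rfl | rfl <;> rw [ev_lf]
      · rw [dt_self2]
      · rw [dt_self1]
      · rw [← dt_cyc]; exact habd.le
    have hTd : ∀ f ∈ T, 0 ≤ ev f d1 := by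
      intro f hf; rw [hT] at hf
      simp only [List.mem_cons, List.not_mem_nil, or_false] at hf
      rcases hf with rfl | rfl | rfl <;> rw [ev_lf]
      · exact habd.le
      · rw [dt_self2]
      · rw [dt_self1]
    let h2 := mvH T w (cen a b d1) hTw hTc
    let h3 := mvH K d1 d hKd hd
    have h2l : ∀ P ∈ Tr a d1 w, h2 P = af (lf d1 a) w (cen a b d1) P := fun P hP =>
      mv_af hTw (by simp [hT]) hTa hTd (by rw [ev_lf, dt_self2]) (by rw [ev_lf, dt_self1]) hP
    have h2r : ∀ P ∈ Tr b d1 w, h2 P = af (lf b d1) w (cen a b d1) P := fun P hP =>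
      mv_af hTw (by simp [hT]) hTb hTd (by rw [ev_lf, dt_self1]) (by rw [ev_lf, dt_self2]) hP
    have h3' : ∀ P ∈ Tr a b d1, h3 P = af (lf a b) d1 d P := fun P hP =>
      mv_af hKd hab haK hbK (by rw [ev_lf, dt_self1]) (by rw [ev_lf, dt_self2]) hP
    have eda : af (lf d1 a) w (cen a b d1) a = a := af_zero (by rw [ev_lf, dt_self2])
    have edd : af (lf d1 a) w (cen a b d1) d1 = d1 := af_zero (by rw [ev_lf, dt_self1])
    have edw : af (lf d1 a) w (cen a b d1) w = cen a b d1 := af_x (hTw _ (by simp [hT])).ne'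
    have edb : af (lf b d1) w (cen a b d1) b = b := af_zero (by rw [ev_lf, dt_self1])
    have edd' : af (lf b d1) w (cen a b d1) d1 = d1 := af_zero (by rw [ev_lf, dt_self2])
    have edw' : af (lf b d1) w (cen a b d1) w = cen a b d1 := af_x (hTw _ (by simp [hT])).ne'
    have e3a : af (lf a b) d1 d a = a := af_zero (by rw [ev_lf, dt_self1])
    have e3b : af (lf a b) d1 d b = b := af_zero (by rw [ev_lf, dt_self2])
    have e3d : af (lf a b) d1 d d1 = d := af_x (hKd _ hab).ne'
    have e3c : af (lf a b) d1 d (cen a b d1) = cen a b d := by rw [(af_aff _ _ _).cen, e3a, e3b, e3d]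
    obtain ⟨fl, hfl, hfle, hfla, hflw, hfld⟩ : ∃ fl : Pt → Pt, Aff fl ∧ (∀ P ∈ Tr a d1 w, h3 (h2 P) = fl P) ∧
        fl a = a ∧ fl w = cen a b d ∧ fl d1 = d := by
      refine ⟨af (lf a b) d1 d ∘ af (lf d1 a) w (cen a b d1), (af_aff _ _ _).comp (af_aff _ _ _), ?_, ?_, ?_, ?_⟩
      · intro P hP
        rw [h2l P hP]
        apply h3'
        exact Tr_min ((af_aff (lf d1 a) w (cen a b d1)).convex (Tr_convex a b d1))
          (by rw [mem_preimage, eda]; exact Tr_a _ _ _) (by rw [mem_preimage, edd]; exact Tr_c _ _ _)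
          (by rw [mem_preimage, edw]; exact cen_mem _ _ _) hP
      · simp only [Function.comp, eda, e3a]
      · simp only [Function.comp, edw, e3c]
      · simp only [Function.comp, edd, e3d]
    obtain ⟨fr, hfr, hfre, hfrb, hfrw, hfrd⟩ : ∃ fr : Pt → Pt, Aff fr ∧ (∀ P ∈ Tr b d1 w, h3 (h2 P) = fr P) ∧
        fr b = b ∧ fr w = cen a b d ∧ fr d1 = d := by
      refine ⟨af (lf a b) d1 d ∘ af (lf b d1) w (cen a b d1), (af_aff _ _ _).comp (af_aff _ _ _), ?_, ?_, ?_, ?_⟩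
      · intro P hP
        rw [h2r P hP]
        apply h3'
        exact Tr_min ((af_aff (lf b d1) w (cen a b d1)).convex (Tr_convex a b d1))
          (by rw [mem_preimage, edb]; exact Tr_b _ _ _) (by rw [mem_preimage, edd']; exact Tr_c _ _ _)
          (by rw [mem_preimage, edw']; exact cen_mem _ _ _) hP
      · simp only [Function.comp, edb, e3b]
      · simp only [Function.comp, edw', e3c]
      · simp only [Function.comp, edd', e3d]
    -- geometric inclusions
    have hLsub : Tr a w (cen a w d1) ⊆ Tr a d1 w := Tr_min (Tr_convex _ _ _) (Tr_a _ _ _) (Tr_c _ _ _)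
      (Tr_min (Tr_convex _ _ _) (Tr_a _ _ _) (Tr_c _ _ _) (Tr_b _ _ _) (cen_mem _ _ _))
    have hRsub : Tr w b (cen w b d1) ⊆ Tr b d1 w := Tr_min (Tr_convex _ _ _) (Tr_c _ _ _) (Tr_a _ _ _)
      (Tr_min (Tr_convex _ _ _) (Tr_c _ _ _) (Tr_a _ _ _) (Tr_b _ _ _) (cen_mem _ _ _))
    have hLm : ∀ P ∈ Tr a d1 w, ev m P ≤ 0 := by
      intro P hP
      have : 0 ≤ ev (ng m) P := Tr_min (ev_convex (ng m)) (by rw [mem_ofPred_eq, ev_ng]; linarith)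
        (by rw [mem_ofPred_eq, ev_ng]; linarith) (by rw [mem_ofPred_eq, ev_ng]; linarith) hP
      rw [ev_ng] at this; linarith
    have hRm : ∀ P ∈ Tr b d1 w, 0 ≤ ev m P := fun P hP =>
      Tr_min (ev_convex m) hmb.le hmd.ge hmw.ge hP
    have hla : hl a = a := hl0 _ (dt_self1 _ _).le
    have hlw : hl w = w := hl0 _ (dt_self2 _ _).le
    have hrw : hr w = w := hr0 _ (dt_self1 _ _).le
    have hrb : hr b = b := hr0 _ (dt_self2 _ _).le
    have key : ∀ P ∈ Tr a d1 w, h3 (h2 (hr P)) = fl P := fun P hP => by rw [hrm P (hLm P hP), hfle P hP]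
    refine ⟨((hl.trans hr).trans h2).trans h3, ?_, ?_, ?_⟩
    · intro P hP
      have e1 : hl P = P := hl1 P fun h => hP fun f hf => h f (by simp [hf])
      have e2 : hr P = P := hr1 P fun h => hP fun f hf => h f (by simp [hf])
      have e3 : h2 P = P := mv_id hTw fun h => hP (hTK P h)
      have e4 : h3 P = P := mv_id hKd hP
      simp only [Homeomorph.trans_apply]
      rw [e1, e2, e3, e4]
    · have eL : l.map (((hl.trans hr).trans h2).trans h3) = std a (cen a b d) (cen a (cen a b d) d) l.sh := by
        have : (std a w (cen a w d1) l.sh).map (fun P => h3 (h2 (hr P))) = (std a w (cen a w d1) l.sh).map fl :=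
          BT.map_congr ((std_mem _ _ _ _).imp fun P hP => key P (hLsub hP))
        rw [std_aff hfl, hfl.cen, hfla, hflw, hfld, ← hl2, BT.map_map] at this
        exact this
      have eR : r.map (((hl.trans hr).trans h2).trans h3) = std (cen a b d) b (cen (cen a b d) b d) r.sh := by
        have h1 : (std w b (cen w b d1) r.sh).map (fun P => h3 (h2 P)) = (std w b (cen w b d1) r.sh).map fr :=
          BT.map_congr ((std_mem _ _ _ _).imp fun P hP => hfre P (hRsub hP))
        rw [std_aff hfr, hfr.cen, hfrb, hfrw, hfrd, ← hr2, BT.map_map] at h1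
        rw [← h1]
        apply BT.map_congr
        refine hRr.pos.imp fun P hP => ?_
        have : hl P = P := hlm P (hP m (by simp)).le
        simp only [Homeomorph.trans_apply, Function.comp, this]
      have eW : (((hl.trans hr).trans h2).trans h3) w = cen a b d := by
        simp only [Homeomorph.trans_apply]
        rw [hlw, hrw, hfle w (Tr_c _ _ _), hflw]
      simp only [BT.map, BT.sh, std]
      rw [eL, eR, eW]
      rfl
    · have segsub : ∀ (f : Fn) (p q : Pt), 0 ≤ ev f p → 0 ≤ ev f q → ∀ P ∈ segment ℝ p q, 0 ≤ ev f P :=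
        fun f p q hp hq P hP => (ev_convex f).segment_subset hp hq hP
      rintro p q (⟨rfl, rfl⟩ | ⟨rfl, rfl⟩ | h | h)
      · refine Sg.of_aff (C := segment ℝ p q) (convex_segment _ _) hfl ?_ (left_mem_segment ℝ _ _) (right_mem_segment ℝ _ _)
        intro P hP
        have h5 : hl P = P := by
          apply hl0
          have := segsub (ng (lf p q)) p q (by rw [ev_ng, ev_lf, dt_self1]; simp) (by rw [ev_ng, ev_lf, dt_self2]; simp) P hP
          rw [ev_ng, ev_lf] at this; linarith
        simp only [Homeomorph.trans_apply, h5]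
        exact key P ((Tr_convex _ _ _).segment_subset (Tr_a _ _ _) (Tr_c _ _ _) hP)
      · refine Sg.of_aff (C := segment ℝ p q) (convex_segment _ _) hfr ?_ (left_mem_segment ℝ _ _) (right_mem_segment ℝ _ _)
        intro P hP
        have hPT := (Tr_convex _ _ _).segment_subset (Tr_c q d1 p) (Tr_a _ _ _) hP
        have h5 : hl P = P := hlm P (hRm P hPT)
        have h6 : hr P = P := by
          apply hr0
          have := segsub (ng (lf p q)) p q (by rw [ev_ng, ev_lf, dt_self1]; simp) (by rw [ev_ng, ev_lf, dt_self2]; simp) P hP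
          rw [ev_ng, ev_lf] at this; linarith
        simp only [Homeomorph.trans_apply, h5, h6]
        exact hfre P hPT
      · have h5 := hl3 p q h
        have h6 := BT.Ed_map hl l h
        rw [hla, hlw, hl2] at h6
        obtain ⟨h7, h8⟩ := BT.Ed_mem (P := fun P => P ∈ Tr a w (cen a w d1)) h6 (Tr_a _ _ _) (Tr_b _ _ _) (std_mem _ _ _ _)
        exact h5.comp (Sg.of_aff (C := Tr a d1 w) (Tr_convex _ _ _) hfl (h := fun P => h3 (h2 (hr P))) key (hLsub h7) (hLsub h8))
      · have hmp := BT.Ed_mem (P := fun P => 0 ≤ ev m P) h hmw.ge hmb.le (hRr.pos.imp fun P hP => (hP m (by simp)).le)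
        have h5 := hr3 p q h
        have h6 := BT.Ed_map hr r h
        rw [hrw, hrb, hr2] at h6
        obtain ⟨h7, h8⟩ := BT.Ed_mem (P := fun P => P ∈ Tr w b (cen w b d1)) h6 (Tr_a _ _ _) (Tr_b _ _ _) (std_mem _ _ _ _)
        have h9 : Sg hl p q := Sg.of_aff (C := {P | 0 ≤ ev m P}) (ev_convex m) Aff.id (fun P hP => hlm P hP) hmp.1 hmp.2
        refine h9.comp (g := fun P => h3 (h2 (hr P))) ?_
        rw [hlm p hmp.1, hlm q hmp.2]
        exact h5.comp (Sg.of_aff (C := Tr b d1 w) (Tr_convex _ _ _) hfr (h := fun P => h3 (h2 P)) hfre (hRsub h7) (hRsub h8))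

end Claim
end SN


namespace SN
section Embed

theorem exists_lower {α : Type} [DecidableEq α] (X : Finset α) (f : α → ℝ) : ∀ p : ℕ, p ≤ X.card →
    ∃ L ⊆ X, L.card = p ∧ ∀ P ∈ L, ∀ Q ∈ X, Q ∉ L → f P ≤ f Q := by
  intro p
  induction p with
  | zero => exact fun _ => ⟨∅, by simp, rfl, by simp⟩
  | succ p ih =>
    intro hp
    obtain ⟨L, hLX, hLc, hL⟩ := ih (by omega)
    have hne : (X \ L).Nonempty := by
      rw [← Finset.card_pos, Finset.card_sdiff_of_subset hLX]; omega
    obtain ⟨w, hw, hmin⟩ := Finset.exists_min_image (X \ L) f hne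
    rw [Finset.mem_sdiff] at hw
    refine ⟨insert w L, Finset.insert_subset hw.1 hLX, by rw [Finset.card_insert_of_notMem hw.2, hLc], ?_⟩
    intro P hP Q hQ hQL
    rw [Finset.mem_insert, not_or] at hQL
    rcases Finset.mem_insert.mp hP with rfl | hP
    · exact hmin Q (Finset.mem_sdiff.mpr ⟨hQ, hQL.2⟩)
    · exact hL P hP Q hQ hQL.2

def BT.sz {α : Type} : BT α → ℕ
  | .leaf => 0
  | .node l _ r => l.sz + r.sz + 1

def GP (X : Set Pt) : Prop := ∀ P ∈ X, ∀ Q ∈ X, ∀ R ∈ X, P ≠ Q → P ≠ R → Q ≠ R → dt P Q R ≠ 0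

theorem GP.mono {X Y : Set Pt} (h : GP Y) (hXY : X ⊆ Y) : GP X :=
  fun P hP Q hQ R hR => h P (hXY hP) Q (hXY hQ) R (hXY hR)

theorem ang_a (a b P Q : Pt) : dt a P Q * ((b.1 - a.1)^2 + (b.2 - a.2)^2) =
    ((P.1 - a.1) * (b.1 - a.1) + (P.2 - a.2) * (b.2 - a.2)) * dt a b Q -
    ((Q.1 - a.1) * (b.1 - a.1) + (Q.2 - a.2) * (b.2 - a.2)) * dt a b P := by
  simp only [dt]; ring

theorem ang_b (a b P Q : Pt) : dt P b Q * ((b.1 - a.1)^2 + (b.2 - a.2)^2) =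
    ((P.1 - b.1) * (a.1 - b.1) + (P.2 - b.2) * (a.2 - b.2)) * dt a b Q -
    ((Q.1 - b.1) * (a.1 - b.1) + (Q.2 - b.2) * (a.2 - b.2)) * dt a b P := by
  simp only [dt]; ring

theorem plu (a b w P Q : Pt) : dt a w P * dt w b Q - dt w b P * dt a w Q = - (dt w a b * dt w P Q) := by
  simp only [dt]; ring

theorem nsq_pos {a b P : Pt} (h : 0 < dt a b P) : 0 < (b.1 - a.1)^2 + (b.2 - a.2)^2 := by
  by_contra hn
  have h1 : b.1 - a.1 = 0 := by nlinarith [sq_nonneg (b.1 - a.1), sq_nonneg (b.2 - a.2)]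
  have h2 : b.2 - a.2 = 0 := by nlinarith [sq_nonneg (b.1 - a.1), sq_nonneg (b.2 - a.2)]
  simp [dt, h1, h2] at h

set_option maxHeartbeats 1000000 in
theorem gritz (s : BT Unit) : ∀ (K : List Fn) (a b : Pt) (X : Finset Pt), X.card = s.sz → lf a b ∈ K →
    (∀ P ∈ X, InK K P) → GP (insert a (insert b (X : Set Pt))) →
    ∃ t : BT Pt, t.sh = s ∧ RealT t K a b ∧ t.Al (fun P => P ∈ X) := by
  classical
  induction s with
  | leaf => exact fun K a b X _ _ _ _ => ⟨.leaf, rfl, trivial, trivial⟩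
  | node sl u sr ihl ihr =>
    intro K a b X hc hab hK hGP
    simp only [BT.sz] at hc
    have habP : ∀ P ∈ X, 0 < dt a b P := fun P hP => by rw [← ev_lf]; exact hK P hP _ hab
    have hPa : ∀ P ∈ X, P ≠ a := fun P hP h => by have := habP P hP; rw [h, dt_self1] at this; exact lt_irrefl _ this
    have hPb : ∀ P ∈ X, P ≠ b := fun P hP h => by have := habP P hP; rw [h, dt_self2] at this; exact lt_irrefl _ this
    obtain ⟨P0, hP0⟩ : X.Nonempty := by rw [← Finset.card_pos]; omega
    have hN := nsq_pos (habP P0 hP0)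
    have hne : a ≠ b := by rintro rfl; simp at hN
    have ha : a ∈ insert a (insert b (X : Set Pt)) := by simp
    have hb : b ∈ insert a (insert b (X : Set Pt)) := by simp
    have hX : ∀ P ∈ X, P ∈ insert a (insert b (X : Set Pt)) := fun P hP => by simp [hP]
    -- the points of smallest angle at a
    obtain ⟨Y, hYX, hYc, hY⟩ := exists_lower X
      (fun P => -(((P.1 - a.1) * (b.1 - a.1) + (P.2 - a.2) * (b.2 - a.2)) / dt a b P)) (sr.sz + 1) (by omega)
    have hYa : ∀ P ∈ Y, ∀ Q ∈ X, Q ∉ Y → 0 < dt a P Q := by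
      intro P hP Q hQ hQY
      have h1 := hY P hP Q hQ hQY
      have h2 := habP P (hYX hP)
      have h3 := habP Q hQ
      simp only [neg_le_neg_iff] at h1
      rw [div_le_div_iff₀ h3 h2] at h1
      have h4 := ang_a a b P Q
      have h5 : 0 ≤ dt a P Q := by
        by_contra hh
        nlinarith [mul_neg_of_neg_of_pos (not_le.mp hh) hN]
      exact lt_of_le_of_ne h5 (hGP a ha P (hX P (hYX hP)) Q (hX Q hQ) (hPa P (hYX hP)).symm (hPa Q hQ).symm
        (fun h => hQY (h ▸ hP))).symm
    obtain ⟨w, hwY, hwmin⟩ := Finset.exists_min_image Y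
      (fun P => -(((P.1 - b.1) * (a.1 - b.1) + (P.2 - b.2) * (a.2 - b.2)) / dt a b P))
      (by rw [← Finset.card_pos]; omega)
    have hwX := hYX hwY
    have hwb : ∀ Q ∈ Y, Q ≠ w → 0 < dt w b Q := by
      intro Q hQ hQw
      have h1 := hwmin Q hQ
      have h2 := habP w hwX
      have h3 := habP Q (hYX hQ)
      simp only [neg_le_neg_iff] at h1
      rw [div_le_div_iff₀ h3 h2] at h1
      have h4 := ang_b a b w Q
      have h5 : 0 ≤ dt w b Q := by
        by_contra hh
        nlinarith [mul_neg_of_neg_of_pos (not_le.mp hh) hN]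
      exact lt_of_le_of_ne h5 (hGP w (hX w hwX) b hb Q (hX Q (hYX hQ)) (hPb w hwX) hQw.symm (hPb Q (hYX hQ)).symm).symm
    have hf0 : ∀ P ∈ X, P ≠ w → dt a w P ≠ 0 := fun P hP h =>
      hGP a ha w (hX w hwX) P (hX P hP) (hPa w hwX).symm (hPa P hP).symm h.symm
    have hg0 : ∀ P ∈ X, P ≠ w → dt w b P ≠ 0 := fun P hP h =>
      hGP w (hX w hwX) b hb P (hX P hP) (hPb w hwX) h.symm (hPb P hP).symm
    have hXYc : (X \ Y).card = sl.sz := by rw [Finset.card_sdiff_of_subset hYX]; omega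
    obtain ⟨F, hF⟩ : ∃ F, F = (X.erase w).filter (fun P => 0 < dt a w P) := ⟨_, rfl⟩
    have hFm : ∀ P, P ∈ F ↔ P ≠ w ∧ P ∈ X ∧ 0 < dt a w P := by
      intro P; rw [hF, Finset.mem_filter, Finset.mem_erase, and_assoc]
    have hFsub : X \ Y ⊆ F := by
      intro P hP
      rw [Finset.mem_sdiff] at hP
      rw [hFm]
      exact ⟨fun h => hP.2 (h ▸ hwY), hP.1, hYa w hwY P hP.1 hP.2⟩
    obtain ⟨L, hLF, hLc, hL⟩ := exists_lower F (fun P => dt w b P / dt a w P) sl.sz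
      (by rw [← hXYc]; exact Finset.card_le_card hFsub)
    have hgneg : ∀ P ∈ X, P ≠ w → dt w b P < 0 → P ∈ X \ Y := by
      intro P hP hPw hg
      rw [Finset.mem_sdiff]
      refine ⟨hP, fun h => ?_⟩
      have := hwb P h hPw; linarith
    have hLneg : ∀ P ∈ X, P ≠ w → dt w b P < 0 → P ∈ L := by
      intro P hP hPw hg
      by_contra hPL
      have hPF := hFsub (hgneg P hP hPw hg)
      have hsub : insert P L ⊆ X \ Y := by
        intro Q hQ
        rcases Finset.mem_insert.mp hQ with rfl | hQ
        · exact hgneg Q hP hPw hg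
        · have h1 := hL Q hQ P hPF hPL
          have h2 := (hFm Q).mp (hLF hQ)
          have h3 := ((hFm P).mp hPF).2.2
          have h4 : dt w b P / dt a w P < 0 := div_neg_of_neg_of_pos hg h3
          have h5 : dt w b Q / dt a w Q < 0 := lt_of_le_of_lt h1 h4
          apply hgneg Q h2.2.1 h2.1
          rcases div_neg_iff.mp h5 with h6 | h6
          · linarith [h6.2, h2.2.2]
          · exact h6.1
      have := Finset.card_le_card hsub
      rw [Finset.card_insert_of_notMem hPL, hLc, hXYc] at this
      omega
    have hwL : w ∉ L := fun h => ((hFm w).mp (hLF h)).1 rfl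
    obtain ⟨R, hR⟩ : ∃ R, R = (X.erase w) \ L := ⟨_, rfl⟩
    have hRm : ∀ P, P ∈ R ↔ P ≠ w ∧ P ∈ X ∧ P ∉ L := by
      intro P; rw [hR, Finset.mem_sdiff, Finset.mem_erase, and_assoc]
    have hLX : L ⊆ X.erase w := by
      intro P hP
      have := (hFm P).mp (hLF hP)
      exact Finset.mem_erase.mpr ⟨this.1, this.2.1⟩
    have hRc : R.card = sr.sz := by
      rw [hR, Finset.card_sdiff_of_subset hLX, Finset.card_erase_of_mem hwX, hLc]; omega
    have hRg : ∀ P ∈ R, 0 < dt w b P := by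
      intro P hP
      obtain ⟨h1, h2, h3⟩ := (hRm P).mp hP
      rcases lt_or_gt_of_ne (hg0 P h2 h1) with h | h
      · exact (h3 (hLneg P h2 h1 h)).elim
      · exact h
    have habw := habP w hwX
    have hwab : dt w a b = dt a b w := (dt_cyc w a b).symm
    obtain ⟨th, hth1, hth2⟩ := Order.exists_between_finsets
      (insert 0 (L.image fun P => dt w b P / dt a w P)) ((F \ L).image fun P => dt w b P / dt a w P) (by
        intro x hx y hy
        obtain ⟨Q, hQ, rfl⟩ := Finset.mem_image.mp hy
        rw [Finset.mem_sdiff] at hQ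
        have hQF := (hFm Q).mp hQ.1
        rcases Finset.mem_insert.mp hx with rfl | hx
        · exact div_pos (hRg Q ((hRm Q).mpr ⟨hQF.1, hQF.2.1, hQ.2⟩)) hQF.2.2
        · obtain ⟨P, hP, rfl⟩ := Finset.mem_image.mp hx
          have hPF := (hFm P).mp (hLF hP)
          refine lt_of_le_of_ne (hL P hP Q hQ.1 hQ.2) fun h => ?_
          rw [div_eq_div_iff hPF.2.2.ne' hQF.2.2.ne'] at h
          have h1 := plu a b w P Q
          have h2 : dt w P Q ≠ 0 := hGP w (hX w hwX) P (hX P hPF.2.1) Q (hX Q hQF.2.1) hPF.1.symm hQF.1.symm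
            (fun h => hQ.2 (h ▸ hP))
          have h3 : dt w a b * dt w P Q = 0 := by linarith
          rcases mul_eq_zero.mp h3 with h4 | h4
          · rw [hwab] at h4; linarith
          · exact h2 h4)
    have hthpos : 0 < th := hth1 0 (by simp)
    have hLth : ∀ P ∈ L, 0 < th * dt a w P - dt w b P := by
      intro P hP
      have h1 := hth1 (dt w b P / dt a w P) (Finset.mem_insert_of_mem (Finset.mem_image.mpr ⟨P, hP, rfl⟩))
      rw [div_lt_iff₀ ((hFm P).mp (hLF hP)).2.2] at h1
      linarith
    have hRth : ∀ P ∈ R, 0 < - (th * dt a w P) + dt w b P := by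
      intro P hP
      obtain ⟨h1, h2, h3⟩ := (hRm P).mp hP
      rcases lt_or_gt_of_ne (hf0 P h2 h1) with h | h
      · have := mul_neg_of_pos_of_neg hthpos h
        linarith [hRg P hP]
      · have hPF := (hFm P).mpr ⟨h1, h2, h⟩
        have h4 := hth2 (dt w b P / dt a w P) (Finset.mem_image.mpr ⟨P, Finset.mem_sdiff.mpr ⟨hPF, h3⟩, rfl⟩)
        rw [lt_div_iff₀ h] at h4
        linarith
    obtain ⟨tl, htl1, htl2, htl3⟩ := ihl (lf a w :: ng (lc (-th) 1 (lf a w) (lf w b)) :: K) a w L hLc (by simp) (by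
        intro P hP f hf
        simp only [List.mem_cons] at hf
        have hPF := (hFm P).mp (hLF hP)
        rcases hf with rfl | rfl | hf
        · rw [ev_lf]; exact hPF.2.2
        · rw [ev_ng, ev_lc, ev_lf, ev_lf]; linarith [hLth P hP]
        · exact hK P hPF.2.1 f hf) (hGP.mono (by
          intro P hP
          rcases hP with rfl | rfl | hP
          · exact ha
          · exact hX _ hwX
          · exact hX _ ((hFm P).mp (hLF hP)).2.1))
    obtain ⟨tr, htr1, htr2, htr3⟩ := ihr (lf w b :: lc (-th) 1 (lf a w) (lf w b) :: K) w b R hRc (by simp) (by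
        intro P hP f hf
        simp only [List.mem_cons] at hf
        rcases hf with rfl | rfl | hf
        · rw [ev_lf]; exact hRg P hP
        · rw [ev_lc, ev_lf, ev_lf]; linarith [hRth P hP]
        · exact hK P ((hRm P).mp hP).2.1 f hf) (hGP.mono (by
          intro P hP
          rcases hP with rfl | rfl | hP
          · exact hX _ hwX
          · exact hb
          · exact hX _ ((hRm P).mp hP).2.1))
    refine ⟨.node tl w tr, ?_, ⟨hK w hwX, lc (-th) 1 (lf a w) (lf w b), ?_, ?_, ?_, htl2, htr2⟩, ?_, hwX, ?_⟩
    · simp only [BT.sh, BT.map] at *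
      rw [htl1, htr1]
    · rw [ev_lc, ev_lf, ev_lf, dt_self1, dt_self2]; ring
    · rw [ev_lc, ev_lf, ev_lf, dt_self1]
      have : dt w b a = - dt a b w := by simp only [dt]; ring
      rw [this]; linarith
    · rw [ev_lc, ev_lf, ev_lf, dt_self2, dt_swap a b w]
      have := mul_pos hthpos habw
      linarith
    · exact htl3.imp fun P hP => ((hFm P).mp (hLF hP)).2.1
    · exact htr3.imp fun P hP => ((hRm P).mp hP).2.1

end Embed
end SN


namespace SN
section Place

def BT.Od : BT ℕ → ℕ → ℕ → Prop
  | .leaf, i, j => j = i + 1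
  | .node l w r, i, j => i < w ∧ w < j ∧ l.Od i w ∧ r.Od w j

theorem BT.Od.sz {t : BT ℕ} {i j : ℕ} (h : t.Od i j) : j = i + 1 + t.sz := by
  induction t generalizing i j with
  | leaf => exact h
  | node l w r ihl ihr =>
    have h1 := ihl h.2.2.1
    have h2 := ihr h.2.2.2
    simp only [BT.sz]; omega

theorem BT.Od.al {t : BT ℕ} {i j : ℕ} {P : ℕ → Prop} (h : t.Od i j) (hP : t.Al P) (m : ℕ) (h1 : i < m) (h2 : m < j) : P m := by
  induction t generalizing i j with
  | leaf => have : j = i + 1 := h; omega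
  | node l w r ihl ihr =>
    rcases lt_trichotomy m w with h3 | rfl | h3
    · exact ihl h.2.2.1 hP.1 h1 h3
    · exact hP.2.1
    · exact ihr h.2.2.2 hP.2.2 h3 h2

theorem exists_tree {k : ℕ} (H : ℕ → ℕ → Prop)
    (hnc : ∀ a b c d, a < b → b < c → c < d → d < k → H a c → H b d → False) (n : ℕ) :
    ∀ i j, j = i + 1 + n → j < k → ∃ t : BT ℕ, t.Od i j ∧
      ∀ p q, i ≤ p → p < q → q ≤ j → H p q → ¬ (p = i ∧ q = j) → t.Ed i j p q := by
  induction n using Nat.strong_induction_on with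
  | _ n ih =>
    intro i j hj hjk
    rcases Nat.eq_zero_or_pos n with rfl | hn
    · exact ⟨.leaf, hj, fun p q h1 h2 h3 h4 h5 => by omega⟩
    · obtain ⟨m, hm1, hm2, hm3, hm4⟩ : ∃ m, i < m ∧ m < j ∧ (H i m ∨ m = i + 1) ∧ ∀ m', m < m' → m' < j → ¬ H i m' := by
        classical
        obtain ⟨m, hm, hmax⟩ := Finset.exists_max_image ((Finset.Ioo i j).filter fun m => H i m ∨ m = i + 1) id
          ⟨i + 1, by simp; omega⟩
        simp only [Finset.mem_filter, Finset.mem_Ioo, id] at hm hmax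
        refine ⟨m, hm.1.1, hm.1.2, hm.2, fun m' h1 h2 h3 => ?_⟩
        have := hmax m' ⟨⟨by omega, h2⟩, Or.inl h3⟩
        omega
      obtain ⟨l, hl1, hl2⟩ := ih (m - i - 1) (by omega) i m (by omega) (by omega)
      obtain ⟨r, hr1, hr2⟩ := ih (j - m - 1) (by omega) m j (by omega) (by omega)
      refine ⟨.node l m r, ⟨hm1, hm2, hl1, hr1⟩, fun p q h1 h2 h3 h4 h5 => ?_⟩
      rcases le_or_gt q m with hq | hq
      · by_cases he : p = i ∧ q = m
        · exact Or.inl he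
        · exact Or.inr (Or.inr (Or.inl (hl2 p q h1 h2 hq h4 he)))
      · rcases le_or_gt m p with hp | hp
        · by_cases he : p = m ∧ q = j
          · exact Or.inr (Or.inl he)
          · exact Or.inr (Or.inr (Or.inr (hr2 p q hp h2 h3 h4 he)))
        · exfalso
          rcases eq_or_lt_of_le h1 with rfl | h1
          · exact hm4 q hq (by omega) h4
          · rcases hm3 with hm3 | hm3
            · exact hnc i p m q h1 hp hq (by omega) hm3 h4
            · omega

/-- parabola point -/
def pb (x : ℕ → ℝ) (m : ℕ) : Pt := (x m, -(x m)^2)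

theorem dt_pb (x : ℕ → ℝ) (i j m : ℕ) : dt (pb x i) (pb x j) (pb x m) = (x j - x i) * (x m - x i) * (x j - x m) := by
  simp only [dt, pb]; ring

theorem real_pb {x : ℕ → ℝ} {k : ℕ} (hx : ∀ i j, i < j → j < k → x i < x j) (t : BT ℕ) : ∀ (K : List Fn) (i j : ℕ), j < k →
    t.Od i j → (∀ m, i < m → m < j → InK K (pb x m)) → RealT (t.map (pb x)) K (pb x i) (pb x j) := by
  induction t with
  | leaf => exact fun _ _ _ _ _ _ => trivial
  | node l w r ihl ihr =>
    rintro K i j hjk ⟨h1, h2, h3, h4⟩ hK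
    have hev : ∀ m, ev (1, 0, - x w) (pb x m) = x m - x w := by intro m; simp only [ev, pb]; ring
    refine ⟨hK w h1 h2, (1, 0, - x w), ?_, ?_, ?_, ?_, ?_⟩
    · rw [hev]; ring
    · rw [hev]; linarith [hx i w h1 (by omega)]
    · rw [hev]; linarith [hx w j h2 (by omega)]
    · refine ihl _ i w (by omega) h3 fun m hm1 hm2 f hf => ?_
      have e1 := hx i m hm1 (by omega)
      have e2 := hx m w hm2 (by omega)
      simp only [List.mem_cons] at hf
      rcases hf with rfl | rfl | hf
      · rw [ev_lf, dt_pb]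
        exact mul_pos (mul_pos (by linarith) (by linarith)) (by linarith)
      · rw [ev_ng, hev]; linarith
      · exact hK m hm1 (by omega) f hf
    · refine ihr _ w j (by omega) h4 fun m hm1 hm2 f hf => ?_
      have e1 := hx w m hm1 (by omega)
      have e2 := hx m j hm2 (by omega)
      simp only [List.mem_cons] at hf
      rcases hf with rfl | rfl | hf
      · rw [ev_lf, dt_pb]
        exact mul_pos (mul_pos (by linarith) (by linarith)) (by linarith)
      · rw [hev]; linarith
      · exact hK m (by omega) hm2 f hf

theorem Aff.symm {f : Pt ≃ₜ Pt} (hf : Aff f) : Aff f.symm := by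
  intro p q s
  apply f.injective
  rw [hf]; simp

noncomputable def frameH (a b : Pt) (h : (b.1 - a.1)^2 + (b.2 - a.2)^2 ≠ 0) : Pt ≃ₜ Pt where
  toFun P := (a.1 + ((b.1 - a.1) * P.1 - (b.2 - a.2) * P.2), a.2 + ((b.2 - a.2) * P.1 + (b.1 - a.1) * P.2))
  invFun Q := (((b.1 - a.1) * (Q.1 - a.1) + (b.2 - a.2) * (Q.2 - a.2)) / ((b.1 - a.1)^2 + (b.2 - a.2)^2),
    (-(b.2 - a.2) * (Q.1 - a.1) + (b.1 - a.1) * (Q.2 - a.2)) / ((b.1 - a.1)^2 + (b.2 - a.2)^2))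
  left_inv P := by
    ext
    · simp only; rw [div_eq_iff h]; ring
    · simp only; rw [div_eq_iff h]; ring
  right_inv Q := by
    ext
    · simp only; rw [mul_div_assoc', mul_div_assoc', ← sub_div, ← eq_sub_iff_add_eq', div_eq_iff h]; ring
    · simp only; rw [mul_div_assoc', mul_div_assoc', ← add_div, ← eq_sub_iff_add_eq', div_eq_iff h]; ring
  continuous_toFun := by fun_prop
  continuous_invFun := by fun_prop

theorem frame_aff (a b : Pt) (h) : Aff (frameH a b h) := by
  intro p q s
  ext <;> simp [frameH] <;> ring

theorem frame0 (a b : Pt) (h) : frameH a b h (0, 0) = a := by simp [frameH]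
theorem frame1 (a b : Pt) (h) : frameH a b h (1, 0) = b := by simp [frameH]
theorem frame2 (a b : Pt) (h) : dt a b (frameH a b h (0, 1)) = (b.1 - a.1)^2 + (b.2 - a.2)^2 := by simp [frameH, dt]; ring

theorem nsq_pos' {a b : Pt} (h : a ≠ b) : 0 < (b.1 - a.1)^2 + (b.2 - a.2)^2 := by
  by_contra hn
  have h1 : b.1 - a.1 = 0 := by nlinarith [sq_nonneg (b.1 - a.1), sq_nonneg (b.2 - a.2)]
  have h2 : b.2 - a.2 = 0 := by nlinarith [sq_nonneg (b.1 - a.1), sq_nonneg (b.2 - a.2)]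
  exact h (Prod.ext (by linarith) (by linarith))

theorem exists_sim {a b a' b' : Pt} (h : a ≠ b) (h' : a' ≠ b') : ∃ (A : Pt ≃ₜ Pt) (d : Pt), Aff A ∧ A a = a' ∧ A b = b' ∧
    0 < dt a b d ∧ 0 < dt a' b' (A d) := by
  have n1 := nsq_pos' h
  have n2 := nsq_pos' h'
  refine ⟨(frameH a b n1.ne').symm.trans (frameH a' b' n2.ne'), frameH a b n1.ne' (0, 1), ?_, ?_, ?_, ?_, ?_⟩
  · exact (frame_aff a' b' n2.ne').comp (frame_aff a b n1.ne').symm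
  · have e : (frameH a b n1.ne').symm a = (0, 0) := by rw [Homeomorph.symm_apply_eq, frame0]
    rw [Homeomorph.trans_apply, e, frame0]
  · have e : (frameH a b n1.ne').symm b = (1, 0) := by rw [Homeomorph.symm_apply_eq, frame1]
    rw [Homeomorph.trans_apply, e, frame1]
  · rw [frame2]; exact n1
  · simp only [Homeomorph.trans_apply, Homeomorph.symm_apply_apply]
    rw [frame2]; exact n2

theorem Sg.symm {h : Pt ≃ₜ Pt} {p q : Pt} (hh : Sg h p q) : Sg h.symm (h p) (h q) := by
  unfold Sg at *
  rw [← hh, image_image]; simp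

theorem hull_edge {Y : Finset Pt} (hY : 2 ≤ Y.card) (hGP : GP (Y : Set Pt)) (hx : ∀ P ∈ Y, ∀ Q ∈ Y, P ≠ Q → P.1 ≠ Q.1) :
    ∃ a ∈ Y, ∃ b ∈ Y, a ≠ b ∧ ∀ P ∈ Y, P ≠ a → P ≠ b → 0 < dt a b P := by
  classical
  obtain ⟨a, ha, hmin⟩ := Finset.exists_min_image Y (fun P => P.1) (by rw [← Finset.card_pos]; omega)
  obtain ⟨b, hb, hbmin⟩ := Finset.exists_min_image (Y.erase a) (fun P => (P.2 - a.2) / (P.1 - a.1))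
    (by rw [← Finset.card_pos, Finset.card_erase_of_mem ha]; omega)
  rw [Finset.mem_erase] at hb
  refine ⟨a, ha, b, hb.2, hb.1.symm, fun P hP hPa hPb => ?_⟩
  have h1 : a.1 < b.1 := lt_of_le_of_ne (hmin b hb.2) (hx a ha b hb.2 hb.1.symm)
  have h2 : a.1 < P.1 := lt_of_le_of_ne (hmin P hP) (hx a ha P hP hPa.symm)
  have h3 := hbmin P (Finset.mem_erase.mpr ⟨hPa, hP⟩)
  rw [div_le_div_iff₀ (by linarith) (by linarith)] at h3
  refine lt_of_le_of_ne ?_ (hGP a ha b hb.2 P hP hb.1.symm hPa.symm hPb.symm).symm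
  simp only [dt]; linarith

theorem placing {k : ℕ} (hk : 2 ≤ k) {x : ℕ → ℝ} (hx : ∀ i j, i < j → j < k → x i < x j) (H : ℕ → ℕ → Prop)
    (hnc : ∀ a b c d, a < b → b < c → c < d → d < k → H a c → H b d → False) {Y : Finset Pt} (hY : Y.card = k)
    (hGP : GP (Y : Set Pt)) (hYx : ∀ P ∈ Y, ∀ Q ∈ Y, P ≠ Q → P.1 ≠ Q.1) :
    ∃ F : Pt ≃ₜ Pt, (∀ i, i < k → F (pb x i) ∈ Y) ∧ ∀ i j, i < j → j < k → H i j → Sg F (pb x i) (pb x j) := by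
  classical
  obtain ⟨t, hOd, hEd⟩ := exists_tree H hnc (k - 2) 0 (k - 1) (by omega) (by omega)
  have hsz := hOd.sz
  obtain ⟨a', ha', b', hb', hab', hpos'⟩ := hull_edge (by omega) hGP hYx
  have hab : pb x 0 ≠ pb x (k - 1) := fun h => (hx 0 (k - 1) (by omega) (by omega)).ne (congrArg Prod.fst h)
  obtain ⟨a, rfl⟩ : ∃ a, a = pb x 0 := ⟨_, rfl⟩
  obtain ⟨A, d, hA, hAa, hAb, hd, hd'⟩ := exists_sim hab hab'
  have hR1 := real_pb hx t [lf (pb x 0) (pb x (k - 1))] 0 (k - 1) (by omega) hOd (by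
    intro m h1 h2 f hf
    rw [List.mem_singleton] at hf
    rw [hf, ev_lf, dt_pb]
    have e1 := hx 0 m h1 (by omega)
    have e2 := hx m (k - 1) h2 (by omega)
    exact mul_pos (mul_pos (by linarith) (by linarith)) (by linarith))
  have hszsh : ∀ (α : Type) (t : BT α), t.sh.sz = t.sz := by
    intro α t
    induction t with
    | leaf => rfl
    | node l w r ihl ihr =>
      simp only [BT.sh, BT.map, BT.sz] at *; rw [ihl, ihr]
  have hshmap : (t.map (pb x)).sh = t.sh := by unfold BT.sh; rw [BT.map_map]
  obtain ⟨t2, ht2s, hR2, ht2Y⟩ := gritz t.sh [lf a' b'] a' b' ((Y.erase a').erase b') (by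
      rw [Finset.card_erase_of_mem (Finset.mem_erase.mpr ⟨hab'.symm, hb'⟩), Finset.card_erase_of_mem ha', hszsh]; omega)
    (by simp) (by
      intro P hP f hf
      rw [List.mem_singleton] at hf
      simp only [Finset.mem_erase] at hP
      rw [hf, ev_lf]; exact hpos' P hP.2.2 hP.2.1 hP.1)
    (hGP.mono (by
      rintro P (rfl | rfl | hP)
      · exact ha'
      · exact hb'
      · simp only [Finset.coe_erase] at hP; exact hP.1.1))
  have lfK : ∀ a b : Pt, (∀ l ∈ [lf a b], 0 ≤ ev l a) ∧ (∀ l ∈ [lf a b], 0 ≤ ev l b) := by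
    intro a b
    constructor <;> intro l hl <;> rw [List.mem_singleton] at hl <;> rw [hl, ev_lf]
    · rw [dt_self1]
    · rw [dt_self2]
  have lfd : ∀ a b d : Pt, 0 < dt a b d → InK [lf a b] d := by
    intro a b d hd l hl
    rw [List.mem_singleton] at hl; rw [hl, ev_lf]; exact hd
  obtain ⟨h1, h11, h12, h13⟩ := straighten _ _ _ _ d hR1 (by simp) (lfK _ _).1 (lfK _ _).2 (lfd _ _ _ hd)
  obtain ⟨h2, h21, h22, h23⟩ := straighten _ _ _ _ (A d) hR2 (by simp) (lfK _ _).1 (lfK _ _).2 (lfd _ _ _ hd')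
  have hsegfix : ∀ a b P : Pt, P ∈ segment ℝ a b → ¬ InK [lf a b] P := by
    intro a b P hP h
    have e1 := h (lf a b) (by simp)
    have e2 : 0 ≤ ev (ng (lf a b)) P := (ev_convex _).segment_subset (by rw [mem_ofPred_eq, ev_ng, ev_lf, dt_self1]; simp)
      (by rw [mem_ofPred_eq, ev_ng, ev_lf, dt_self2]; simp) hP
    rw [ev_ng] at e2; linarith
  have h1a := h11 _ (hsegfix _ _ _ (left_mem_segment ℝ (pb x 0) (pb x (k - 1))))
  have h1b := h11 _ (hsegfix _ _ _ (right_mem_segment ℝ (pb x 0) (pb x (k - 1))))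
  have h2a := h21 _ (hsegfix _ _ _ (left_mem_segment ℝ a' b'))
  have h2b := h21 _ (hsegfix _ _ _ (right_mem_segment ℝ a' b'))
  have hh2 : ∀ P, h2 P = P → h2.symm P = P := fun P h => by rw [Homeomorph.symm_apply_eq, h]
  have hFa : (((h1.trans A).trans h2.symm)) (pb x 0) = a' := by
    simp only [Homeomorph.trans_apply]; rw [h1a, hAa, hh2 _ h2a]
  have hFb : (((h1.trans A).trans h2.symm)) (pb x (k - 1)) = b' := by
    simp only [Homeomorph.trans_apply]; rw [h1b, hAb, hh2 _ h2b]
  have hFt : (t.map (pb x)).map ((h1.trans A).trans h2.symm) = t2 := by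
    have e1 : ((t.map (pb x)).map h1).map A = t2.map h2 := by
      rw [h12, std_aff hA, hAa, hAb, h22, hshmap, ht2s]
    have e2 := congrArg (BT.map h2.symm) e1
    rw [BT.map_map h2 h2.symm] at e2
    have e3 : (h2.symm ∘ h2 : Pt → Pt) = fun P => P := by ext1 P; simp
    rw [e3, BT.map_id, BT.map_map, BT.map_map] at e2
    exact e2
  refine ⟨(h1.trans A).trans h2.symm, ?_, ?_⟩
  · intro i hi
    rcases Nat.eq_zero_or_pos i with rfl | hi0
    · rw [hFa]; exact ha'
    · rcases Nat.lt_or_ge i (k - 1) with hi1 | hi1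
      · rw [← hFt, BT.Al_map, BT.Al_map] at ht2Y
        have := hOd.al ht2Y i hi0 hi1
        simp only [Finset.mem_erase] at this
        exact this.2.2
      · obtain rfl : i = k - 1 := by omega
        rw [hFb]; exact hb'
  · intro i j hij hjk hH
    by_cases hr : i = 0 ∧ j = k - 1
    · obtain ⟨rfl, rfl⟩ := hr
      have s1 : Sg h1 (pb x 0) (pb x (k - 1)) := Sg.of_aff (convex_segment _ _) Aff.id
        (fun P hP => h11 P (hsegfix _ _ _ hP)) (left_mem_segment ℝ _ _) (right_mem_segment ℝ _ _)
      have s2 : Sg A (h1 (pb x 0)) (h1 (pb x (k - 1))) := hA.seg _ _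
      have s3 : Sg h2.symm (A (h1 (pb x 0))) (A (h1 (pb x (k - 1)))) := by
        rw [h1a, h1b, hAa, hAb]
        exact Sg.of_aff (convex_segment _ _) Aff.id
          (fun P hP => hh2 P (h21 P (hsegfix _ _ _ hP))) (left_mem_segment ℝ _ _) (right_mem_segment ℝ _ _)
      exact (s1.comp s2).comp (g := h2.symm) (h := A ∘ h1) s3
    · have e1 := BT.Ed_map (pb x) t (hEd i j (Nat.zero_le _) hij (by omega) hH hr)
      have s1 := h13 _ _ e1
      have s2 : Sg A (h1 (pb x i)) (h1 (pb x j)) := hA.seg _ _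
      have e2 := BT.Ed_map ((h1.trans A).trans h2.symm) _ e1
      rw [hFa, hFb, hFt] at e2
      have s3 := (h23 _ _ e2).symm
      simp only [Homeomorph.trans_apply, Homeomorph.apply_symm_apply] at s3
      exact (s1.comp s2).comp (g := h2.symm) (h := A ∘ h1) s3

end Place
end SN


namespace SN
section Final

theorem seg_dt {p q X : Pt} (h : X ∈ segment ℝ p q) : dt p q X = 0 := by
  rw [seg_eq] at h
  obtain ⟨s, _, rfl⟩ := h
  rw [← ev_lf, ev_comb, ev_lf, ev_lf, dt_self1, dt_self2]; ring

theorem seg_share {p q r X : Pt} (h : dt p q r ≠ 0) (h1 : X ∈ segment ℝ p q) (h2 : X ∈ segment ℝ p r) : X = p := by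
  have e1 := seg_dt h1
  rw [seg_eq] at h2
  obtain ⟨s, _, rfl⟩ := h2
  simp only at e1 ⊢
  rw [← ev_lf, ev_comb, ev_lf, ev_lf, dt_self1] at e1
  have : s * dt p q r = 0 := by linarith
  rcases mul_eq_zero.mp this with h0 | h0
  · rw [h0]; simp
  · exact (h h0).elim

theorem seg_dj_aux {P Q R S X : Pt} (h : 0 < dt P Q R * dt P Q S) (h1 : X ∈ segment ℝ P Q) (h2 : X ∈ segment ℝ R S) : False := by
  have e1 := seg_dt h1
  rw [seg_eq] at h2
  obtain ⟨s, hs, rfl⟩ := h2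
  simp only at e1
  rw [← ev_lf, ev_comb, ev_lf, ev_lf] at e1
  rcases mul_pos_iff.mp h with ⟨h3, h4⟩ | ⟨h3, h4⟩
  · rcases eq_or_lt_of_le hs.1 with h0 | h0
    · rw [← h0] at e1; linarith
    · have := mul_pos h0 h4
      have := mul_nonneg (sub_nonneg.mpr hs.2) h3.le
      linarith
  · rcases eq_or_lt_of_le hs.1 with h0 | h0
    · rw [← h0] at e1; linarith
    · have := mul_neg_of_pos_of_neg h0 h4
      have := mul_nonpos_of_nonneg_of_nonpos (sub_nonneg.mpr hs.2) h3.le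
      linarith

theorem seg_dj {P Q R S X : Pt} (h : Dj P Q R S) (h1 : X ∈ segment ℝ P Q) (h2 : X ∈ segment ℝ R S) : False := by
  rcases h with h | h
  · exact seg_dj_aux h h1 h2
  · exact seg_dj_aux h h2 h1

/-- the segment of an unordered pair -/
def sgm {V : Type} (p : V → Pt) (e : Sym2 V) : Set Pt :=
  Sym2.lift ⟨fun u v => segment ℝ (p u) (p v), fun u v => segment_symm ℝ (p u) (p v)⟩ e

theorem SL.inj {V : Type} {G : SimpleGraph V} {p : V → ℝ × ℝ} (h : SL G p) : Function.Injective p := by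
  intro u v huv
  by_contra hne
  exact h.xinj u v hne (by rw [huv])

def PDsl {V : Type} [Fintype V] {G : SimpleGraph V} {p : V → ℝ × ℝ} (h : SL G p) : PlanarDrawing G where
  ρ := p
  inj := h.inj
  arc := sgm p
  arc_isArc u v huv := IsArc.segment (h.inj.ne huv.ne)
  vertex_mem e he w hw := by
    induction e with
    | _ u v =>
      have huv : G.Adj u v := he
      by_contra hn
      rw [Sym2.mem_iff, not_or] at hn
      exact h.gp u v w huv.ne (Ne.symm hn.1) (Ne.symm hn.2) (seg_dt hw)
  arcs_cross e he e' he' hne X hX := by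
    induction e with
    | _ a b =>
      induction e' with
      | _ c d =>
        have hab : G.Adj a b := he
        have hcd : G.Adj c d := he'
        have h1 : X ∈ segment ℝ (p a) (p b) := hX.1
        have h2 : X ∈ segment ℝ (p c) (p d) := hX.2
        by_cases hac : a = c
        · subst hac
          have hbd : b ≠ d := fun h => hne (by rw [h])
          exact ⟨a, by simp, by simp, seg_share (h.gp a b d hab.ne hcd.ne hbd) h1 h2⟩
        by_cases had : a = d
        · subst had
          have hbd : b ≠ c := fun h => hne (by rw [h, Sym2.eq_swap])
          rw [segment_symm] at h2
          exact ⟨a, by simp, by simp, seg_share (h.gp a b c hab.ne hcd.symm.ne hbd) h1 h2⟩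
        by_cases hbc : b = c
        · subst hbc
          rw [segment_symm] at h1
          exact ⟨b, by simp, by simp, seg_share (h.gp b a d hab.symm.ne hcd.ne had) h1 h2⟩
        by_cases hbd : b = d
        · subst hbd
          rw [segment_symm] at h1 h2
          exact ⟨b, by simp, by simp, seg_share (h.gp b a c hab.symm.ne hcd.symm.ne hac) h1 h2⟩
        exact (seg_dj (h.dj a b c d hab hcd hac had hbc hbd) h1 h2).elim

set_option maxHeartbeats 1000000 in
theorem main_big {V₁ V₂ : Type} [Fintype V₁] [Fintype V₂]
    (G₁ : SimpleGraph V₁) (G₂ : SimpleGraph V₂) (D1 : PlanarDrawing G₁) (D2 : PlanarDrawing G₂)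
    (hk : 2 ≤ Fintype.card V₂) (hcard : 2 * Fintype.card V₂ ≤ Fintype.card V₁) :
    ∃ (Γ₁ : PlanarDrawing G₁) (Γ₂ : PlanarDrawing G₂), IsSefeNoMap Γ₁ Γ₂ := by
  classical
  have : Nontrivial V₁ := Fintype.one_lt_card_iff_nontrivial.mp (by omega)
  have : Nontrivial V₂ := Fintype.one_lt_card_iff_nontrivial.mp (by omega)
  obtain ⟨p, hp⟩ := exists_SL (wplanar_of_drawing D2)
  obtain ⟨G', hle, hMax⟩ := exists_max G₁ (wplanar_of_drawing D1)
  obtain ⟨v1, v2, vn, ord, _, _, _, _, hTri⟩ := exists_triFace hMax (by omega)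
  obtain ⟨B, ⟨b0, hb0⟩, hBc, hCC, hdom⟩ := hTri.dominating
  obtain ⟨E, hE, sl, lab, hOP, hadj, hsurj, hcont⟩ := exists_slots hMax.planar (B := (B : Set V₁)) hb0 hCC hdom
  obtain ⟨S, hSB, hSc⟩ := Finset.exists_subset_card_eq (s := Finset.univ \ B) (n := Fintype.card V₂)
    (by rw [Finset.card_sdiff_of_subset (Finset.subset_univ _), Finset.card_univ]; omega)
  have hSB' : ∀ s ∈ S, s ∉ B := fun s hs => (Finset.mem_sdiff.mp (hSB hs)).2
  obtain ⟨Γ, x, hxi, hρ, hseg, hnc⟩ := base_drawing hOP hadj hsurj (S := (S : Set V₁))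
    (fun s hs => hcont s (hSB' s hs))
  obtain ⟨k, hkk⟩ : ∃ k, k = Fintype.card V₂ := ⟨_, rfl⟩
  have hXc : (S.image x).card = k := by rw [Finset.card_image_of_injective _ hxi, hSc, hkk]
  let xs : ℕ → ℝ := fun i => if h : i < k then (S.image x).orderEmbOfFin hXc ⟨i, h⟩ else 0
  have hxs : ∀ i (h : i < k), xs i = (S.image x).orderEmbOfFin hXc ⟨i, h⟩ := fun i h => dif_pos h
  have hxmono : ∀ i j, i < j → j < k → xs i < xs j := by
    intro i j hij hj
    rw [hxs i (by omega), hxs j hj]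
    exact (OrderEmbedding.lt_iff_lt _).mpr hij
  have hxmem : ∀ i, i < k → ∃ s ∈ S, x s = xs i := by
    intro i hi
    rw [hxs i hi]
    exact Finset.mem_image.mp (Finset.orderEmbOfFin_mem (S.image x) hXc ⟨i, hi⟩)
  have hxsurj : ∀ s ∈ S, ∃ i, i < k ∧ xs i = x s := by
    intro s hs
    have h1 : x s ∈ Set.range ((S.image x).orderEmbOfFin hXc) := by
      rw [Finset.range_orderEmbOfFin]; exact Finset.mem_coe.mpr (Finset.mem_image_of_mem x hs)
    obtain ⟨⟨i, hi⟩, h⟩ := h1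
    exact ⟨i, hi, by rw [hxs i hi, h]⟩
  obtain ⟨F, hF1, hF2⟩ := placing (k := k) (by omega) hxmono
    (fun i j => ∃ u ∈ S, ∃ v ∈ S, x u = xs i ∧ x v = xs j ∧ G'.Adj u v) (by
      rintro a b c d hab hbc hcd hd ⟨u, hu, u', hu', e1, e2, e3⟩ ⟨v, hv, v', hv', e4, e5, e6⟩
      refine hnc u hu v hv u' hu' v' hv' ?_ ?_ ?_ e3 e6
      · rw [e1, e4]; exact hxmono a b hab (by omega)
      · rw [e4, e2]; exact hxmono b c hbc (by omega)
      · rw [e2, e5]; exact hxmono c d hcd (by omega))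
    (Y := Finset.univ.image p) (by rw [Finset.card_image_of_injective _ hp.inj, Finset.card_univ, hkk])
    (by
      intro P hP Q hQ R hR h1 h2 h3
      simp only [Finset.coe_image, Finset.coe_univ, image_univ, mem_range] at hP hQ hR
      obtain ⟨u, rfl⟩ := hP
      obtain ⟨v, rfl⟩ := hQ
      obtain ⟨w, rfl⟩ := hR
      exact hp.gp u v w (fun h => h1 (by rw [h])) (fun h => h2 (by rw [h])) (fun h => h3 (by rw [h])))
    (by
      intro P hP Q hQ h1
      simp only [Finset.mem_image, Finset.mem_univ, true_and] at hP hQ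
      obtain ⟨u, rfl⟩ := hP
      obtain ⟨v, rfl⟩ := hQ
      exact hp.xinj u v (fun h => h1 (by rw [h])))
  have hpb : ∀ s i, xs i = x s → Γ.ρ s = pb xs i := by
    intro s i h; rw [hρ, pb, h]
  have hTY : S.image (fun s => F (Γ.ρ s)) = Finset.univ.image p := by
    apply Finset.eq_of_subset_of_card_le
    · intro P hP
      obtain ⟨s, hs, rfl⟩ := Finset.mem_image.mp hP
      obtain ⟨i, hi, hxi'⟩ := hxsurj s hs
      simp only [hpb s i hxi']
      exact hF1 i hi
    · rw [Finset.card_image_of_injective _ hp.inj, Finset.card_univ,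
        Finset.card_image_of_injective _ (show Function.Injective (fun s => F (Γ.ρ s)) from F.injective.comp Γ.inj), hSc]
  have hback : ∀ u w, F (Γ.ρ u) = p w → u ∈ S := by
    intro u w h
    have h1 : p w ∈ Finset.univ.image p := Finset.mem_image_of_mem _ (Finset.mem_univ _)
    rw [← hTY] at h1
    obtain ⟨s, hs, h2⟩ := Finset.mem_image.mp h1
    rw [← h] at h2
    rw [← Γ.inj (F.injective h2)]; exact hs
  refine ⟨PDmono hle (PDmap Γ F), PDsl hp, ?_, ?_⟩
  · rintro P ⟨w, rfl⟩
    have h1 : p w ∈ Finset.univ.image p := Finset.mem_image_of_mem _ (Finset.mem_univ _)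
    rw [← hTY] at h1
    obtain ⟨s, hs, h2⟩ := Finset.mem_image.mp h1
    exact ⟨s, h2⟩
  · intro u v a b huv hab heq
    have heq' : ({F (Γ.ρ u), F (Γ.ρ v)} : Set Pt) = {p a, p b} := heq
    have hS : u ∈ S ∧ v ∈ S := by
      rcases Set.pair_eq_pair_iff.mp heq' with ⟨h1, h2⟩ | ⟨h1, h2⟩ <;> exact ⟨hback _ _ h1, hback _ _ h2⟩
    have huv' := hle huv
    have hsg : Sg F (Γ.ρ u) (Γ.ρ v) := by
      obtain ⟨i, hi, hiu⟩ := hxsurj u hS.1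
      obtain ⟨j, hj, hjv⟩ := hxsurj v hS.2
      rcases lt_trichotomy i j with hij | hij | hij
      · rw [hpb u i hiu, hpb v j hjv]
        exact hF2 i j hij hj ⟨u, hS.1, v, hS.2, hiu.symm, hjv.symm, huv'⟩
      · subst hij
        exact (huv'.ne (hxi (hiu.symm.trans hjv))).elim
      · have := hF2 j i hij hi ⟨v, hS.2, u, hS.1, hjv.symm, hiu.symm, huv'.symm⟩
        rw [hpb u i hiu, hpb v j hjv]
        unfold Sg at this ⊢
        rw [segment_symm, this, segment_symm]
    change F '' Γ.arc s(u, v) = segment ℝ (p a) (p b)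
    rw [hseg u hS.1 v hS.2 huv', ← hρ, ← hρ, hsg]
    rcases Set.pair_eq_pair_iff.mp heq' with ⟨h1, h2⟩ | ⟨h1, h2⟩
    · rw [h1, h2]
    · rw [h1, h2, segment_symm]

theorem main_small {V₁ V₂ : Type} [Fintype V₁] [Fintype V₂]
    (G₁ : SimpleGraph V₁) (G₂ : SimpleGraph V₂) (D1 : PlanarDrawing G₁)
    (hk : Fintype.card V₂ ≤ 1) (hcard : 2 * Fintype.card V₂ ≤ Fintype.card V₁) :
    ∃ (Γ₁ : PlanarDrawing G₁) (Γ₂ : PlanarDrawing G₂), IsSefeNoMap Γ₁ Γ₂ := by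
  have hsub : ∀ a b : V₂, ¬ G₂.Adj a b := fun a b h => h.ne (Fintype.card_le_one_iff.mp hk a b)
  have hed : ∀ e, e ∉ G₂.edgeSet := by
    intro e
    induction e with
    | _ u v => exact hsub u v
  obtain ⟨f⟩ := Function.Embedding.nonempty_of_card_le (α := V₂) (β := V₁) (by omega)
  refine ⟨D1, ⟨fun v => D1.ρ (f v), D1.inj.comp f.injective, fun _ => ∅, fun u v h => (hsub u v h).elim,
    fun e he => (hed e he).elim, fun e he => (hed e he).elim⟩, ?_, fun u v a b _ h => (hsub a b h).elim⟩
  rintro P ⟨v, rfl⟩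
  exact ⟨f v, rfl⟩

end Final
end SN


/-- Every `n`-vertex planar graph and every planar graph with at most `n/2`
vertices admit a SefeNoMap. -/
theorem sefeNoMap_of_half {V₁ V₂ : Type} [Fintype V₁] [Fintype V₂]
    (G₁ : SimpleGraph V₁) (G₂ : SimpleGraph V₂) (n : ℕ)
    (hn : Fintype.card V₁ = n)
    (hplanar₁ : Nonempty (PlanarDrawing G₁)) (hplanar₂ : Nonempty (PlanarDrawing G₂))
    (hcard : 2 * Fintype.card V₂ ≤ n) :
    ∃ (Γ₁ : PlanarDrawing G₁) (Γ₂ : PlanarDrawing G₂), IsSefeNoMap Γ₁ Γ₂ := by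
  obtain ⟨D1⟩ := hplanar₁
  obtain ⟨D2⟩ := hplanar₂
  subst hn
  rcases Nat.lt_or_ge (Fintype.card V₂) 2 with h | h
  · exact SN.main_small G₁ G₂ D1 (by omega) hcard
  · exact SN.main_big G₁ G₂ D1 D2 h hcard
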